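/- Let (R, m) be an analytically unramified Cohen-Macaulay local ring of dimension d > 0 with infinite residue field and I an m-primary ideal with minimal reduction J. If ē₁(I) ≤ e₀(I) − λ(R/closure(I)) + 1, then the associated graded ring Ḡ of the normal filtration satisfies depth Ḡ ≥ d − 1. -/

import Mathlib

section StmtDefs

set_option synthInstance.maxHeartbeats 1000000
set_option maxHeartbeats 2000000

open IsLocalRing Polynomial Finset

variable {R : Type*}

/-- `x` is integral over the ideal `I`: it satisfies an equation
`x^n + a₁ x^{n-1} + ⋯ + aₙ = 0` with `aᵢ ∈ Iⁱ`. -/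
def IsIntegralOverIdeal [CommRing R] (I : Ideal R) (x : R) : Prop :=
  ∃ n : ℕ, 0 < n ∧ ∃ a : ℕ → R, (∀ i ∈ Finset.Icc 1 n, a i ∈ I ^ i) ∧
    x ^ n + ∑ i ∈ Finset.Icc 1 n, a i * x ^ (n - i) = 0

/-- The integral closure of an ideal (the set of integral elements is an ideal,
so the span equals it). -/
def intCl [CommRing R] (I : Ideal R) : Ideal R :=
  Ideal.span {x | IsIntegralOverIdeal I x}

/-- Length of a module, as the Krull dimension of its lattice of submodules. -/
noncomputable def mlen (R M : Type*) [CommRing R] [AddCommGroup M] [Module R M] :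
    WithBot ℕ∞ :=
  Order.krullDim (Submodule R M)

/-- The quotient module `N/(K ∩ N)` for ideals `N K`. -/
abbrev idealQuot [CommRing R] (N K : Ideal R) :=
  N ⧸ (Submodule.comap N.subtype K)

/-- Depth of `M` with respect to the ideal `J`: sup of lengths of `M`-regular
sequences contained in `J`. -/
noncomputable def rdepth (A : Type*) [CommRing A] (J : Ideal A)
    (M : Type*) [AddCommGroup M] [Module A M] : ℕ∞ :=
  sSup {n : ℕ∞ | ∃ rs : List A, (rs.length : ℕ∞) = n ∧ (∀ x ∈ rs, x ∈ J) ∧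
    RingTheory.Sequence.IsRegular M rs}

/-- A local ring is Cohen-Macaulay if its depth equals its Krull dimension. -/
def IsCMLocal (R : Type*) [CommRing R] [IsLocalRing R] : Prop :=
  (rdepth R (maximalIdeal R) R : WithBot ℕ∞) = ringKrullDim R

/-- A local ring is analytically unramified if its `m`-adic completion is reduced. -/
def AnalyticallyUnramified (R : Type*) [CommRing R] [IsLocalRing R] : Prop :=
  IsReduced (AdicCompletion (maximalIdeal R) R)

/-- An ideal is `m`-primary. -/
def IsMPrimary [CommRing R] [IsLocalRing R] (I : Ideal R) : Prop :=
  I.radical = maximalIdeal R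

/-- `J ⊆ I` is a minimal reduction: generated by `d = dim R` elements and
`I^{n+1} = J I^n` for `n ≫ 0`. -/
def IsMinimalReduction [CommRing R] (d : ℕ) (J I : Ideal R) : Prop :=
  J ≤ I ∧ (∃ s : Fin d → R, J = Ideal.span (Set.range s)) ∧
    ∃ N : ℕ, ∀ n ≥ N, I ^ (n + 1) = J * I ^ n

/-- Normal Hilbert data: `L n = λ(R/ intCl(I^{n+1}))` and for `n ≫ 0` this agrees
with the polynomial whose normalized coefficients are the `e i`. -/
def NormalHilbertData [CommRing R] (d : ℕ) (I : Ideal R) (L : ℕ → ℕ) (e : ℕ → ℤ) : Prop :=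
  (∀ n, mlen R (R ⧸ intCl (I ^ (n + 1))) = (L n : WithBot ℕ∞)) ∧
    ∃ N : ℕ, ∀ n ≥ N, (L n : ℤ) =
      ∑ i ∈ Finset.range (d + 1), (-1 : ℤ) ^ i * e i * ((n + d - i).choose (d - i))

/-- `t` is the Cohen-Macaulay type of the local ring `R` of dimension `d`:
`t = λ((Q : m)/Q)` for every ideal `Q` generated by a maximal regular sequence in `m`. -/
def CMTypeData (R : Type*) [CommRing R] [IsLocalRing R] (d t : ℕ) : Prop :=
  ∀ s : List R, s.length = d → (∀ x ∈ s, x ∈ maximalIdeal R) →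
    RingTheory.Sequence.IsRegular R s →
      mlen R (idealQuot ((Ideal.span {x | x ∈ s}).colon (maximalIdeal R))
        (Ideal.span {x | x ∈ s})) = (t : WithBot ℕ∞)

/-- The quotient module `N/(K ∩ N)` for submodules `N K` of a module. -/
abbrev submoduleQuot {A M : Type*} [CommRing A] [AddCommGroup M] [Module A M]
    (N K : Submodule A M) :=
  N ⧸ (Submodule.comap N.subtype K)

end StmtDefs


namespace DA
section P1
open MvPolynomial IsLocalRing Finset
variable {R : Type*} [CommRing R] {d : ℕ}

/-- a form is good if some coefficient is a unit -/
def Good [IsLocalRing R] (F : MvPolynomial (Fin d) R) : Prop :=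
  F ∉ (maximalIdeal R).map (C : R →+* MvPolynomial (Fin d) R)

theorem mccoy [IsLocalRing R] {F H : MvPolynomial (Fin d) R} (hF : Good F)
    {a : Ideal R} (h : F * H ∈ a.map (C : R →+* MvPolynomial (Fin d) R)) :
    H ∈ a.map (C : R →+* MvPolynomial (Fin d) R) := by
  classical
  let o : MonomialOrder (Fin d) := MonomialOrder.lex
  set hh : Ideal R := Ideal.span (↑(H.support.image (fun m => coeff m H)) : Set R) with hhdef
  have hmem : ∀ m, coeff m H ∈ hh := by
    intro m
    by_cases hm : m ∈ H.support
    · exact Ideal.subset_span (by simpa using ⟨m, by simpa using hm, rfl⟩)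
    · rw [notMem_support_iff.mp hm]; exact hh.zero_mem
  set b : Ideal R := a ⊔ maximalIdeal R • hh with hb
  have key : ∀ m, coeff m H ∈ b := by
    by_contra hcon
    push Not at hcon
    obtain ⟨m0, hm0⟩ := hcon
    have hFn : ∃ m, coeff m F ∉ maximalIdeal R := by
      by_contra h2
      push Not at h2
      exact hF (mem_map_C_iff.mpr h2)
    obtain ⟨n0, hn0⟩ := hFn
    -- maximal elements
    have e1 : (H.support.filter (fun m => coeff m H ∉ b)).Nonempty := by
      refine ⟨m0, ?_⟩
      simp only [mem_filter, mem_support_iff]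
      exact ⟨fun h0 => hm0 (h0 ▸ b.zero_mem), hm0⟩
    have e2 : (F.support.filter (fun m => coeff m F ∉ maximalIdeal R)).Nonempty := by
      refine ⟨n0, ?_⟩
      simp only [mem_filter, mem_support_iff]
      exact ⟨fun h0 => hn0 (h0 ▸ Ideal.zero_mem _), hn0⟩
    obtain ⟨ν, hν, hνmax⟩ := Finset.exists_max_image _ (fun m => o.toSyn m) e1
    obtain ⟨μ, hμ, hμmax⟩ := Finset.exists_max_image _ (fun m => o.toSyn m) e2
    simp only [mem_filter, mem_support_iff] at hν hμ hνmax hμmax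
    have hc : coeff (μ + ν) (F * H) ∈ b := (le_sup_left : a ≤ b) (mem_map_C_iff.mp h _)
    rw [coeff_mul] at hc
    have hsum : ∑ x ∈ (antidiagonal (μ + ν)).erase (μ, ν), coeff x.1 F * coeff x.2 H ∈ b := by
      refine Ideal.sum_mem _ ?_
      rintro ⟨p, q⟩ hpq
      rw [mem_erase, HasAntidiagonal.mem_antidiagonal] at hpq
      obtain ⟨hne, hpq⟩ := hpq
      simp only at hpq ⊢
      by_cases hq : coeff q H ∈ b
      · exact b.mul_mem_left _ hq
      by_cases hp : coeff p F ∈ maximalIdeal R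
      · exact (le_sup_right : _ ≤ b) (Submodule.smul_mem_smul hp (hmem q))
      exfalso
      have h1 := hνmax q ⟨fun h0 => hq (h0 ▸ b.zero_mem), hq⟩
      have h2 := hμmax p ⟨fun h0 => hp (h0 ▸ Ideal.zero_mem _), hp⟩
      have h3 : o.toSyn p + o.toSyn q = o.toSyn μ + o.toSyn ν := by
        rw [← map_add, ← map_add, hpq]
      have h4 : o.toSyn p = o.toSyn μ := by
        apply le_antisymm h2
        by_contra hlt
        exact absurd h3 (ne_of_lt (add_lt_add_of_lt_of_le (not_le.mp hlt) h1))
      have h5 : p = μ := o.toSyn.injective h4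
      subst h5
      exact hne (by rw [add_left_cancel hpq])
    have hin : (μ, ν) ∈ antidiagonal (μ + ν) := by simp
    rw [← add_sum_erase _ _ hin] at hc
    have h6 : coeff μ F * coeff ν H ∈ b := (Ideal.add_mem_iff_left _ hsum).mp hc
    have hu : IsUnit (coeff μ F) := by
      by_contra hnu
      exact hμ.2 ((mem_maximalIdeal _).mpr hnu)
    exact hν.2 ((Ideal.unit_mul_mem_iff_mem b hu).mp h6)
  have hle : hh ≤ a := by
    refine Submodule.le_of_le_smul_of_le_jacobson_bot (I := maximalIdeal R) ?_ ?_ ?_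
    · exact ⟨_, rfl⟩
    · exact (IsLocalRing.jacobson_eq_maximalIdeal ⊥ bot_ne_top).ge
    · rw [hhdef, Ideal.span_le]
      intro y hy
      simp only [coe_image, Set.mem_image] at hy
      obtain ⟨m, -, rfl⟩ := hy
      exact key m
  exact mem_map_C_iff.mpr fun m => hle (hmem m)

theorem Good.mul [IsLocalRing R] {F G : MvPolynomial (Fin d) R} (hF : Good F) (hG : Good G) :
    Good (F * G) := fun h => hG (mccoy hF h)

theorem good_one [IsLocalRing R] : Good (1 : MvPolynomial (Fin d) R) := by
  intro h
  have := mem_map_C_iff.mp h 0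
  rw [coeff_zero_one] at this
  exact (Ideal.ne_top_iff_one _).mp (maximalIdeal.isMaximal R).ne_top this

theorem Good.pow [IsLocalRing R] {F : MvPolynomial (Fin d) R} (hF : Good F) (n : ℕ) :
    Good (F ^ n) := by
  induction n with
  | zero => simpa using good_one
  | succ n ih => rw [pow_succ]; exact ih.mul hF

theorem good_X [IsLocalRing R] (i : Fin d) : Good (X i : MvPolynomial (Fin d) R) := by
  intro h
  have := mem_map_C_iff.mp h (Finsupp.single i 1)
  rw [coeff_X, if_pos rfl] at this
  exact (Ideal.ne_top_iff_one _).mp (maximalIdeal.isMaximal R).ne_top this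

/-- the ideal generated by `x` -/
def JJ (x : Fin d → R) : Ideal R := Ideal.span (Set.range x)

theorem eval_mem_pow (x : Fin d → R) {n : ℕ} {F : MvPolynomial (Fin d) R}
    (hF : F.IsHomogeneous n) : eval x F ∈ JJ x ^ n :=
  (Ideal.mem_span_pow_iff_exists_isHomogeneous x _).mpr ⟨F, hF, rfl⟩

theorem x_mem (x : Fin d → R) (i : Fin d) : x i ∈ JJ x := Ideal.subset_span ⟨i, rfl⟩

theorem mem_mul_pow (x : Fin d → R) (a : Ideal R) (n : ℕ) (z : R) :
    z ∈ a * JJ x ^ n ↔ ∃ F : MvPolynomial (Fin d) R, F.IsHomogeneous n ∧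
      F ∈ a.map (C : R →+* MvPolynomial (Fin d) R) ∧ eval x F = z := by
  constructor
  · intro hz
    refine Submodule.mul_induction_on hz ?_ ?_
    · intro r hr y hy
      obtain ⟨F, hF, rfl⟩ := (Ideal.mem_span_pow_iff_exists_isHomogeneous x y).mp hy
      refine ⟨C r * F, hF.C_mul r, Ideal.mul_mem_right _ _ (Ideal.mem_map_of_mem _ hr), by simp⟩
    · rintro y z ⟨F, hF, hFa, rfl⟩ ⟨G, hG, hGa, rfl⟩
      exact ⟨F + G, hF.add hG, Ideal.add_mem _ hFa hGa, by simp⟩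
  · rintro ⟨F, hF, hFa, rfl⟩
    rw [eval_eq']
    refine Ideal.sum_mem _ fun m hm => ?_
    refine Ideal.mul_mem_mul (mem_map_C_iff.mp hFa m) ?_
    have := eval_mem_pow x (isHomogeneous_monomial (1 : R)
      (d := m) (n := n) (hF.degree_eq_sum_deg_support hm ▸ rfl))
    rw [eval_monomial, one_mul, Finsupp.prod_fintype _ _ (by simp)] at this
    exact this

/-- quasi-regularity -/
def QR (x : Fin d → R) : Prop := ∀ (n : ℕ) (F : MvPolynomial (Fin d) R), F.IsHomogeneous n →
  eval x F = 0 → F ∈ (JJ x).map (C : R →+* MvPolynomial (Fin d) R)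

theorem QR.coeff_mem {x : Fin d → R} (hx : QR x) {a : Ideal R} (ha : JJ x ≤ a) {n : ℕ}
    {F : MvPolynomial (Fin d) R} (hF : F.IsHomogeneous n) (h : eval x F ∈ a * JJ x ^ n) :
    F ∈ a.map (C : R →+* MvPolynomial (Fin d) R) := by
  obtain ⟨G, hG, hGa, hGe⟩ := (mem_mul_pow x a n _).mp h
  have := hx n (F - G) (hF.sub hG) (by simp [hGe])
  have h2 := Ideal.map_mono (f := C) ha this
  simpa using Ideal.add_mem _ h2 hGa

theorem QR.coeff_mem_J {x : Fin d → R} (hx : QR x) {n : ℕ}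
    {F : MvPolynomial (Fin d) R} (hF : F.IsHomogeneous n) (h : eval x F ∈ JJ x ^ (n + 1)) :
    F ∈ (JJ x).map (C : R →+* MvPolynomial (Fin d) R) :=
  hx.coeff_mem le_rfl hF (by rwa [← pow_succ'])

theorem QR.tf [IsLocalRing R] {x : Fin d → R} (hx : QR x) {s n : ℕ}
    {F : MvPolynomial (Fin d) R} (hF : F.IsHomogeneous s) (hg : Good F) {z : R}
    (h : eval x F * z ∈ JJ x ^ (n + s)) : z ∈ JJ x ^ n := by
  have key : ∀ i ≤ n, z ∈ JJ x ^ i := by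
    intro i
    induction i with
    | zero => simp
    | succ i ih =>
      intro hi
      obtain ⟨H, hH, rfl⟩ := (Ideal.mem_span_pow_iff_exists_isHomogeneous x z).mp (ih (by omega))
      have h1 : F * H ∈ (JJ x).map (C : R →+* MvPolynomial (Fin d) R) := by
        refine hx.coeff_mem_J (hF.mul hH) ?_
        rw [eval_mul]
        exact Ideal.pow_le_pow_right (by omega) h
      have h2 := mccoy hg h1
      rw [pow_succ']
      exact (mem_mul_pow x _ _ _).mpr ⟨H, hH, h2, rfl⟩
  exact key n le_rfl

theorem QR.tf' [IsLocalRing R] {x : Fin d → R} (hx : QR x) {a : Ideal R} (ha : JJ x ≤ a)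
    {s n : ℕ} {F : MvPolynomial (Fin d) R} (hF : F.IsHomogeneous s) (hg : Good F) {z : R}
    (h : eval x F * z ∈ a * JJ x ^ (n + s)) : z ∈ a * JJ x ^ n := by
  have h0 : a * JJ x ^ (n + s) ≤ JJ x ^ (n + s) := Ideal.mul_le_right
  have h1 := hx.tf hF hg (h0 h)
  obtain ⟨H, hH, rfl⟩ := (Ideal.mem_span_pow_iff_exists_isHomogeneous x z).mp h1
  rw [← eval_mul] at h
  have h2 := mccoy hg (hx.coeff_mem ha (by rw [add_comm]; exact hF.mul hH) h)
  exact (mem_mul_pow x _ _ _).mpr ⟨H, hH, h2, rfl⟩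

end P1
end DA

namespace DA
section P2
open MvPolynomial IsLocalRing Finset
variable {R : Type*} [CommRing R]

theorem nzd_pow {d : ℕ} {x : Fin d → R} (hx : QR x) {y : R}
    (hy : ∀ z, y * z ∈ JJ x → z ∈ JJ x) (n : ℕ) (z : R) (h : y * z ∈ JJ x ^ n) :
    z ∈ JJ x ^ n := by
  have key : ∀ i ≤ n, z ∈ JJ x ^ i := by
    intro i
    induction i with
    | zero => simp
    | succ i ih =>
      intro hi
      obtain ⟨H, hH, rfl⟩ := (Ideal.mem_span_pow_iff_exists_isHomogeneous x z).mp (ih (by omega))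
      have h1 : C y * H ∈ (JJ x).map (C : R →+* MvPolynomial (Fin d) R) := by
        refine hx.coeff_mem_J (hH.C_mul y) ?_
        rw [eval_mul, eval_C]
        exact Ideal.pow_le_pow_right hi h
      rw [pow_succ']
      refine (mem_mul_pow x _ _ _).mpr ⟨H, hH, mem_map_C_iff.mpr fun m => hy _ ?_, rfl⟩
      have := mem_map_C_iff.mp h1 m
      rwa [coeff_C_mul] at this
  exact key n le_rfl

theorem QR_zero (x : Fin 0 → R) : QR x := by
  intro n F hF h
  have h1 : F = C (coeff 0 F) := by
    ext m
    rw [Subsingleton.elim m 0]; simp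
  rw [h1, eval_C] at h
  rw [h1, h]; simp

theorem QR_succ {n : ℕ} (x : Fin (n + 1) → R) (h : QR (x ∘ Fin.castSucc))
    (hr : ∀ z, x (Fin.last n) * z ∈ JJ (x ∘ Fin.castSucc) → z ∈ JJ (x ∘ Fin.castSucc)) :
    QR x := by
  have hle : JJ (x ∘ Fin.castSucc) ≤ JJ x := Ideal.span_mono (by
    rintro _ ⟨i, rfl⟩; exact ⟨_, rfl⟩)
  intro s
  induction s with
  | zero =>
    intro F hF h0
    have h1 : F = C (coeff 0 F) := by
      rw [← totalDegree_zero_iff_isHomogeneous] at hF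
      exact totalDegree_eq_zero_iff_eq_C.mp hF
    rw [h1, eval_C] at h0
    rw [h1, h0]; simp
  | succ s ih =>
    intro F hF h0
    set H := F.divMonomial (Finsupp.single (Fin.last n) 1) with hH
    set G := F.modMonomial (Finsupp.single (Fin.last n) 1) with hG
    have hdec : X (Fin.last n) * H + G = F := divMonomial_add_modMonomial_single F _
    have hHh : H.IsHomogeneous s := by
      intro m hm
      rw [hH, coeff_divMonomial] at hm
      have := hF hm
      simp only [map_add, Finsupp.weight_single, Pi.one_apply, smul_eq_mul] at this
      omega
    have hGh : G.IsHomogeneous (s + 1) := by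
      have : G = F - X (Fin.last n) * H := by rw [← hdec]; ring
      rw [this, add_comm s 1]
      exact (add_comm s 1 ▸ hF).sub ((isHomogeneous_X _ _).mul hHh)
    have hGr : ∃ G' : MvPolynomial (Fin n) R, rename Fin.castSucc G' = G := by
      refine exists_rename_eq_of_vars_subset_range G Fin.castSucc (Fin.castSucc_injective n) ?_
      intro i hi
      rw [mem_coe, mem_vars_iff_mem_support] at hi
      obtain ⟨m, hm, hmi⟩ := hi
      induction i using Fin.lastCases with
      | last =>
        exfalso
        rw [mem_support_iff, hG] at hm
        apply hm
        apply coeff_modMonomial_of_le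
        rw [Finsupp.single_le_iff]
        have := Finsupp.mem_support_iff.mp hmi
        omega
      | cast i => exact ⟨i, rfl⟩
    obtain ⟨G', hG'⟩ := hGr
    have hG'h : G'.IsHomogeneous (s + 1) := by
      rw [← IsHomogeneous.rename_isHomogeneous_iff (Fin.castSucc_injective n), hG']; exact hGh
    have e1 : x (Fin.last n) * eval x H + eval (x ∘ Fin.castSucc) G' = 0 := by
      rw [← h0, ← hdec, ← hG', eval_add, eval_mul, eval_X, eval_rename]
    have e2 : eval x H ∈ JJ (x ∘ Fin.castSucc) ^ (s + 1) := by
      refine nzd_pow h hr _ _ ?_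
      rw [eq_neg_of_add_eq_zero_left e1]
      exact neg_mem (eval_mem_pow _ hG'h)
    have e3 : H ∈ (JJ x).map (C : R →+* MvPolynomial (Fin (n + 1)) R) := by
      have e4 : eval x H ∈ JJ x ^ (s + 1) := Ideal.pow_right_mono hle _ e2
      rw [pow_succ'] at e4
      obtain ⟨H', h1, h2, h3⟩ := (mem_mul_pow x _ _ _).mp e4
      have := ih (H - H') (hHh.sub h1) (by simp [h3])
      simpa using Ideal.add_mem _ this h2
    obtain ⟨K, hK, hKe⟩ := (Ideal.mem_span_pow_iff_exists_isHomogeneous _ _).mp e2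
    have e5 := h (s + 1) (C (x (Fin.last n)) * K + G') ((hK.C_mul _).add hG'h) (by
      rw [eval_add, eval_mul, eval_C, hKe, e1])
    have e6 : G' ∈ (JJ x).map (C : R →+* MvPolynomial (Fin n) R) := by
      have a1 := Ideal.map_mono (f := (C : R →+* MvPolynomial (Fin n) R)) hle e5
      have a2 : C (x (Fin.last n)) * K ∈ (JJ x).map (C : R →+* MvPolynomial (Fin n) R) :=
        Ideal.mul_mem_right _ _ (Ideal.mem_map_of_mem _ (x_mem x _))
      simpa using Ideal.sub_mem _ a1 a2
    rw [← hdec, ← hG']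
    refine Ideal.add_mem _ (Ideal.mul_mem_left _ _ e3) ?_
    have := Ideal.mem_map_of_mem (rename (R := R) (Fin.castSucc : Fin n → Fin (n + 1))).toRingHom e6
    rw [Ideal.map_map] at this
    have e7 : ((rename (R := R) (Fin.castSucc : Fin n → Fin (n + 1))).toRingHom.comp C)
        = (C : R →+* MvPolynomial (Fin (n + 1)) R) := by
      ext; simp
    rw [e7] at this
    exact this

theorem QR_of_reg : ∀ {d : ℕ} (x : Fin d → R)
    (_ : ∀ i : Fin d, ∀ z, x i * z ∈ Ideal.span (x '' {j | j < i}) →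
      z ∈ Ideal.span (x '' {j | j < i})), QR x := by
  intro d
  induction d with
  | zero => intro x _; exact QR_zero x
  | succ n ih =>
    intro x hx
    refine QR_succ x (ih _ ?_) ?_
    · intro i z hz
      have := hx i.castSucc z
      have e : x '' {j | j < i.castSucc} = (x ∘ Fin.castSucc) '' {j | j < i} := by
        ext y; constructor
        · rintro ⟨j, hj, rfl⟩
          induction j using Fin.lastCases with
          | last => exact absurd hj (by simp [Fin.le_last])
          | cast j => exact ⟨j, by simpa using hj, rfl⟩
        · rintro ⟨j, hj, rfl⟩
          exact ⟨j.castSucc, by simpa using hj, rfl⟩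
      rw [e] at this
      exact this hz
    · intro z hz
      have := hx (Fin.last n) z
      have e : x '' {j | j < Fin.last n} = Set.range (x ∘ Fin.castSucc) := by
        ext y; constructor
        · rintro ⟨j, hj, rfl⟩
          induction j using Fin.lastCases with
          | last => exact absurd hj (by simp)
          | cast j => exact ⟨j, rfl⟩
        · rintro ⟨j, rfl⟩
          exact ⟨j.castSucc, by simp [Fin.castSucc_lt_last], rfl⟩
      rw [e] at this
      exact this hz

end P2
end DA

namespace DA
section P3
open IsLocalRing RingTheory.Sequence Pointwise

universe u

theorem le_dim_of_reg {R : Type u} [CommRing R] [IsLocalRing R] [IsNoetherianRing R] (rs : List R)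
    (hrs : ∀ r ∈ rs, r ∈ maximalIdeal R) :
    ∀ (M : Type u) [AddCommGroup M] [Module R M] [Module.Finite R M], IsRegular M rs →
    ∀ p : Ideal R, IsAssociatedPrime p M → (rs.length : WithBot ℕ∞) ≤ ringKrullDim (R ⧸ p) := by
  induction rs with
  | nil =>
    intro M _ _ _ _ p hp
    have : p.IsPrime := hp.1
    simpa using ringKrullDim_nonneg_of_nontrivial
  | cons a rs ih =>
    intro M _ _ _ hreg p hp
    rw [isRegular_cons_iff] at hreg
    obtain ⟨ha, hreg⟩ := hreg
    have ham : a ∈ maximalIdeal R := hrs a (by simp)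
    have hpp : p.IsPrime := hp.1
    obtain ⟨-, x, hx⟩ := isAssociatedPrime_iff.1 hp
    have hap : a ∉ p := by
      intro h
      rw [hx, Submodule.mem_colon_singleton] at h
      have hx0 : x = 0 := by
        have h' : a • x = a • (0 : M) := by simpa using h
        exact ha h'
      subst hx0
      apply hpp.ne_top
      rw [hx, Ideal.eq_top_iff_one, Submodule.mem_colon_singleton]
      simp
    -- the submodule killed by `p`
    let N : Submodule R M :=
      { carrier := {z | ∀ r ∈ p, r • z = 0}
        add_mem' := by
          intro z w hz hw r hr
          rw [smul_add, hz r hr, hw r hr, add_zero]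
        zero_mem' := by intro r _; simp
        smul_mem' := by
          intro c z hz r hr
          rw [smul_comm, hz r hr, smul_zero] }
    have hxN : x ∈ N := by
      intro r hr
      rw [hx, Submodule.mem_colon_singleton] at hr
      simpa using hr
    have hx0 : x ≠ 0 := by
      rintro rfl
      apply hpp.ne_top
      rw [hx, Ideal.eq_top_iff_one, Submodule.mem_colon_singleton]
      simp
    have hNa : ∃ z ∈ N, z ∉ a • (⊤ : Submodule R M) := by
      by_contra! hcon
      have : N ≤ (maximalIdeal R) • N := by
        intro z hz
        obtain ⟨y, -, hy⟩ := Submodule.mem_smul_pointwise_iff_exists _ _ _ |>.1 (hcon z hz)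
        have hyN : y ∈ N := by
          intro r hr
          have h' : a • (r • y) = a • (0 : M) := by
            rw [smul_comm, hy, hz r hr, smul_zero]
          exact ha h'
        rw [← hy]
        exact Submodule.smul_mem_smul ham hyN
      have hN0 : N = ⊥ :=
        Submodule.eq_bot_of_le_smul_of_le_jacobson_bot (maximalIdeal R) N
          (IsNoetherian.noetherian N) this (IsLocalRing.maximalIdeal_le_jacobson _)
      rw [hN0] at hxN
      exact hx0 (by simpa using hxN)
    obtain ⟨z, hzN, hza⟩ := hNa
    let zb : QuotSMulTop a M := Submodule.Quotient.mk z
    have hzb : zb ≠ 0 := by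
      intro h
      exact hza ((Submodule.Quotient.mk_eq_zero _).1 h)
    obtain ⟨q, hq, hzq⟩ := exists_le_isAssociatedPrime_of_isNoetherianRing R zb hzb
    have hpq : p ≤ q := by
      intro r hr
      apply hzq
      rw [Submodule.mem_colon_singleton]
      have : r • zb = Submodule.Quotient.mk (r • z) := rfl
      rw [this, hzN r hr]
      simp
    have haq : a ∈ q := by
      apply hzq
      rw [Submodule.mem_colon_singleton]
      have : a • zb = Submodule.Quotient.mk (a • z) := rfl
      rw [this, Submodule.mem_bot, Submodule.Quotient.mk_eq_zero]
      exact Submodule.smul_mem_pointwise_smul _ _ _ trivial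
    have h1 := ih (fun r hr => hrs r (by simp [hr])) (QuotSMulTop a M) hreg q hq
    have h2 := ringKrullDim_succ_le_of_surjective (Ideal.Quotient.factor hpq)
      (Ideal.Quotient.factor_surjective hpq) (r := Ideal.Quotient.mk p a)
      (by
        rw [mem_nonZeroDivisors_iff_ne_zero]
        rwa [Ne, Ideal.Quotient.eq_zero_iff_mem])
      (by simpa [Ideal.Quotient.eq_zero_iff_mem] using haq)
    refine le_trans ?_ h2
    rw [List.length_cons, Nat.cast_add, Nat.cast_one]
    gcongr

theorem reg_of_card {R : Type u} [CommRing R] [IsLocalRing R] [IsNoetherianRing R] (ys : List R)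
    (hys : ∀ r ∈ ys, r ∈ maximalIdeal R) (k : ℕ) :
    ∀ (M : Type u) [AddCommGroup M] [Module R M] [Module.Finite R M],
    (∃ rs : List R, rs.length = ys.length ∧ (∀ r ∈ rs, r ∈ maximalIdeal R) ∧ IsRegular M rs) →
    maximalIdeal R ^ k ≤ Ideal.ofList ys ⊔ Module.annihilator R M → IsWeaklyRegular M ys := by
  induction ys with
  | nil => intros; exact IsWeaklyRegular.nil _ _
  | cons y ys ih =>
    intro M _ _ _ ⟨rs, hlen, hrs, hreg⟩ hk
    have hym : y ∈ maximalIdeal R := hys y (by simp)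
    have hyreg : IsSMulRegular M y := by
      by_contra hcon
      have : y ∈ ⋃ p ∈ associatedPrimes R M, (p : Set R) := by
        rw [biUnion_associatedPrimes_eq_compl_regular]
        exact hcon
      simp only [Set.mem_iUnion, SetLike.mem_coe] at this
      obtain ⟨p, hp, hyp⟩ := this
      have hpp : p.IsPrime := hp.1
      have h1 := le_dim_of_reg rs hrs M hreg p hp
      have hann : Module.annihilator R M ≤ p := by
        obtain ⟨-, x, hx⟩ := isAssociatedPrime_iff.1 hp
        intro r hr
        rw [hx, Submodule.mem_colon_singleton]
        rw [Module.mem_annihilator] at hr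
        simp [hr]
      classical
      let s : Finset (R ⧸ p) := ys.toFinset.image (Ideal.Quotient.mk p)
      have : IsLocalRing (R ⧸ p) := 
        IsLocalRing.of_surjective' (Ideal.Quotient.mk p) Ideal.Quotient.mk_surjective
      have hsm : ∀ r ∈ maximalIdeal R, Ideal.Quotient.mk p r ∈ maximalIdeal (R ⧸ p) := by
        intro r hr
        rw [IsLocalRing.mem_maximalIdeal, mem_nonunits_iff]
        intro hu
        have := IsLocalRing.of_surjective' (Ideal.Quotient.mk p) Ideal.Quotient.mk_surjective
        obtain ⟨b, hb⟩ := hu.exists_right_inv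
        obtain ⟨b, rfl⟩ := Ideal.Quotient.mk_surjective b
        rw [← map_mul, ← map_one (Ideal.Quotient.mk p), Ideal.Quotient.eq] at hb
        have h2 := IsLocalRing.le_maximalIdeal hpp.ne_top hb
        have h3 : (1 : R) ∈ maximalIdeal R := by
          have := Ideal.sub_mem _ (Ideal.mul_mem_right b _ hr) h2
          rwa [sub_sub_cancel] at this
        exact (Ideal.ne_top_iff_one _).1 (maximalIdeal.isMaximal R).ne_top h3
      have h2 := ringKrullDim_le_ringKrullDim_quotient_add_card s (by
        intro t ht
        simp only [s, Finset.coe_image, Set.mem_image, List.coe_toFinset, Set.mem_ofPred_eq] at ht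
        obtain ⟨r, hr, rfl⟩ := ht
        rw [IsLocalRing.ringJacobson_eq_maximalIdeal]
        exact hsm r (hys r (by simp [hr])))
      have h3 : ringKrullDim ((R ⧸ p) ⧸ Ideal.span (s : Set (R ⧸ p))) ≤ 0 := by
        rw [← Nat.cast_zero, ← Ring.krullDimLE_iff, Ring.krullDimLE_zero_iff]
        intro P hP
        let f : R →+* ((R ⧸ p) ⧸ Ideal.span (s : Set (R ⧸ p))) :=
          (Ideal.Quotient.mk _).comp (Ideal.Quotient.mk p)
        have hf : Function.Surjective f := 
          Ideal.Quotient.mk_surjective.comp Ideal.Quotient.mk_surjective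
        have hPf : (P.comap f).IsPrime := Ideal.IsPrime.comap f
        have hmle : maximalIdeal R ≤ P.comap f := by
          have : maximalIdeal R ^ k ≤ P.comap f := by
            refine hk.trans (sup_le ?_ ?_)
            · rw [Ideal.ofList, Ideal.span_le]
              intro r hr
              have hr0 : f r = 0 := by
                rcases List.mem_cons.1 hr with rfl | hr
                · have : Ideal.Quotient.mk p r = 0 := Ideal.Quotient.eq_zero_iff_mem.2 hyp
                  simp [f, this]
                · simp only [f, RingHom.comp_apply, Ideal.Quotient.eq_zero_iff_mem]
                  apply Ideal.subset_span
                  simp only [s, Finset.coe_image, Set.mem_image, List.coe_toFinset,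
                    Set.mem_ofPred_eq]
                  exact ⟨r, hr, rfl⟩
              simp [hr0]
            · intro r hr
              have : Ideal.Quotient.mk p r = 0 := Ideal.Quotient.eq_zero_iff_mem.2 (hann hr)
              simp [f, this]
          exact hPf.le_of_pow_le this
        have : P.comap f = maximalIdeal R := 
          ((maximalIdeal.isMaximal R).eq_of_le hPf.ne_top hmle).symm
        have hmax : (P.comap f).IsMaximal := this ▸ maximalIdeal.isMaximal R
        rcases Ideal.map_eq_top_or_isMaximal_of_surjective f hf hmax with h | h
        · rw [Ideal.map_comap_of_surjective f hf] at h
          exact absurd h hP.ne_top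
        · rwa [Ideal.map_comap_of_surjective f hf] at h
      have h4 : s.card ≤ ys.length := Finset.card_image_le.trans (List.toFinset_card_le ys)
      have h5 : ((ys.length + 1 : ℕ) : WithBot ℕ∞) ≤ (ys.length : ℕ) := by
        rw [hlen, List.length_cons] at h1
        refine h1.trans (h2.trans ?_)
        calc _ ≤ (0 : WithBot ℕ∞) + (s.card : WithBot ℕ∞) := by gcongr
          _ = (s.card : WithBot ℕ∞) := zero_add _
          _ ≤ _ := by exact_mod_cast h4
      have : ys.length + 1 ≤ ys.length := by exact_mod_cast h5
      omega
    rw [isWeaklyRegular_cons_iff]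
    refine ⟨hyreg, ih (fun r hr => hys r (by simp [hr])) _ ?_ ?_⟩
    · -- Rees
      have : Nontrivial M := hreg.nontrivial
      have hlt : maximalIdeal R • (⊤ : Submodule R M) < ⊤ := by
        rw [lt_top_iff_ne_top]
        intro h
        have := Submodule.eq_bot_of_le_smul_of_le_jacobson_bot (maximalIdeal R) (⊤ : Submodule R M)
          Module.Finite.fg_top h.ge (IsLocalRing.maximalIdeal_le_jacobson _)
        exact top_ne_bot this
      have hlt' : maximalIdeal R • (⊤ : Submodule R (QuotSMulTop y M)) < ⊤ := by
        rw [lt_top_iff_ne_top]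
        intro eq
        have := congrArg (Submodule.comap (Submodule.mkQ _)) eq
        have h2 : maximalIdeal R • (⊤ : Submodule R M) = ⊤ := by
          simpa [Submodule.comap_smul_top_of_surjective _ _ (Submodule.mkQ_surjective _),
            Submodule.smul_mono_left ((Ideal.span_singleton_le_iff_mem _).mpr hym),
            ← Submodule.ideal_span_singleton_smul] using this
        exact hlt.ne h2
      have e12 := (ModuleCat.exists_isRegular_tfae (maximalIdeal R) (ys.length + 1)
        (ModuleCat.of R M) hlt).out 3 1
      have h12 := e12.1 ⟨rs, by simpa using hlen, hrs, hreg⟩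
      have e13 := (ModuleCat.exists_isRegular_tfae (maximalIdeal R) (ys.length)
        (ModuleCat.of R (QuotSMulTop y M)) hlt').out 1 3
      have := e13.1 (by
          intro i hi
          have zero1 := AddCommGrpCat.isZero_of_iff_subsingleton.mpr (h12 i (by omega))
          have zero2 := AddCommGrpCat.isZero_of_iff_subsingleton.mpr (h12 (i + 1) (by omega))
          exact AddCommGrpCat.subsingleton_of_isZero <|
            CategoryTheory.ShortComplex.Exact.isZero_of_both_zeros
            ((CategoryTheory.Abelian.Ext.covariant_sequence_exact₃' _
              (IsSMulRegular.smulShortComplex_shortExact (M := ModuleCat.of R M) hyreg)) i (i + 1) rfl)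
            (zero1.eq_zero_of_src _) (zero2.eq_zero_of_tgt _))
      exact this
    · refine hk.trans ?_
      rw [Ideal.ofList_cons]
      refine sup_le (sup_le ?_ le_sup_left) ?_
      · refine le_trans ?_ le_sup_right
        rw [Ideal.span_singleton_le_iff_mem, Module.mem_annihilator]
        intro z
        obtain ⟨z, rfl⟩ := Submodule.Quotient.mk_surjective _ z
        rw [← Submodule.Quotient.mk_smul, Submodule.Quotient.mk_eq_zero]
        exact Submodule.smul_mem_pointwise_smul _ _ _ trivial
      · refine le_trans ?_ le_sup_right
        intro r hr
        rw [Module.mem_annihilator] at hr ⊢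
        intro z
        obtain ⟨z, rfl⟩ := Submodule.Quotient.mk_surjective _ z
        rw [← Submodule.Quotient.mk_smul, hr z]
        simp

theorem exists_reg_of_CM {R : Type u} [CommRing R] [IsLocalRing R] {d : ℕ}
    (hdim : ringKrullDim R = d) (hCM : IsCMLocal R) :
    ∃ rs : List R, rs.length = d ∧ (∀ r ∈ rs, r ∈ maximalIdeal R) ∧ IsRegular R rs := by
  rw [IsCMLocal, hdim] at hCM
  have h : rdepth R (maximalIdeal R) R = (d : ℕ∞) := by exact_mod_cast hCM
  rw [rdepth] at h
  have hne : Set.Nonempty {n : ℕ∞ | ∃ rs : List R, (rs.length : ℕ∞) = n ∧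
      (∀ x ∈ rs, x ∈ maximalIdeal R) ∧ RingTheory.Sequence.IsRegular R rs} :=
    ⟨0, [], by simp, by simp, by simp [isRegular_iff]⟩
  rcases Nat.eq_zero_or_pos d with rfl | hd
  · exact ⟨[], by simp, by simp, by simp [isRegular_iff]⟩
  have hlt : ((d - 1 : ℕ) : ℕ∞) < sSup {n : ℕ∞ | ∃ rs : List R, (rs.length : ℕ∞) = n ∧
      (∀ x ∈ rs, x ∈ maximalIdeal R) ∧ RingTheory.Sequence.IsRegular R rs} := by
    rw [h]; exact_mod_cast Nat.sub_lt hd one_pos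
  obtain ⟨b, ⟨rs, hb, hm, hr⟩, hlt⟩ := lt_sSup_iff.1 hlt
  have hle : b ≤ (d : ℕ∞) := h ▸ le_sSup ⟨rs, hb, hm, hr⟩
  refine ⟨rs, ?_, hm, hr⟩
  rw [← hb] at hle hlt
  have h1 : rs.length ≤ d := by exact_mod_cast hle
  have h2 : d - 1 < rs.length := by exact_mod_cast hlt
  omega

theorem QR_of_CM {R : Type u} [CommRing R] [IsLocalRing R] [IsNoetherianRing R] {d : ℕ}
    (hdim : ringKrullDim R = d) (hCM : IsCMLocal R) (x : Fin d → R)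
    (hx : JJ x ≤ maximalIdeal R) (k : ℕ) (hk : maximalIdeal R ^ k ≤ JJ x) : QR x := by
  obtain ⟨rs, hl, hm, hr⟩ := exists_reg_of_CM hdim hCM
  have hw : IsWeaklyRegular R (List.ofFn x) := by
    apply reg_of_card (List.ofFn x) _ k R
    · exact ⟨rs, by simpa using hl, hm, hr⟩
    · refine hk.trans (le_trans ?_ le_sup_left)
      rw [JJ, Ideal.ofList]
      apply Ideal.span_mono
      rintro _ ⟨i, rfl⟩
      simp [List.mem_ofFn]
    · intro r hr
      rw [List.mem_ofFn] at hr
      obtain ⟨i, rfl⟩ := hr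
      exact hx (x_mem x i)
  rw [isWeaklyRegular_iff_Fin] at hw
  apply QR_of_reg
  intro i z hz
  have h := hw ⟨i, by simp⟩
  have e : (Ideal.ofList (List.take (i : ℕ) (List.ofFn x)) • ⊤ : Submodule R R)
      = Ideal.span (x '' {j | j < i}) := by
    rw [smul_eq_mul, Ideal.mul_top, Ideal.ofList]
    congr 1
    ext r
    simp only [Set.mem_ofPred_eq, List.mem_take_iff_getElem, List.getElem_ofFn, Set.mem_image,
      List.length_ofFn]
    constructor
    · rintro ⟨j, hj, rfl⟩
      exact ⟨⟨j, by omega⟩, Fin.lt_def.2 (by simp; omega), rfl⟩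
    · rintro ⟨j, hj, rfl⟩
      exact ⟨j, by have := Fin.lt_def.1 hj; omega, rfl⟩
  have h2 : x i • (Submodule.Quotient.mk z : R ⧸ (Ideal.ofList (List.take (i : ℕ) (List.ofFn x)) • ⊤ : Submodule R R)) = x i • 0 := by
    rw [← Submodule.Quotient.mk_smul, smul_zero, Submodule.Quotient.mk_eq_zero, e]
    exact hz
  simp only [List.getElem_ofFn, Fin.getElem_fin] at h
  have h3 := h h2
  rw [Submodule.Quotient.mk_eq_zero, e] at h3
  exact h3

end P3
end DA

namespace DA
section P4
open MvPolynomial IsLocalRing Finset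
variable {R : Type*} [CommRing R] {d : ℕ}

/-- relative length -/
noncomputable def ql (a b : Ideal R) : ℕ∞ :=
  Module.length R (a ⧸ Submodule.comap a.subtype b)

/-- length of the quotient ring -/
noncomputable def qlen (b : Ideal R) : ℕ∞ := Module.length R (R ⧸ b)

theorem qlen_eq_add {a b : Ideal R} (h : b ≤ a) : qlen b = ql a b + qlen a := by
  refine Module.length_eq_add_of_exact
    (Submodule.mapQ (Submodule.comap a.subtype b) b a.subtype le_rfl)
    (Submodule.mapQ b a LinearMap.id h) ?_ ?_ ?_
  · rw [← LinearMap.ker_eq_bot, Submodule.ker_mapQ]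
    simp
  · rintro ⟨z⟩
    exact ⟨Submodule.Quotient.mk z, rfl⟩
  · rintro ⟨z⟩
    constructor
    · intro hz
      have : z ∈ a := (Submodule.Quotient.mk_eq_zero _).1 hz
      exact ⟨Submodule.Quotient.mk ⟨z, this⟩, rfl⟩
    · rintro ⟨⟨w⟩, hw⟩
      have : Submodule.Quotient.mk z = (0 : R ⧸ a) := by
        have h1 : (Submodule.Quotient.mk z : R ⧸ b) = Submodule.Quotient.mk (w : R) := hw.symm
        rw [Submodule.Quotient.eq] at h1
        rw [Submodule.Quotient.mk_eq_zero]
        have := a.add_mem (h h1) w.2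
        simpa using this
      exact this

theorem qlen_mono {a b : Ideal R} (h : b ≤ a) : qlen a ≤ qlen b := by
  rw [qlen_eq_add h]; exact le_add_self

/-- degree `n` monomials -/
abbrev Mon (d n : ℕ) := {μ : Fin d →₀ ℕ // μ ∈ finsuppAntidiag (univ : Finset (Fin d)) n}

theorem mem_mon {n : ℕ} {μ : Fin d →₀ ℕ} :
    μ ∈ finsuppAntidiag (univ : Finset (Fin d)) n ↔ μ.degree = n := by
  simp [mem_finsuppAntidiag, Finsupp.degree_eq_sum]

theorem card_mon (d n : ℕ) : Fintype.card (Mon d n) = (d + n - 1).choose n := by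
  rw [Fintype.card_coe, card_finsuppAntidiag_nat_eq_choose]
  simp

/-- the form with given coefficients -/
noncomputable def form {n : ℕ} (c : Mon d n → R) : MvPolynomial (Fin d) R :=
  ∑ μ : Mon d n, monomial μ.1 (c μ)

theorem form_hom {n : ℕ} (c : Mon d n → R) : (form c).IsHomogeneous n := by
  refine IsHomogeneous.sum _ _ _ fun μ _ => isHomogeneous_monomial _ ?_
  exact mem_mon.1 μ.2

theorem coeff_form {n : ℕ} (c : Mon d n → R) (μ : Mon d n) : coeff μ.1 (form c) = c μ := by
  classical
  rw [form, coeff_sum, Finset.sum_eq_single μ]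
  · rw [coeff_monomial, if_pos rfl]
  · intro ν _ hne
    rw [coeff_monomial, if_neg]
    intro h; exact hne (Subtype.ext h)
  · simp

theorem form_coeff {n : ℕ} {F : MvPolynomial (Fin d) R} (hF : F.IsHomogeneous n) :
    form (fun μ : Mon d n => coeff μ.1 F) = F := by
  ext μ
  by_cases h : μ.degree = n
  · exact coeff_form (fun μ : Mon d n => coeff μ.1 F) ⟨μ, mem_mon.2 h⟩
  · rw [hF.coeff_eq_zero h, (form_hom _).coeff_eq_zero h]

theorem form_mem {n : ℕ} (c : Mon d n → R) (a : Ideal R) :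
    form c ∈ a.map (C : R →+* MvPolynomial (Fin d) R) ↔ ∀ μ, c μ ∈ a := by
  constructor
  · intro h μ
    have := mem_map_C_iff.mp h μ.1
    rwa [coeff_form] at this
  · intro h
    refine mem_map_C_iff.mpr fun μ => ?_
    by_cases hd : μ.degree = n
    · have := coeff_form c ⟨μ, mem_mon.2 hd⟩
      simp only at this
      rw [this]
      exact h _
    · rw [(form_hom _).coeff_eq_zero hd]
      exact a.zero_mem

/-- the value of a form as a linear map in the coefficients -/
noncomputable def formL (x : Fin d → R) (n : ℕ) : (Mon d n → R) →ₗ[R] (JJ x ^ n : Ideal R) where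
  toFun c := ⟨eval x (form c), eval_mem_pow x (form_hom c)⟩
  map_add' c c' := by
    ext
    simp [form, Finset.sum_add_distrib]
  map_smul' r c := by
    ext
    simp only [form, map_sum, eval_monomial, Pi.smul_apply, smul_eq_mul, RingHom.id_apply,
      SetLike.val_smul, Finset.mul_sum, mul_assoc]

theorem ql_pow {x : Fin d → R} (hx : QR x) {a : Ideal R} (ha : JJ x ≤ a) (n : ℕ) :
    ql (JJ x ^ n) (a * JJ x ^ n) = ((d + n - 1).choose n : ℕ∞) * qlen a := by
  classical
  let f := (Submodule.mkQ (Submodule.comap (JJ x ^ n : Ideal R).subtype (a * JJ x ^ n))).comp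
    (formL x n)
  have hf : Function.Surjective f := by
    refine (Submodule.mkQ_surjective _).comp ?_
    rintro ⟨z, hz⟩
    obtain ⟨F, hF, rfl⟩ := (Ideal.mem_span_pow_iff_exists_isHomogeneous x z).mp hz
    refine ⟨fun μ => coeff μ.1 F, ?_⟩
    ext
    simp [formL, form_coeff hF]
  have hker : LinearMap.ker f = Submodule.pi Set.univ (fun _ : Mon d n => a) := by
    ext c
    simp only [f, LinearMap.mem_ker, LinearMap.comp_apply, Submodule.mkQ_apply,
      Submodule.Quotient.mk_eq_zero, Submodule.mem_comap, Submodule.mem_pi, Set.mem_univ,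
      true_implies]
    rw [← form_mem]
    constructor
    · intro h
      exact hx.coeff_mem ha (form_hom c) h
    · intro h
      exact (mem_mul_pow x a n _).2 ⟨form c, form_hom c, h, rfl⟩
  have e1 := (LinearMap.quotKerEquivOfSurjective f hf).length_eq
  have e2 := (Submodule.quotEquivOfEq _ _ hker).length_eq
  have e3 := (Submodule.quotientPi (fun _ : Mon d n => a)).length_eq
  rw [ql, ← e1, e2, e3, Module.length_pi_of_fintype]
  simp only [Finset.sum_const, Finset.card_univ, nsmul_eq_mul]
  rw [card_mon]
  rfl

theorem qlen_top : qlen (⊤ : Ideal R) = 0 := by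
  rw [qlen, Module.length_eq_zero_iff]
  exact Submodule.Quotient.subsingleton_iff.2 rfl

theorem qlen_pow {x : Fin d → R} (hd : 0 < d) (hx : QR x) (n : ℕ) :
    qlen (JJ x ^ n) = ((n + d - 1).choose d : ℕ∞) * qlen (JJ x) := by
  induction n with
  | zero => 
    rw [pow_zero, Ideal.one_eq_top, qlen_top, Nat.choose_eq_zero_of_lt (by omega)]
    simp
  | succ n ih =>
    have h1 : JJ x ^ (n + 1) ≤ JJ x ^ n := Ideal.pow_le_pow_right (by omega)
    rw [qlen_eq_add h1, ih, pow_succ', ql_pow hx le_rfl, ← add_mul]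
    congr 1
    obtain ⟨e, rfl⟩ : ∃ e, d = e + 1 := ⟨d - 1, by omega⟩
    have : (n + 1 + (e + 1) - 1).choose (e + 1) = (e + 1 + n - 1).choose n
      + (n + (e + 1) - 1).choose (e + 1) := by
      have h2 : n + 1 + (e + 1) - 1 = (n + e) + 1 := by omega
      have h3 : e + 1 + n - 1 = n + e := by omega
      have h4 : n + (e + 1) - 1 = n + e := by omega
      rw [h2, h3, h4, Nat.choose_succ_succ, Nat.choose_symm_add]
    rw [this]
    push_cast
    rfl

theorem qlen_mul_pow {x : Fin d → R} (hd : 0 < d) (hx : QR x) {a : Ideal R} (ha : JJ x ≤ a)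
    (n : ℕ) : qlen (a * JJ x ^ n) = ((n + d - 1).choose n : ℕ∞) * qlen a +
      ((n + d - 1).choose d : ℕ∞) * qlen (JJ x) := by
  rw [qlen_eq_add (Ideal.mul_le_right : a * JJ x ^ n ≤ JJ x ^ n), qlen_pow hd hx, ql_pow hx ha,
    add_comm d n]

end P4
end DA

namespace DA
section P5
open MvPolynomial IsLocalRing Finset

theorem asym_le {a r K d : ℕ} (h : ∀ n : ℕ, a * (n + 1) ^ d ≤ r * (n + K) ^ d) : a ≤ r := by
  have h1 : Filter.Tendsto (fun n : ℕ => ((n : ℝ) + K) / ((n : ℝ) + 1)) Filter.atTop (nhds 1) := by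
    have : (fun n : ℕ => ((n : ℝ) + K) / ((n : ℝ) + 1)) =
        fun n : ℕ => 1 + ((K : ℝ) - 1) * (1 / ((n : ℝ) + 1)) := by
      ext n
      have : (n : ℝ) + 1 ≠ 0 := by positivity
      field_simp
      ring
    rw [this]
    have := (tendsto_one_div_add_atTop_nhds_zero_nat (𝕜 := ℝ)).const_mul ((K : ℝ) - 1)
    simpa using this.const_add 1
  have h2 := ((h1.pow d).const_mul (r : ℝ))
  rw [one_pow, mul_one] at h2
  have : (a : ℝ) ≤ r := by
    refine ge_of_tendsto' h2 fun n => ?_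
    have hn : (0 : ℝ) < ((n : ℝ) + 1) ^ d := by positivity
    rw [div_pow, ← mul_div_assoc, le_div_iff₀ hn]
    exact_mod_cast h n
  exact_mod_cast this

theorem asym_choose {a r K d : ℕ}
    (h : ∀ n : ℕ, a * (n + d).choose d ≤ r * (n + K + d).choose d) : a ≤ r := by
  refine asym_le (K := K + d) (d := d) fun n => ?_
  have h1 : (n + 1) ^ d ≤ d.factorial * (n + d).choose d := by
    rw [← Nat.ascFactorial_eq_factorial_mul_choose]
    exact Nat.pow_succ_le_ascFactorial (n + 1) d
  have h2 : d.factorial * (n + K + d).choose d ≤ (n + (K + d)) ^ d := by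
    rw [← Nat.ascFactorial_eq_factorial_mul_choose]
    rw [← add_assoc]
    exact Nat.ascFactorial_le_pow_add (n + K) d
  calc a * (n + 1) ^ d ≤ a * (d.factorial * (n + d).choose d) := by gcongr
    _ = d.factorial * (a * (n + d).choose d) := by ring
    _ ≤ d.factorial * (r * (n + K + d).choose d) := Nat.mul_le_mul_left _ (h n)
    _ = r * (d.factorial * (n + K + d).choose d) := by ring
    _ ≤ _ := by gcongr

variable {R : Type*} [CommRing R] [IsLocalRing R] {d : ℕ}

theorem card_le_ql {ι : Type*} [Fintype ι] (u : ι → R) (a b : Ideal R) (hu : ∀ i, u i ∈ a)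
    (h : ∀ r : ι → R, ∑ i, r i * u i ∈ b → ∀ i, r i ∈ maximalIdeal R) :
    (Fintype.card ι : ℕ∞) ≤ ql a b := by
  classical
  let f : (ι → R) →ₗ[R] (a ⧸ Submodule.comap a.subtype b) :=
    (Submodule.mkQ _).comp (Fintype.linearCombination R (fun i => (⟨u i, hu i⟩ : a)))
  have hker : LinearMap.ker f ≤ Submodule.pi Set.univ (fun _ : ι => maximalIdeal R) := by
    intro r hr i _
    simp only [f, LinearMap.mem_ker, LinearMap.comp_apply, Submodule.mkQ_apply,
      Submodule.Quotient.mk_eq_zero, Submodule.mem_comap, Fintype.linearCombination_apply] at hr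
    refine h r ?_ i
    simpa using hr
  have e1 : Module.length R ((ι → R) ⧸ LinearMap.ker f) ≤ ql a b :=
    Module.length_le_of_injective (f.ker.liftQ f le_rfl)
      (by rw [← LinearMap.ker_eq_bot]; exact Submodule.ker_liftQ_eq_bot _ _ _ le_rfl)
  have e2 : Module.length R ((ι → R) ⧸ Submodule.pi Set.univ (fun _ : ι => maximalIdeal R)) ≤
      Module.length R ((ι → R) ⧸ LinearMap.ker f) :=
    Module.length_le_of_surjective (Submodule.factor hker) (Submodule.factor_surjective hker)
  have e3 := (Submodule.quotientPi (fun _ : ι => maximalIdeal R)).length_eq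
  refine le_trans ?_ (e2.trans e1)
  rw [e3, Module.length_pi_of_fintype]
  have : Module.length R (R ⧸ maximalIdeal R) = 1 := by
    have : IsSimpleModule R (R ⧸ maximalIdeal R) := by
      rw [isSimpleModule_iff_isCoatom]
      exact Ideal.isMaximal_def.1 (maximalIdeal.isMaximal R)
    exact Module.length_eq_one R _
  simp [this]

theorem chain_card {κ : Type*} (u : κ → R) (val : κ → ℝ) (E Ep : ℝ → Ideal R)
    (b : Ideal R) (hE : ∀ β, Ep β ≤ E β) (hEE : ∀ β β', β < β' → E β' ≤ Ep β)
    (hu : ∀ k, u k ∈ E (val k))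
    (hind : ∀ (S : Finset κ) (β : ℝ) (r : κ → R), (∀ k ∈ S, val k = β) →
      ∑ k ∈ S, r k * u k ∈ Ep β → ∀ k ∈ S, r k ∈ maximalIdeal R)
    (n : ℕ) : ∀ (S : Finset κ) (c : Ideal R), S.card ≤ n → b ≤ c → (∀ k ∈ S, E (val k) ≤ c) →
      (∀ k ∈ S, b ≤ Ep (val k)) → qlen c + S.card ≤ qlen b := by
  classical
  induction n with
  | zero =>
    intro S c hS hbc _ _
    have : S.card = 0 := by omega
    rw [this]
    simpa using qlen_mono hbc
  | succ n ih =>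
    intro S c hS hbc hEc hb
    rcases S.eq_empty_or_nonempty with rfl | hne
    · simpa using qlen_mono hbc
    obtain ⟨k0, hk0, hmin⟩ := S.exists_min_image val hne
    set S0 := S.filter (fun k => val k = val k0)
    set S1 := S.filter (fun k => ¬ val k = val k0)
    have hcard : S0.card + S1.card = S.card := Finset.card_filter_add_card_filter_not _
    have h0 : 0 < S0.card := Finset.card_pos.2 ⟨k0, by simp [S0, hk0]⟩
    have h1 : qlen (Ep (val k0)) + S1.card ≤ qlen b := by
      apply ih S1 _ (by omega) (hb k0 hk0)
      · intro k hk
        simp only [S1, mem_filter] at hk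
        exact hEE _ _ (lt_of_le_of_ne (hmin k hk.1) (Ne.symm hk.2))
      · intro k hk
        simp only [S1, mem_filter] at hk
        exact hb k hk.1
    have h2 : (S0.card : ℕ∞) ≤ ql (E (val k0)) (Ep (val k0)) := by
      have := card_le_ql (ι := S0) (fun k => u k) (E (val k0)) (Ep (val k0))
        (by
          rintro ⟨k, hk⟩
          simp only [S0, mem_filter] at hk
          rw [← hk.2]
          exact hu k)
        (by
          intro r hr k
          have hr' : ∑ k ∈ S0, (fun k => if hk : k ∈ S0 then r ⟨k, hk⟩ else 0) k * u k ∈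
              Ep (val k0) := by
            rw [← Finset.sum_attach]
            simpa using hr
          have := hind S0 (val k0) _ (by
            intro k hk
            simp only [S0, mem_filter] at hk
            exact hk.2) hr' k.1 k.2
          simpa using this)
      simpa using this
    have h3 := qlen_eq_add (hE (val k0))
    have h4 := qlen_mono (hEc k0 hk0)
    calc qlen c + S.card = qlen c + S0.card + S1.card := by rw [← hcard]; push_cast; ring
      _ ≤ qlen (E (val k0)) + ql (E (val k0)) (Ep (val k0)) + S1.card := by gcongr
      _ = qlen (Ep (val k0)) + S1.card := by rw [h3, add_comm (qlen _)]
      _ ≤ _ := h1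

/-- the number of monomials of degree at most `n` -/
theorem card_mon_le (hd : 0 < d) (n : ℕ) :
    Fintype.card (Σ j : Fin (n + 1), Mon d j) = (n + d).choose d := by
  rw [Fintype.card_sigma]
  simp only [card_mon]
  rw [Fin.sum_univ_eq_sum_range (fun j => (d + j - 1).choose j)]
  obtain ⟨e, rfl⟩ : ∃ e, d = e + 1 := ⟨d - 1, by omega⟩
  induction n with
  | zero => simp
  | succ n ih =>
    rw [Finset.sum_range_succ, ih]
    have h3 : e + 1 + (n + 1) - 1 = (n + 1) + e := by omega
    have h4 : n + 1 + (e + 1) = (n + 1 + e) + 1 := by omega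
    rw [h3, h4, Nat.choose_succ_succ, Nat.choose_symm_add, add_comm]
    congr 2
    omega

theorem growth {x : Fin d → R} (hd : 0 < d) (hx : QR x) {r0 : ℕ} (hr0 : qlen (JJ x) = r0)
    {ι : Type*} [Fintype ι] (z : ι → R) (val : ι → ℝ) (E Ep : ℝ → Ideal R)
    (hE : ∀ β, Ep β ≤ E β) (hEE : ∀ β β', β < β' → E β' ≤ Ep β)
    (hz : ∀ i s (F : MvPolynomial (Fin d) R), F.IsHomogeneous s → eval x F * z i ∈ E (val i + s))
    (c : ℕ) (hJ : ∀ i (s n : ℕ), s + c ≤ n → JJ x ^ n ≤ Ep (val i + s))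
    (hind : ∀ (β : ℝ) (F : ι → MvPolynomial (Fin d) R),
      (∀ i, F i = 0 ∨ ∃ s : ℕ, (F i).IsHomogeneous s ∧ val i + s = β) →
      ∑ i, eval x (F i) * z i ∈ Ep β → ∀ i, ¬ Good (F i)) :
    Fintype.card ι ≤ r0 := by
  classical
  refine asym_choose (K := c) (d := d) fun n => ?_
  let κ := ι × (Σ j : Fin (n + 1), Mon d j)
  have hcard : Fintype.card κ = Fintype.card ι * (n + d).choose d := by
    rw [Fintype.card_prod, card_mon_le hd]
  have key := chain_card (κ := κ) (fun k => eval x (monomial k.2.2.1 (1 : R)) * z k.1)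
    (fun k => val k.1 + (k.2.1 : ℕ)) E Ep (JJ x ^ (n + c + 1)) hE hEE
    (by
      rintro ⟨i, j, μ⟩
      exact hz i j _ (isHomogeneous_monomial _ (mem_mon.1 μ.2)))
    (by
      intro S β r hS hsum k hk
      let F : ι → MvPolynomial (Fin d) R := fun i =>
        ∑ k ∈ S.filter (fun k => k.1 = i), monomial k.2.2.1 (r k)
      have hF := hind β F (by
        intro i
        rcases (S.filter (fun k => k.1 = i)).eq_empty_or_nonempty with h | ⟨k, hk⟩
        · left
          simp [F, h]
        · right
          rw [mem_filter] at hk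
          refine ⟨k.2.1, ?_, by rw [← hS k hk.1, hk.2]⟩
          refine IsHomogeneous.sum _ _ _ fun l hl => isHomogeneous_monomial _ ?_
          rw [mem_filter] at hl
          rw [mem_mon.1 l.2.2.2]
          have h1 := hS k hk.1
          have h2 := hS l hl.1
          rw [hk.2] at h1
          rw [hl.2] at h2
          have : ((l.2.1 : ℕ) : ℝ) = ((k.2.1 : ℕ) : ℝ) := by linarith
          exact_mod_cast this) (by
        convert hsum using 1
        rw [← Finset.sum_fiberwise_of_maps_to (s := S) (t := univ) (g := fun k => k.1) (by simp)]
        refine Finset.sum_congr rfl fun i _ => ?_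
        simp only [F, map_sum, Finset.sum_mul]
        refine Finset.sum_congr rfl fun l hl => ?_
        rw [mem_filter] at hl
        rw [hl.2, eval_monomial, eval_monomial]
        ring) k.1
      rw [Good, not_not] at hF
      have h1 := mem_map_C_iff.mp hF k.2.2.1
      have h2 : coeff k.2.2.1 (F k.1) = r k := by
        simp only [F, coeff_sum]
        rw [Finset.sum_eq_single k]
        · rw [coeff_monomial, if_pos rfl]
        · intro l hl hne
          rw [mem_filter] at hl
          rw [coeff_monomial, if_neg]
          intro h
          apply hne
          obtain ⟨i, j, μ⟩ := k
          obtain ⟨i', j', μ'⟩ := l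
          simp only at h hl
          have hj : j = j' := by
            have e1 := mem_mon.1 μ.2
            have e2 := mem_mon.1 μ'.2
            rw [h] at e2
            exact Fin.ext (e1.symm.trans e2)
          subst hj
          have := Subtype.ext h
          rw [this, hl.2]
        · intro h
          exact absurd (mem_filter.2 ⟨hk, rfl⟩ : k ∈ S.filter (fun l => l.1 = k.1)) h
      rwa [h2] at h1)
    (Fintype.card κ) univ ⊤ (by simp) le_top (by simp) (by
      rintro ⟨i, j, μ⟩ _
      exact hJ i j _ (by have := j.2; omega))
  rw [qlen_top, zero_add, Finset.card_univ, hcard, qlen_pow hd hx, hr0] at key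
  have h5 : n + c + 1 + d - 1 = n + c + d := by omega
  rw [h5] at key
  rw [mul_comm r0]
  exact_mod_cast key

end P5
end DA

namespace DA
section P6
open MvPolynomial IsLocalRing Finset
variable {R : Type*} [CommRing R] {d : ℕ}

theorem pow_mem_add {J : Ideal R} {a b c : ℕ} (h : c ≤ a + b) {u v : R} (hu : u ∈ J ^ a)
    (hv : v ∈ J ^ b) : u * v ∈ J ^ c :=
  Ideal.pow_le_pow_right h (by rw [pow_add]; exact Ideal.mul_mem_mul hu hv)

/-- the integral closure of `J^n`, by bounded orders of powers -/
def ic (x : Fin d → R) (n : ℕ) : Ideal R where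
  carrier := {w | ∃ M, ∀ j, w ^ j ∈ JJ x ^ (n * j - M)}
  zero_mem' := by
    refine ⟨0, fun j => ?_⟩
    rcases j with _ | j
    · simp
    · simp
  add_mem' := by
    rintro w z ⟨M, hM⟩ ⟨M', hM'⟩
    refine ⟨M + M', fun j => ?_⟩
    rw [add_pow]
    refine Ideal.sum_mem _ fun i hi => Ideal.mul_mem_right _ _ ?_
    refine pow_mem_add ?_ (hM i) (hM' (j - i))
    have : n * j = n * i + n * (j - i) := by
      rw [← mul_add]; congr 1; have := mem_range.1 hi; omega
    omega
  smul_mem' := by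
    rintro r w ⟨M, hM⟩
    refine ⟨M, fun j => ?_⟩
    rw [smul_eq_mul, mul_pow]
    exact Ideal.mul_mem_left _ _ (hM j)

theorem mem_ic {x : Fin d → R} {n : ℕ} {w : R} :
    w ∈ ic x n ↔ ∃ M, ∀ j, w ^ j ∈ JJ x ^ (n * j - M) := Iff.rfl

theorem pow_le_ic (x : Fin d → R) (n : ℕ) : JJ x ^ n ≤ ic x n := fun w hw =>
  ⟨0, fun j => by rw [Nat.sub_zero, pow_mul]; exact Ideal.pow_mem_pow hw j⟩

theorem ic_zero (x : Fin d → R) : ic x 0 = ⊤ := by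
  rw [eq_top_iff]; simpa using pow_le_ic x 0

theorem ic_anti (x : Fin d → R) {n m : ℕ} (h : n ≤ m) : ic x m ≤ ic x n := by
  rintro w ⟨M, hM⟩
  refine ⟨M, fun j => Ideal.pow_le_pow_right ?_ (hM j)⟩
  have := Nat.mul_le_mul_right j h
  omega

theorem ic_mul {x : Fin d → R} {n m : ℕ} {w z : R} (hw : w ∈ ic x n) (hz : z ∈ ic x m) :
    w * z ∈ ic x (n + m) := by
  obtain ⟨M, hM⟩ := hw
  obtain ⟨M', hM'⟩ := hz
  refine ⟨M + M', fun j => ?_⟩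
  rw [mul_pow]
  refine pow_mem_add ?_ (hM j) (hM' j)
  rw [add_mul]; omega

theorem ic_mul_le (x : Fin d → R) (n m : ℕ) : ic x n * ic x m ≤ ic x (n + m) :=
  Ideal.mul_le.2 fun _ hw _ hz => ic_mul hw hz

theorem ic_pow {x : Fin d → R} {n : ℕ} {w : R} (hw : w ∈ ic x n) (b : ℕ) :
    w ^ b ∈ ic x (b * n) := by
  induction b with
  | zero => simp [ic_zero]
  | succ b ih => rw [pow_succ, Nat.succ_mul]; exact ic_mul ih hw

theorem ic_root {x : Fin d → R} {n b : ℕ} {w : R} (hb : 0 < b) (hw : w ^ b ∈ ic x (b * n)) :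
    w ∈ ic x n := by
  obtain ⟨M, hM⟩ := hw
  refine ⟨M + n * b, fun j => ?_⟩
  have h1 : j = b * (j / b) + j % b := (Nat.div_add_mod j b).symm
  have h2 := hM (j / b)
  rw [← pow_mul] at h2
  have h3 : w ^ j = w ^ (j % b) * w ^ (b * (j / b)) := by
    rw [← pow_add, add_comm, ← h1]
  rw [h3]
  refine Ideal.mul_mem_left _ _ (Ideal.pow_le_pow_right ?_ h2)
  have h4 : j % b < b := Nat.mod_lt _ hb
  have h5 : n * j ≤ n * (b * (j / b) + b) := Nat.mul_le_mul_left n (by omega)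
  rw [mul_add] at h5
  have h6 : b * n * (j / b) = n * (b * (j / b)) := by ring
  omega

theorem ic_key [IsLocalRing R] {x : Fin d → R} (hx : QR x) {s n : ℕ}
    {F : MvPolynomial (Fin d) R} (hF : F.IsHomogeneous s) (hg : Good F) {w : R}
    (h : eval x F * w ∈ ic x (n + s)) : w ∈ ic x n := by
  obtain ⟨M, hM⟩ := h
  refine ⟨M, fun j => ?_⟩
  by_cases hj : n * j ≤ M
  · rw [Nat.sub_eq_zero_of_le hj]; simp
  have h1 := hM j
  rw [mul_pow, ← map_pow] at h1
  have h2 : (n + s) * j - M = (n * j - M) + s * j := by rw [add_mul]; omega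
  rw [h2] at h1
  exact hx.tf (hF.pow j) (hg.pow j) h1

/-- transitivity of integral dependence -/
theorem ic_trans {x : Fin d → R} {B m : ℕ} {y : R} (a : ℕ → R) 
    (ha : ∀ i ∈ Icc 1 m, a i ∈ ic x (i * B)) (hy : y ^ m = ∑ i ∈ Icc 1 m, a i * y ^ (m - i)) :
    y ∈ ic x B := by
  classical
  choose! M hM using fun i (hi : i ∈ Icc 1 m) => mem_ic.1 (ha i hi)
  let T : ℕ → Ideal R := fun w => Ideal.span {u | ∃ α : ℕ → ℕ, w ≤ ∑ i ∈ Icc 1 m, i * α i ∧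
    u = ∏ i ∈ Icc 1 m, a i ^ α i}
  have hT0 : T 0 = ⊤ := by
    rw [Ideal.eq_top_iff_one]
    exact Ideal.subset_span ⟨0, by simp, by simp⟩
  have hTanti : ∀ w w', w ≤ w' → T w' ≤ T w := fun w w' h =>
    Ideal.span_mono (by rintro u ⟨α, h1, h2⟩; exact ⟨α, h.trans h1, h2⟩)
  have hTa : ∀ i ∈ Icc 1 m, ∀ w u, u ∈ T w → a i * u ∈ T (w + i) := by
    intro i hi w u hu
    have : T w ≤ Submodule.comap (LinearMap.mulLeft R (a i)) (T (w + i)) := by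
      refine Submodule.span_le.2 ?_
      rintro _ ⟨α, h1, rfl⟩
      refine Ideal.subset_span ⟨fun k => α k + if k = i then 1 else 0, ?_, ?_⟩
      · simp only [mul_add, Finset.sum_add_distrib, mul_ite, mul_one, mul_zero, 
          Finset.sum_ite_eq', if_pos hi]
        omega
      · simp only [LinearMap.mulLeft_apply, pow_add, Finset.prod_mul_distrib]
        have : ∏ k ∈ Icc 1 m, a k ^ (if k = i then 1 else 0) = a i := by
          rw [Finset.prod_eq_single i]
          · simp
          · intro b _ hb; simp [hb]
          · intro h; exact absurd hi h
        rw [this, mul_comm]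
    exact this hu
  have hTJ : ∀ w, T w ≤ JJ x ^ (w * B - ∑ i ∈ Icc 1 m, M i) := by
    intro w
    refine Ideal.span_le.2 ?_
    rintro _ ⟨α, h1, rfl⟩
    have : ∀ S ⊆ Icc 1 m, ∏ i ∈ S, a i ^ α i ∈
        JJ x ^ (∑ i ∈ S, i * α i * B - ∑ i ∈ S, M i) := by
      intro S
      induction S using Finset.induction_on with
      | empty => simp
      | insert i S hi ih =>
        intro hS
        rw [Finset.prod_insert hi, Finset.sum_insert hi, Finset.sum_insert hi]
        refine pow_mem_add ?_ (hM i (hS (mem_insert_self _ _)) (α i))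
          (ih ((subset_insert _ _).trans hS))
        have : i * B * α i = i * α i * B := by ring
        omega
    refine Ideal.pow_le_pow_right ?_ (this _ subset_rfl)
    rw [← Finset.sum_mul]
    have := Nat.mul_le_mul_right B h1
    omega
  have hyT : ∀ j, y ^ j ∈ T (j - m) := by
    intro j
    induction j using Nat.strong_induction_on with
    | _ j ih =>
      by_cases hj : j ≤ m
      · rw [Nat.sub_eq_zero_of_le hj, hT0]; trivial
      have h1 : y ^ j = ∑ i ∈ Icc 1 m, a i * y ^ (j - i) := by
        have : j = (j - m) + m := by omega
        rw [this, pow_add, hy, Finset.mul_sum]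
        refine Finset.sum_congr rfl fun i hi => ?_
        rw [mem_Icc] at hi
        have e : j - m + m - i = (j - m) + (m - i) := by omega
        rw [e, pow_add]; ring
      rw [h1]
      refine Ideal.sum_mem _ fun i hi => ?_
      have hi' := mem_Icc.1 hi
      exact hTanti _ _ (by omega) (hTa i hi _ _ (ih (j - i) (by omega)))
  refine ⟨m * B + ∑ i ∈ Icc 1 m, M i, fun j => Ideal.pow_le_pow_right ?_ (hTJ _ (hyT j))⟩
  rw [Nat.sub_mul, mul_comm B j]; omega

theorem ic_L [IsLocalRing R] {x : Fin d → R} (hx : QR x) {s A m : ℕ}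
    {F : MvPolynomial (Fin d) R} (hF : F.IsHomogeneous s) (hg : Good F) {z : R} (c : ℕ → R) (hm : 0 < m)
    (hc : ∀ b < m, c b ∈ ic x ((m - b) * A + s))
    (h : eval x F * z ^ m = ∑ b ∈ range m, c b * z ^ b) : z ∈ ic x A := by
  refine ic_key hx hF hg (ic_trans (m := m) (fun i => c (m - i) * eval x F ^ (i - 1)) ?_ ?_)
  · intro i hi
    rw [mem_Icc] at hi
    have h1 := hc (m - i) (by omega)
    have h2 : eval x F ^ (i - 1) ∈ ic x ((i - 1) * s) :=
      ic_pow (pow_le_ic x s (eval_mem_pow x hF)) _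
    have h3 := ic_mul h1 h2
    have e : (m - (m - i)) * A + s + (i - 1) * s = i * (A + s) := by
      obtain ⟨k, rfl⟩ : ∃ k, i = k + 1 := ⟨i - 1, by omega⟩
      have : m - (m - (k + 1)) = k + 1 := by omega
      rw [this, Nat.add_sub_cancel]; ring
    rwa [e] at h3
  · obtain ⟨k, rfl⟩ : ∃ k, m = k + 1 := ⟨m - 1, by omega⟩
    rw [mul_pow, pow_succ (eval x F), mul_assoc, h, Finset.mul_sum]
    refine Finset.sum_bij' (fun b _ => k + 1 - b) (fun i _ => k + 1 - i) ?_ ?_ ?_ ?_ ?_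
    · intro b hb; rw [mem_range] at hb; rw [mem_Icc]; omega
    · intro b hb; rw [mem_Icc] at hb; rw [mem_range]; omega
    · intro b hb; rw [mem_range] at hb; show _ = _; omega
    · intro b hb; rw [mem_Icc] at hb; show _ = _; omega
    · intro b hb
      rw [mem_range] at hb
      have e1 : k + 1 - (k + 1 - b) = b := by omega
      have e2 : k + 1 - b - 1 = k - b := by omega
      rw [e1, e2, mul_pow]
      have e3 : k = (k - b) + b := by omega
      have e4 : eval x F ^ k = eval x F ^ (k - b) * eval x F ^ b := by rw [← pow_add, ← e3]
      rw [e4]; ring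

theorem nzd [IsLocalRing R] [IsNoetherianRing R] {x : Fin d → R} (hx : QR x)
    (hm : JJ x ≤ maximalIdeal R) {s : ℕ}
    {F : MvPolynomial (Fin d) R} (hF : F.IsHomogeneous s) (hg : Good F) {z : R}
    (h : eval x F * z = 0) : z = 0 := by
  have h1 : ∀ n, z ∈ maximalIdeal R ^ n := fun n =>
    Ideal.pow_right_mono hm n (hx.tf hF hg (by rw [h]; exact Ideal.zero_mem _))
  have h2 := Ideal.iInf_pow_eq_bot_of_isLocalRing (maximalIdeal R) 
    (maximalIdeal.isMaximal R).ne_top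
  have : z ∈ (⨅ i, maximalIdeal R ^ i : Ideal R) := by
    rw [Submodule.mem_iInf]; exact h1
  rw [h2] at this
  exact this

theorem integral_of_mem_ic [IsLocalRing R] [IsNoetherianRing R] {x : Fin d → R} (hx : QR x)
    (hd : 0 < d) (hm : JJ x ≤ maximalIdeal R) {n : ℕ} {w : R} (hw : w ∈ ic x n) :
    ∃ k : ℕ, 0 < k ∧ ∃ a : ℕ → R, (∀ i < k, a i ∈ JJ x ^ (n * (k - i))) ∧
      w ^ k = ∑ i ∈ range k, a i * w ^ i := by
  classical
  obtain ⟨M, hM⟩ := hw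
  let F : MvPolynomial (Fin d) R := X ⟨0, hd⟩ ^ M
  have hF : F.IsHomogeneous M := by
    simpa using (isHomogeneous_X R (⟨0, hd⟩ : Fin d)).pow M
  have hg : Good F := (good_X _).pow M
  let u := eval x F
  have hu : ∀ j, u * w ^ j ∈ (JJ x ^ n) ^ j := by
    intro j
    rw [← pow_mul]
    exact pow_mem_add (by omega) (eval_mem_pow x hF) (hM j)
  let A := reesAlgebra (JJ x ^ n)
  let p : ℕ → A := fun j => ⟨Polynomial.monomial j (u * w ^ j), reesAlgebra.monomial_mem.2 (hu j)⟩
  have hN : IsNoetherianRing A := inferInstance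
  let f : ℕ →o Submodule A A := ⟨fun k => Submodule.span A (p '' ↑(range k)), fun k l h =>
    Submodule.span_mono (Set.image_mono (by simpa using h))⟩
  obtain ⟨N, hN⟩ := monotone_stabilizes_iff_noetherian.2 hN f
  have h1 : p (N + 1) ∈ f (N + 1) := by
    rw [← hN (N + 1) (by omega), hN (N + 2) (by omega)]
    exact Submodule.subset_span ⟨N + 1, by simp, rfl⟩
  obtain ⟨c', hc'⟩ := (Submodule.mem_span_image_finset_iff_exists_fun A).1 h1
  let c : ℕ → A := fun i => if h : i ∈ range (N + 1) then c' ⟨i, h⟩ else 0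
  have hc : ∑ i ∈ range (N + 1), c i • p i = p (N + 1) := by
    rw [← hc', ← Finset.sum_attach]
    exact Finset.sum_congr rfl fun i _ => by simp only [c, dif_pos i.2]
  refine ⟨N + 1, by omega, fun i => (c i : Polynomial R).coeff (N + 1 - i), ?_, ?_⟩
  · intro i _
    rw [pow_mul]
    exact (mem_reesAlgebra_iff _ _).1 (c i).2 _
  · have h2 := congrArg (fun q : A => (q : Polynomial R).coeff (N + 1)) hc
    simp only [smul_eq_mul, AddSubmonoidClass.coe_finsetSum, Polynomial.finsetSum_coeff,
      MulMemClass.coe_mul, p, Polynomial.coeff_monomial, if_true] at h2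
    have h3 : ∀ i ∈ range (N + 1), ((c i : Polynomial R) * 
        Polynomial.monomial i (u * w ^ i)).coeff (N + 1) = 
        u * ((c i : Polynomial R).coeff (N + 1 - i) * w ^ i) := by
      intro i hi
      rw [mem_range] at hi
      have : N + 1 = (N + 1 - i) + i := by omega
      conv_lhs => rw [this]
      rw [Polynomial.coeff_mul_monomial]
      ring
    rw [Finset.sum_congr rfl h3, ← Finset.mul_sum] at h2
    have h4 := nzd hx hm hF hg (z := w ^ (N + 1) - 
      ∑ i ∈ range (N + 1), (c i : Polynomial R).coeff (N + 1 - i) * w ^ i) (by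
        rw [mul_sub, sub_eq_zero]; exact h2.symm)
    exact sub_eq_zero.1 h4

theorem red_pow {I J : Ideal R} {N : ℕ} (h : ∀ n ≥ N, I ^ (n + 1) = J * I ^ n) (m : ℕ) :
    I ^ m ≤ J ^ (m - N) := by
  by_cases hm : m ≤ N
  · rw [Nat.sub_eq_zero_of_le hm]; simp
  obtain ⟨k, rfl⟩ : ∃ k, m = N + k := ⟨m - N, by omega⟩
  have : I ^ (N + k) = J ^ k * I ^ N := by
    clear hm
    induction k with
    | zero => simp
    | succ k ih => rw [← add_assoc, h _ (by omega), ih, ← mul_assoc, pow_succ']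
  rw [this, Nat.add_sub_cancel_left]
  exact Ideal.mul_le_left

theorem mem_ic_of_integral {x : Fin d → R} {I : Ideal R} {N : ℕ}
    (h : ∀ n ≥ N, I ^ (n + 1) = JJ x * I ^ n) {n : ℕ} {w : R} (hw : IsIntegralOverIdeal (I ^ n) w) :
    w ∈ ic x n := by
  obtain ⟨k, hk, a, ha, he⟩ := hw
  have h1 : ∀ j, w ^ j ∈ I ^ (n * j - n * k) := by
    intro j
    induction j using Nat.strong_induction_on with
    | _ j ih =>
      by_cases hj : j ≤ k
      · rw [Nat.sub_eq_zero_of_le (Nat.mul_le_mul_left n hj)]; simp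
      have e1 : w ^ j = - ∑ i ∈ Icc 1 k, a i * w ^ (j - i) := by
        have : j = (j - k) + k := by omega
        rw [this, pow_add, eq_neg_of_add_eq_zero_left he, mul_neg, Finset.mul_sum]
        congr 1
        refine Finset.sum_congr rfl fun i hi => ?_
        rw [mem_Icc] at hi
        have e : j - k + k - i = (j - k) + (k - i) := by omega
        rw [e, pow_add]; ring
      rw [e1]
      refine Submodule.neg_mem _ (Ideal.sum_mem _ fun i hi => ?_)
      have hi' := mem_Icc.1 hi
      have h2 := ha i hi
      rw [← pow_mul] at h2
      refine pow_mem_add ?_ h2 (ih (j - i) (by omega))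
      rw [Nat.mul_sub]; omega
  refine ⟨n * k + N, fun j => ?_⟩
  have := red_pow h _ (h1 j)
  rwa [Nat.sub_sub] at this

theorem intCl_eq_ic [IsLocalRing R] [IsNoetherianRing R] {x : Fin d → R} (hx : QR x)
    (hd : 0 < d) (hm : JJ x ≤ maximalIdeal R) {I : Ideal R} (hJI : JJ x ≤ I) {N : ℕ}
    (h : ∀ n ≥ N, I ^ (n + 1) = JJ x * I ^ n) (n : ℕ) : intCl (I ^ n) = ic x n := by
  refine le_antisymm (Ideal.span_le.2 fun w hw => mem_ic_of_integral h hw) fun w hw => ?_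
  obtain ⟨k, hk, a, ha, he⟩ := integral_of_mem_ic hx hd hm hw
  refine Ideal.subset_span ⟨k, hk, fun i => - a (k - i), ?_, ?_⟩
  · intro i hi
    rw [mem_Icc] at hi
    refine Submodule.neg_mem _ ?_
    have := ha (k - i) (by omega)
    have e : k - (k - i) = i := by omega
    rw [e] at this
    rw [← pow_mul]
    exact Ideal.pow_right_mono hJI _ this
  · rw [he]
    simp only [neg_mul, Finset.sum_neg_distrib]
    rw [add_neg_eq_zero]
    refine Finset.sum_bij' (fun b _ => k - b) (fun i _ => k - i) ?_ ?_ ?_ ?_ ?_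
    · intro b hb; rw [mem_range] at hb; rw [mem_Icc]; omega
    · intro b hb; rw [mem_Icc] at hb; rw [mem_range]; omega
    · intro b hb; rw [mem_range] at hb; show _ = _; omega
    · intro b hb; rw [mem_Icc] at hb; show _ = _; omega
    · intro b hb
      rw [mem_range] at hb
      have e1 : k - (k - b) = b := by omega
      rw [e1]

end P6
end DA

namespace DA
section P7
open MvPolynomial Finset

theorem finite_of_semilinear {P C M : Type*} [CommRing P] [IsNoetherianRing P] [AddCommGroup C]
    [Module P C] [AddCommGroup M] [Module P M] (φ : P →+* P) (ψ : C →ₛₗ[φ] M)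
    (hψ : Function.Injective ψ) {ι : Type*} [Fintype ι] (g : ι → M)
    (h : ∀ c, ∃ q : ι → P, ψ c = ∑ i, φ (q i) • g i) : Module.Finite P C := by
  let N0 : Submodule P (ι → P) :=
    { carrier := {q | ∃ c, ψ c = ∑ i, φ (q i) • g i}
      zero_mem' := ⟨0, by simp⟩
      add_mem' := by
        rintro q q' ⟨c, hc⟩ ⟨c', hc'⟩
        exact ⟨c + c', by simp [hc, hc', add_smul, Finset.sum_add_distrib]⟩
      smul_mem' := by
        rintro p q ⟨c, hc⟩
        exact ⟨p • c, by simp [hc, mul_smul, Finset.smul_sum]⟩ }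
  choose f hf using fun q : N0 => q.2
  let F : N0 →ₗ[P] C :=
    { toFun := f
      map_add' := by
        intro q q'
        apply hψ
        rw [hf, map_add, hf, hf]
        simp [add_smul, Finset.sum_add_distrib]
      map_smul' := by
        intro p q
        apply hψ
        rw [hf, LinearMap.map_smulₛₗ, RingHom.id_apply, hf]
        simp [mul_smul, Finset.smul_sum] }
  refine Module.Finite.of_surjective F fun c => ?_
  obtain ⟨q, hq⟩ := h c
  exact ⟨⟨q, c, hq⟩, hψ ((hf ⟨q, c, hq⟩).trans hq.symm)⟩

variable {k : Type*} [Field k] {d : ℕ}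

theorem coeff_frob (p n : ℕ) [ExpChar k p] (h : MvPolynomial (Fin d) k) :
    ∀ μ, coeff μ (h ^ p ^ n) ∈ (iterateFrobenius k p n).fieldRange := by
  induction h using MvPolynomial.induction_on' with
  | monomial u a =>
    intro μ
    rw [monomial_pow, coeff_monomial]
    split_ifs
    · exact ⟨a, rfl⟩
    · exact zero_mem _
  | add f g hf hg =>
    intro μ
    rw [add_pow_expChar_pow, coeff_add]
    exact add_mem (hf μ) (hg μ)

theorem cf_mul {F : Subfield k} (U : Submodule F k) {g f : MvPolynomial (Fin d) k}
    (hg : ∀ μ, coeff μ g ∈ F) (hf : ∀ μ, coeff μ f ∈ U) (μ) : coeff μ (g * f) ∈ U := by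
  classical
  rw [coeff_mul]
  refine Submodule.sum_mem _ fun x _ => ?_
  exact U.smul_mem ⟨_, hg x.1⟩ (hf x.2)

theorem cf_div {F : Subfield k} (U : Submodule F k) {g f : MvPolynomial (Fin d) k} (h0 : g ≠ 0)
    (hg : ∀ μ, coeff μ g ∈ F) (hf : ∀ μ, coeff μ (g * f) ∈ U) (μ) : coeff μ f ∈ U := by
  classical
  obtain ⟨W, hW⟩ := U.exists_isCompl
  have hsp : ∀ a : k, ∃ b ∈ U, ∃ c ∈ W, b + c = a := fun a => by
    have : a ∈ U ⊔ W := by rw [hW.sup_eq_top]; trivial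
    exact Submodule.mem_sup.1 this
  choose b hb c hc hbc using hsp
  let f1 : MvPolynomial (Fin d) k := ∑ ν ∈ f.support, monomial ν (b (coeff ν f))
  let f2 : MvPolynomial (Fin d) k := ∑ ν ∈ f.support, monomial ν (c (coeff ν f))
  have hs : f = f1 + f2 := by
    simp only [f1, f2, ← Finset.sum_add_distrib, ← map_add, hbc]
    exact f.as_sum
  have h1 : ∀ ν, coeff ν f1 ∈ U := by
    intro ν
    simp only [f1, coeff_sum, coeff_monomial]
    refine Submodule.sum_mem _ fun x _ => ?_
    split_ifs
    · exact hb _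
    · exact zero_mem _
  have h2 : ∀ ν, coeff ν f2 ∈ W := by
    intro ν
    simp only [f2, coeff_sum, coeff_monomial]
    refine Submodule.sum_mem _ fun x _ => ?_
    split_ifs
    · exact hc _
    · exact zero_mem _
  have h3 : g * f2 = 0 := by
    ext ν
    have e1 : coeff ν (g * f2) ∈ W := cf_mul W hg h2 ν
    have e2 : coeff ν (g * f2) ∈ U := by
      have := sub_mem (hf ν) (cf_mul U hg h1 ν)
      rwa [hs, mul_add, coeff_add, add_sub_cancel_left] at this
    have := Submodule.mem_inf.2 ⟨e2, e1⟩
    rw [hW.inf_eq_bot] at this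
    simpa using this
  have h4 : f2 = 0 := (mul_eq_zero.1 h3).resolve_left h0
  rw [hs, h4, add_zero]
  exact h1 μ

/-- polynomials with coefficients in `U` are generated over `P^q` by finitely many elements -/
theorem cf_gen (p n : ℕ) [ExpChar k p] {τ : Type*} [Fintype τ] (u : τ → k)
    (f : MvPolynomial (Fin d) k)
    (hf : ∀ μ, coeff μ f ∈ Submodule.span (iterateFrobenius k p n).fieldRange (Set.range u)) :
    ∃ q : τ × (Fin d → Fin (p ^ n)) → MvPolynomial (Fin d) k,
      f = ∑ i, (q i) ^ p ^ n * monomial (Finsupp.equivFunOnFinite.symm (fun j => (i.2 j : ℕ))) (u i.1) := by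
  classical
  have hpos : 0 < p ^ n := pow_pos (expChar_pos k p) n
  let S : AddSubmonoid (MvPolynomial (Fin d) k) :=
    { carrier := {f | ∃ q : τ × (Fin d → Fin (p ^ n)) → MvPolynomial (Fin d) k,
        f = ∑ i, (q i) ^ p ^ n * 
          monomial (Finsupp.equivFunOnFinite.symm (fun j => (i.2 j : ℕ))) (u i.1)}
      zero_mem' := ⟨0, by simp only [Pi.zero_apply, zero_pow hpos.ne', zero_mul, Finset.sum_const_zero]⟩
      add_mem' := by
        rintro f g ⟨q, rfl⟩ ⟨q', rfl⟩
        refine ⟨q + q', ?_⟩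
        simp only [Pi.add_apply, add_pow_expChar_pow, add_mul, Finset.sum_add_distrib] }
  show f ∈ S
  rw [f.as_sum]
  refine sum_mem fun μ _ => ?_
  obtain ⟨c, hc⟩ := (Submodule.mem_span_range_iff_exists_fun _).1 (hf μ)
  rw [← hc, map_sum]
  refine sum_mem fun t _ => ?_
  obtain ⟨a, ha⟩ := (c t).2
  let α : Fin d → Fin (p ^ n) := fun j => ⟨μ j % p ^ n, Nat.mod_lt _ hpos⟩
  let β : Fin d →₀ ℕ := Finsupp.equivFunOnFinite.symm fun j => μ j / p ^ n
  refine ⟨Pi.single (t, α) (monomial β a), ?_⟩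
  rw [Finset.sum_eq_single (t, α)]
  · rw [Pi.single_eq_same, monomial_pow, monomial_mul]
    congr 1
    · congr 1
      ext j
      simp [α, β, Nat.div_add_mod]
    · show (c t : k) * u t = _
      rw [← ha, iterateFrobenius_def]
  · intro i _ hi
    rw [Pi.single_eq_of_ne hi, zero_pow hpos.ne', zero_mul]
  · simp

theorem finite_field (K L : Type*) [Field K] [Field L] [Algebra (MvPolynomial (Fin d) k) K]
    [IsFractionRing (MvPolynomial (Fin d) k) K] [Algebra K L] [Algebra (MvPolynomial (Fin d) k) L]
    [IsScalarTower (MvPolynomial (Fin d) k) K L] [FiniteDimensional K L] :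
    Module.Finite (MvPolynomial (Fin d) k) (integralClosure (MvPolynomial (Fin d) k) L) := by
  classical
  set P := MvPolynomial (Fin d) k
  obtain ⟨p, hp⟩ := ExpChar.exists k
  have hpP : ExpChar P p := expChar_of_injective_ringHom (C_injective (Fin d) k) p
  have hpK : ExpChar K p := expChar_of_injective_algebraMap (IsFractionRing.injective P K) p
  have hpL : ExpChar L p := expChar_of_injective_algebraMap (algebraMap K L).injective p
  let Ls := separableClosure K L
  have hpLs : ExpChar Ls p := expChar_of_injective_algebraMap (algebraMap K Ls).injective p
  have hst : IsScalarTower P Ls L := IsScalarTower.of_algebraMap_eq fun r => rfl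
  let n := IsPurelyInseparable.exponent Ls L
  have hn : ∀ a : L, ∃ b : Ls, (b : L) = a ^ p ^ n := fun a => by
    obtain ⟨b, hb⟩ := IsPurelyInseparable.exponent_def' Ls p a
    exact ⟨b, hb⟩
  obtain ⟨s, b, hb⟩ := FiniteDimensional.exists_is_basis_integral P K Ls
  have hle := integralClosure_le_span_dualBasis (A := P) (K := K) b hb
  set a := (Algebra.traceForm K Ls).dualBasis (traceForm_nondegenerate K Ls) b
  let Cc := integralClosure P L
  have hco : ∀ c : Cc, ∃ f : s → P, (c : L) ^ p ^ n = ∑ i, f i • ((a i : Ls) : L) := by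
    intro c
    obtain ⟨y, hy⟩ := hn c
    have hyi : IsIntegral P y := by
      have : IsIntegral P (y : L) := by rw [hy]; exact c.2.pow _
      exact (isIntegral_algHom_iff (IsScalarTower.toAlgHom P Ls L) (algebraMap Ls L).injective).1 this
    have h1 : y ∈ Submodule.span P (Set.range a) := hle hyi
    obtain ⟨f, hf⟩ := (Submodule.mem_span_range_iff_exists_fun _).1 h1
    refine ⟨f, ?_⟩
    rw [← hy, ← hf]
    have := map_sum (IsScalarTower.toAlgHom P Ls L).toLinearMap (fun i => f i • a i) univ
    simp only [map_smul] at this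
    exact this
  have hli : LinearIndependent P (fun i => ((a i : Ls) : L)) := by
    have h1 : LinearIndependent K a := a.linearIndependent
    have h2 : LinearIndependent K (fun i => ((a i : Ls) : L)) :=
      h1.map' (IsScalarTower.toAlgHom K Ls L).toLinearMap
        (LinearMap.ker_eq_bot.2 (algebraMap Ls L).injective)
    exact (LinearIndependent.iff_fractionRing P K).2 h2
  choose f hf using hco
  have huniq : ∀ (c : Cc) (g : s → P), (c : L) ^ p ^ n = ∑ i, g i • ((a i : Ls) : L) → f c = g := by
    intro c g hg
    have h1 : ∑ i, (f c i - g i) • ((a i : Ls) : L) = 0 := by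
      simp only [sub_smul, Finset.sum_sub_distrib, ← hf, ← hg, sub_self]
    funext i
    exact sub_eq_zero.1 (Fintype.linearIndependent_iff.1 hli _ h1 i)
  let ψ : Cc →ₛₗ[iterateFrobenius P p n] (s → P) :=
    { toFun := f
      map_add' := by
        intro c c'
        apply huniq
        simp only [Pi.add_apply, add_smul, Finset.sum_add_distrib, ← hf]
        exact add_pow_expChar_pow (c : L) (c' : L) p n
      map_smul' := by
        intro r c
        apply huniq
        simp only [Pi.smul_apply, smul_eq_mul, mul_smul, ← Finset.smul_sum, ← hf, 
          iterateFrobenius_def]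
        show (r • (c : L)) ^ p ^ n = _
        rw [smul_pow] }
  have hψ : Function.Injective ψ := by
    rw [injective_iff_map_eq_zero]
    intro c hc
    have h1 := hf c
    have h2 : f c = 0 := hc
    rw [h2] at h1
    simp only [Pi.zero_apply, zero_smul, Finset.sum_const_zero] at h1
    exact Subtype.ext (eq_zero_of_pow_eq_zero h1)
  obtain ⟨s', l, hl⟩ := FiniteDimensional.exists_is_basis_integral P K L
  let l' : s' → Cc := fun j => ⟨l j, hl j⟩
  -- coefficients
  let τ := Σ ij : s × s', (f (l' ij.2) ij.1).support
  let u : τ → k := fun t => coeff t.2.1 (f (l' t.1.2) t.1.1)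
  let U := Submodule.span (iterateFrobenius k p n).fieldRange (Set.range u)
  have hU0 : ∀ j i μ, coeff μ (f (l' j) i) ∈ U := by
    intro j i μ
    by_cases hμ : μ ∈ (f (l' j) i).support
    · exact Submodule.subset_span ⟨⟨(i, j), ⟨μ, hμ⟩⟩, rfl⟩
    · rw [notMem_support_iff.1 hμ]; exact zero_mem _
  have hU : ∀ c i μ, coeff μ (f c i) ∈ U := by
    intro c i
    obtain ⟨h, hh⟩ := IsLocalization.exist_integer_multiples_of_finite (nonZeroDivisors P)
      (fun j => l.repr (c : L) j)
    choose r hr using hh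
    have h0 : (h : P) ≠ 0 := nonZeroDivisors.ne_zero h.2
    have e1 : (h : P) • c = ∑ j, r j • l' j := by
      apply Subtype.ext
      have : ((∑ j, r j • l' j : Cc) : L) = ∑ j, r j • l j := by
        rw [AddSubmonoidClass.coe_finsetSum]; rfl
      rw [this]
      show (h : P) • (c : L) = _
      conv_lhs => rw [← l.sum_repr (c : L)]
      rw [Finset.smul_sum]
      refine Finset.sum_congr rfl fun j _ => ?_
      rw [← smul_assoc]
      have e3 : (h : P) • l.repr (c : L) j = algebraMap P K (r j) := (hr j).symm
      rw [e3, algebraMap_smul]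
    have e2 := congrFun (congrArg ψ e1) i
    rw [LinearMap.map_smulₛₗ, map_sum] at e2
    simp only [LinearMap.map_smulₛₗ, Finset.sum_apply, Pi.smul_apply, smul_eq_mul,
      iterateFrobenius_def] at e2
    refine cf_div U (pow_ne_zero _ h0) (coeff_frob p n _) fun μ => ?_
    have e3 : (h : P) ^ p ^ n * f c i = ∑ j, r j ^ p ^ n * f (l' j) i := e2
    rw [e3, coeff_sum]
    exact Submodule.sum_mem _ fun j _ => cf_mul U (coeff_frob p n _) (hU0 j i) μ
  refine finite_of_semilinear (iterateFrobenius P p n) ψ hψ 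
    (ι := s × (τ × (Fin d → Fin (p ^ n))))
    (fun i => Pi.single i.1 (monomial (Finsupp.equivFunOnFinite.symm (fun j => (i.2.2 j : ℕ))) (u i.2.1))) ?_
  intro c
  choose q hq using fun i => cf_gen p n u (f c i) (hU c i)
  refine ⟨fun i => q i.1 i.2, ?_⟩
  funext i
  rw [Fintype.sum_prod_type]
  simp only [Finset.sum_apply, Pi.smul_apply, smul_eq_mul]
  rw [Finset.sum_eq_single i]
  · simp only [Pi.single_eq_same]
    exact hq i
  · intro j _ hj
    refine Finset.sum_eq_zero fun t _ => ?_
    rw [Pi.single_eq_of_ne (Ne.symm hj), mul_zero]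
  · simp

theorem N2 {B : Type*} [CommRing B] [Algebra (MvPolynomial (Fin d) k) B] [IsReduced B]
    (htf : ∀ (p : MvPolynomial (Fin d) k) (b : B), p • b = 0 → p = 0 ∨ b = 0)
    (hintg : ∀ b : B, IsIntegral (MvPolynomial (Fin d) k) b)
    (S : Finset B) (hS : ∀ b : B, ∃ p : MvPolynomial (Fin d) k, p ≠ 0 ∧
      p • b ∈ Submodule.span (MvPolynomial (Fin d) k) (S : Set B)) :
    Module.Finite (MvPolynomial (Fin d) k) B := by
  classical
  set P := MvPolynomial (Fin d) k
  let M := nonZeroDivisors P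
  let MB := Algebra.algebraMapSubmonoid B M
  let K := FractionRing P
  let E := Localization MB
  let _ : Algebra K E := localizationAlgebra M B
  have htower : IsScalarTower P K E := by
    refine IsScalarTower.of_algebraMap_eq fun r => ?_
    rw [IsScalarTower.algebraMap_apply P B E]
    exact (IsLocalization.map_eq _ r).symm
  have hMB : MB ≤ nonZeroDivisors B := by
    rintro _ ⟨p, hp, rfl⟩
    rw [mem_nonZeroDivisors_iff_right]
    intro b hb
    have := htf p b (by rw [Algebra.smul_def, mul_comm]; exact hb)
    exact this.resolve_left (nonZeroDivisors.ne_zero hp)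
  have hinj : Function.Injective (algebraMap B E) := IsLocalization.injective E hMB
  have hred : IsReduced E := inferInstance
  have hfin : Module.Finite K E := by
    refine ⟨⟨S.image (algebraMap B E), ?_⟩⟩
    rw [eq_top_iff]
    rintro e -
    obtain ⟨b, ⟨_, p, hp, rfl⟩, rfl⟩ := IsLocalization.exists_mk'_eq MB e
    obtain ⟨p0, hp0, hb⟩ := hS b
    have hle : Submodule.span P (S : Set B) ≤ Submodule.comap 
        (IsScalarTower.toAlgHom P B E).toLinearMap 
        ((Submodule.span K (↑(S.image (algebraMap B E)) : Set E)).restrictScalars P) := by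
      refine Submodule.span_le.2 fun y hy => ?_
      exact Submodule.subset_span (by simpa using ⟨y, hy, rfl⟩)
    have h1 : algebraMap B E (p0 • b) ∈ 
        Submodule.span K (↑(S.image (algebraMap B E)) : Set E) := hle hb
    have hκ : algebraMap P K (p0 * p) ≠ 0 := by
      rw [Ne, map_eq_zero_iff _ (IsFractionRing.injective P K)]
      exact mul_ne_zero hp0 (nonZeroDivisors.ne_zero hp)
    have h2 : algebraMap P K (p0 * p) • IsLocalization.mk' E b 
        (⟨algebraMap P B p, ⟨p, hp, rfl⟩⟩ : MB) = algebraMap B E (p0 • b) := by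
      rw [algebraMap_smul, Algebra.smul_def, map_mul, IsScalarTower.algebraMap_apply P B E p,
        mul_assoc, Algebra.smul_def p0 b, map_mul, ← IsScalarTower.algebraMap_apply]
      congr 1
      exact IsLocalization.mk'_spec' E b (⟨algebraMap P B p, ⟨p, hp, rfl⟩⟩ : MB)
    rw [← h2] at h1
    have h3 := Submodule.smul_mem _ (algebraMap P K (p0 * p))⁻¹ h1
    rwa [inv_smul_smul₀ hκ] at h3
  have : IsArtinianRing E := IsArtinianRing.of_finite K E
  let ee := IsArtinianRing.equivPi E
  let _ : ∀ I : MaximalSpectrum E, Field (E ⧸ I.asIdeal) := fun I => Ideal.Quotient.field _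
  have hfi : ∀ I : MaximalSpectrum E, Module.Finite P (integralClosure P (E ⧸ I.asIdeal)) := by
    intro I
    exact finite_field K (E ⧸ I.asIdeal)
  let f : B →ₗ[P] (∀ I : MaximalSpectrum E, integralClosure P (E ⧸ I.asIdeal)) :=
    LinearMap.pi fun I => 
      (((IsScalarTower.toAlgHom P E (E ⧸ I.asIdeal)).comp (IsScalarTower.toAlgHom P B E)).codRestrict 
        (integralClosure P (E ⧸ I.asIdeal)) (fun b => (hintg b).map _)).toLinearMap
  have : Module.Finite P (∀ I : MaximalSpectrum E, integralClosure P (E ⧸ I.asIdeal)) :=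
    inferInstance
  refine Module.Finite.of_injective f ?_
  rw [injective_iff_map_eq_zero]
  intro b hb
  apply hinj
  rw [map_zero]
  apply ee.injective
  rw [map_zero]
  funext I
  have := congrArg Subtype.val (congrFun hb I)
  exact this

end P7
end DA

namespace DA
section P8
open MvPolynomial IsLocalRing Finset Pointwise

theorem CHlem {P T : Type*} [CommRing P] [CommRing T] [Algebra P T] (ω : T) (𝔪 : Ideal P)
    [h𝔪 : 𝔪.IsPrime] {B r : ℕ} (hrB : r ≤ B) (hB : ω ^ B ∈ Submodule.span P ((ω ^ ·) '' Set.Iio B)) {G : P}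
    (hG : G ∉ 𝔪) (h : G • ω ^ r ∈ Submodule.span P ((ω ^ ·) '' Set.Iio r) ⊔ 
      𝔪 • Submodule.span P ((ω ^ ·) '' Set.Iio B)) :
    ∃ G' ∉ 𝔪, G' • ω ^ r ∈ Submodule.span P ((ω ^ ·) '' Set.Iio r) := by
  classical
  set V : ℕ → Submodule P T := fun r => Submodule.span P ((ω ^ ·) '' Set.Iio r) with hV
  have hVm : ∀ {b r}, b < r → ω ^ b ∈ V r := fun {b r} hb => Submodule.subset_span ⟨b, hb, rfl⟩
  have hωV : ∀ r u, u ∈ V r → ω * u ∈ V r ⊔ Submodule.span P {ω ^ r} := by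
    intro r u hu
    have : V r ≤ Submodule.comap (LinearMap.mulLeft P ω) (V r ⊔ Submodule.span P {ω ^ r}) := by
      refine Submodule.span_le.2 ?_
      rintro _ ⟨b, hb, rfl⟩
      show ω * ω ^ b ∈ V r ⊔ Submodule.span P {ω ^ r}
      rw [← pow_succ']
      rcases Nat.lt_or_ge (b + 1) r with h | h
      · exact Submodule.mem_sup_left (hVm h)
      · have : b + 1 = r := le_antisymm hb h
        rw [this]
        exact Submodule.mem_sup_right (Submodule.subset_span rfl)
    exact this hu
  have hωB : ∀ u, u ∈ V B → ω * u ∈ V B := by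
    intro u hu
    have h1 := hωV B u hu
    have : Submodule.span P {ω ^ B} ≤ V B := by
      rw [Submodule.span_singleton_le_iff_mem]; exact hB
    rwa [sup_eq_left.2 this] at h1
  have hωmB : ∀ u, u ∈ 𝔪 • V B → ω * u ∈ 𝔪 • V B := by
    intro u hu
    have : 𝔪 • V B ≤ Submodule.comap (LinearMap.mulLeft P ω) (𝔪 • V B) := by
      refine Submodule.smul_le.2 fun a ha v hv => ?_
      show ω * (a • v) ∈ 𝔪 • V B
      rw [mul_smul_comm]
      exact Submodule.smul_mem_smul ha (hωB v hv)
    exact this hu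
  have hall : ∀ b, ∃ H ∉ 𝔪, H • ω ^ b ∈ V r ⊔ 𝔪 • V B := by
    intro b
    induction b with
    | zero =>
      rcases Nat.eq_zero_or_pos r with rfl | hr
      · exact ⟨G, hG, h⟩
      · exact ⟨1, h𝔪.one_notMem, by rw [one_smul]; exact Submodule.mem_sup_left (hVm hr)⟩
    | succ b ih =>
      obtain ⟨H, hH, hb⟩ := ih
      refine ⟨G * H, fun hmem => (h𝔪.mem_or_mem hmem).elim hG hH, ?_⟩
      obtain ⟨u, hu, v, hv, huv⟩ := Submodule.mem_sup.1 hb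
      have e1 : (G * H) • ω ^ (b + 1) = G • (ω * u) + G • (ω * v) := by
        rw [← smul_add, ← mul_add, huv, mul_smul, pow_succ', mul_smul_comm]
      rw [e1]
      refine add_mem ?_ (Submodule.mem_sup_right (Submodule.smul_mem _ _ (hωmB v hv)))
      obtain ⟨u1, hu1, u2, hu2, hu12⟩ := Submodule.mem_sup.1 (hωV r u hu)
      obtain ⟨a, rfl⟩ := Submodule.mem_span_singleton.1 hu2
      rw [← hu12, smul_add, smul_comm]
      exact add_mem (Submodule.mem_sup_left (Submodule.smul_mem _ _ hu1)) (Submodule.smul_mem _ _ h)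
  choose H hH hHb using hall
  let H0 := ∏ b ∈ range B, H b
  have hH0 : H0 ∉ 𝔪 := by
    intro h
    obtain ⟨b, _, hb⟩ := (h𝔪.prod_mem_iff).1 h
    exact hH b hb
  have hH0V : ∀ u ∈ V B, H0 • u ∈ V r ⊔ 𝔪 • V B := by
    have : V B ≤ Submodule.comap (LinearMap.lsmul P T H0) (V r ⊔ 𝔪 • V B) := by
      refine Submodule.span_le.2 ?_
      rintro _ ⟨b, hb, rfl⟩
      show H0 • ω ^ b ∈ V r ⊔ 𝔪 • V B
      have : H0 = (∏ c ∈ (range B).erase b, H c) * H b := by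
        rw [Finset.prod_erase_mul]
        exact mem_range.2 hb
      rw [this, mul_smul]
      exact Submodule.smul_mem _ _ (hHb b)
    exact this
  let N : Submodule P (T ⧸ V r) := (V B).map (V r).mkQ
  have hNfg : N.FG := by
    refine Submodule.FG.map _ ?_
    exact Submodule.fg_span ((Set.finite_Iio B).image _)
  have hNf : Module.Finite P N := Module.Finite.iff_fg.2 hNfg
  have hmap : ∀ u, u ∈ V r ⊔ 𝔪 • V B → (V r).mkQ u ∈ 𝔪 • N := by
    intro u hu
    obtain ⟨u1, hu1, u2, hu2, rfl⟩ := Submodule.mem_sup.1 hu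
    rw [map_add, Submodule.mkQ_apply _ u1, (Submodule.Quotient.mk_eq_zero _).2 hu1, zero_add]
    have := Submodule.mem_map_of_mem (f := (V r).mkQ) hu2
    rwa [Submodule.map_smul''] at this
  have hrange : LinearMap.range (LinearMap.lsmul P N H0) ≤ 𝔪 • ⊤ := by
    rintro _ ⟨⟨_, u, hu, rfl⟩, rfl⟩
    have h1 := hmap _ (hH0V u hu)
    have h2 : Submodule.map N.subtype (𝔪 • ⊤) = 𝔪 • N := by
      rw [Submodule.map_smul'', Submodule.map_top, Submodule.range_subtype]
    rw [← h2] at h1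
    obtain ⟨y, hy, hy'⟩ := h1
    refine Set.mem_of_eq_of_mem (Subtype.ext ?_) hy
    rw [Submodule.subtype_apply] at hy'
    rw [hy', map_smul]
    rfl
  obtain ⟨p, hp, -, hpc, hp0⟩ :=
    LinearMap.exists_monic_and_natDegree_eq_and_coeff_mem_pow_and_aeval_eq_zero P
      (LinearMap.lsmul P N H0) 𝔪 hrange
  refine ⟨p.eval H0, ?_, ?_⟩
  · rw [Polynomial.eval_eq_sum_range, Finset.sum_range_succ, hp.coeff_natDegree, one_mul]
    intro hmem
    refine hH0 (h𝔪.mem_of_pow_mem p.natDegree ?_)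
    refine (Submodule.add_mem_iff_right _ (Ideal.sum_mem _ fun k hk => ?_)).1 hmem
    refine Ideal.mul_mem_right _ _ ?_
    rw [mem_range] at hk
    exact Ideal.pow_le_self (by omega) (hpc k)
  · have hrB' : ω ^ r ∈ V B ⊔ V r := by
      rcases hrB.lt_or_eq with h | rfl
      · exact Submodule.mem_sup_left (hVm h)
      · exact Submodule.mem_sup_left hB
    have hωN : (V r).mkQ (ω ^ r) ∈ N := by
      rcases hrB.lt_or_eq with h | rfl
      · exact Submodule.mem_map_of_mem (hVm h)
      · exact Submodule.mem_map_of_mem hB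
    have h1 := LinearMap.congr_fun hp0 ⟨_, hωN⟩
    have h2 : ∀ n : N, Polynomial.aeval (LinearMap.lsmul P N H0) p n = p.eval H0 • n := by
      intro n
      have : LinearMap.lsmul P N H0 = algebraMap P (Module.End P N) H0 := by
        ext; simp [Module.algebraMap_end_apply]
      rw [this, Polynomial.aeval_algebraMap_apply, Module.algebraMap_end_apply]
      simp
    rw [h2] at h1
    have h3 := congrArg Subtype.val h1
    simp only [SetLike.val_smul, LinearMap.zero_apply, ZeroMemClass.coe_zero] at h3
    rw [← map_smul, Submodule.mkQ_apply, Submodule.Quotient.mk_eq_zero] at h3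
    exact h3

variable {R : Type*} [CommRing R] [IsLocalRing R] {d : ℕ}

theorem growthN {x : Fin d → R} (hd : 0 < d) (hx : QR x) {r0 : ℕ} (hr0 : qlen (JJ x) = r0)
    {ι : Type*} [Fintype ι] (z : ι → R) (val : ι → ℕ) (E Ep : ℕ → Ideal R)
    (hE : ∀ N, Ep N ≤ E N) (hEE : ∀ N, E (N + 1) ≤ Ep N)
    (hz : ∀ i s (F : MvPolynomial (Fin d) R), F.IsHomogeneous s → eval x F * z i ∈ E (val i + s))
    (c : ℕ) (hJ : ∀ i (s n : ℕ), s + c ≤ n → JJ x ^ n ≤ Ep (val i + s))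
    (hind : ∀ (N : ℕ) (F : ι → MvPolynomial (Fin d) R),
      (∀ i, F i = 0 ∨ ∃ s : ℕ, (F i).IsHomogeneous s ∧ val i + s = N) →
      ∑ i, eval x (F i) * z i ∈ Ep N → ∀ i, ¬ Good (F i)) :
    Fintype.card ι ≤ r0 := by
  classical
  have hanti : ∀ N M, N ≤ M → E M ≤ E N := fun N M h =>
    antitone_nat_of_succ_le (f := E) (fun n => (hEE n).trans (hE n)) h
  let E' : ℝ → Ideal R := fun β => E ⌈β⌉₊
  let Ep' : ℝ → Ideal R := fun β => if β = (⌈β⌉₊ : ℝ) then Ep ⌈β⌉₊ else E ⌈β⌉₊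
  have hEpN : ∀ N : ℕ, Ep' N = Ep N := fun N => by simp [Ep']
  refine growth hd hx hr0 z (fun i => (val i : ℝ)) E' Ep' ?_ ?_ ?_ c ?_ ?_
  · intro β
    simp only [Ep', E']
    split_ifs
    · exact hE _
    · exact le_rfl
  · intro β β' h
    simp only [Ep', E']
    split_ifs with h1
    · refine le_trans (hanti _ _ ?_) (hEE _)
      rw [h1] at h
      exact Nat.lt_ceil.2 h
    · exact hanti _ _ (Nat.ceil_mono h.le)
  · intro i s F hF
    have := hz i s F hF
    simp only [E']
    have e : ⌈(val i : ℝ) + s⌉₊ = val i + s := by exact_mod_cast Nat.ceil_natCast (val i + s)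
    rwa [e]
  · intro i s n h
    have e : ((val i : ℝ) + s) = ((val i + s : ℕ) : ℝ) := by push_cast; rfl
    rw [e, hEpN]
    exact hJ i s n h
  · intro β F hF hsum i
    by_cases hN : ∃ N : ℕ, β = N
    · obtain ⟨N, rfl⟩ := hN
      rw [hEpN] at hsum
      refine hind N F (fun i => (hF i).imp_right ?_) hsum i
      rintro ⟨s, h1, h2⟩
      exact ⟨s, h1, by exact_mod_cast h2⟩
    · rcases hF i with h | ⟨s, _, h2⟩
      · rw [h]; intro hg; exact hg (Ideal.zero_mem _)
      · exact absurd ⟨val i + s, by rw [← h2]; push_cast; rfl⟩ hN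

end P8
end DA

namespace DA
section P9
open MvPolynomial IsLocalRing Finset

variable {R : Type*} [CommRing R] {d : ℕ}

/-- the Rees-type map -/
noncomputable def phi (x : Fin d → R) : MvPolynomial (Fin d) R →ₐ[R] Polynomial R :=
  aeval (fun i => Polynomial.monomial 1 (x i))

theorem phi_hom (x : Fin d → R) {s : ℕ} {F : MvPolynomial (Fin d) R} (hF : F.IsHomogeneous s) :
    phi x F = Polynomial.monomial s (eval x F) := by
  rw [phi, aeval_def, eval₂_eq', eval_eq', map_sum]
  refine Finset.sum_congr rfl fun μ hμ => ?_
  have h1 : μ.degree = s := by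
    have := hF (mem_support_iff.1 hμ)
    rw [Finsupp.degree_eq_weight_one]; exact this
  have h2 : ∏ i, Polynomial.monomial 1 (x i) ^ μ i = Polynomial.monomial s (∏ i, x i ^ μ i) := by
    have : ∀ i, Polynomial.monomial 1 (x i) ^ μ i = Polynomial.C (x i ^ μ i) * Polynomial.X ^ (μ i) := by
      intro i; rw [Polynomial.monomial_pow, one_mul, Polynomial.C_mul_X_pow_eq_monomial]
    simp_rw [this]
    rw [Finset.prod_mul_distrib, Finset.prod_pow_eq_pow_sum, ← map_prod,
      Polynomial.C_mul_X_pow_eq_monomial]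
    rw [← h1, Finsupp.degree_eq_sum]
  rw [h2, Polynomial.algebraMap_eq, Polynomial.C_mul_monomial]

theorem phi_coeff (x : Fin d → R) (s : ℕ) (F : MvPolynomial (Fin d) R) :
    (phi x F).coeff s = eval x (homogeneousComponent s F) := by
  conv_lhs => rw [← sum_homogeneousComponent F, map_sum, Polynomial.finsetSum_coeff]
  have : ∀ i ∈ range (F.totalDegree + 1), (phi x (homogeneousComponent i F)).coeff s =
      if i = s then eval x (homogeneousComponent s F) else 0 := by
    intro i _
    rw [phi_hom x (homogeneousComponent_isHomogeneous i F), Polynomial.coeff_monomial]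
    split_ifs with h
    · rw [h]
    · rfl
  rw [Finset.sum_congr rfl this, Finset.sum_ite_eq']
  split_ifs with h
  · rfl
  · rw [homogeneousComponent_eq_zero]
    · simp
    · rw [mem_range] at h; omega

theorem good_comp [IsLocalRing R] {F : MvPolynomial (Fin d) R} (h : Good F) :
    ∃ s, Good (homogeneousComponent s F) := by
  by_contra hc
  push Not at hc
  refine h ?_
  rw [← sum_homogeneousComponent F]
  exact Ideal.sum_mem _ fun i _ => not_not.1 (hc i)

instance prime_map [IsLocalRing R] : ((maximalIdeal R).map (C : R →+* MvPolynomial (Fin d) R)).IsPrime where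
  ne_top' := fun h => good_one (R := R) (d := d) (by rw [h]; trivial)
  mem_or_mem' := by
    intro a b hab
    by_contra hc
    push Not at hc
    exact Good.mul hc.1 hc.2 hab

theorem pow_r0 [IsLocalRing R] [IsNoetherianRing R] {x : Fin d → R} (hd : 0 < d) (hx : QR x)
    (hm : JJ x ≤ maximalIdeal R) {r0 : ℕ} (hr0 : qlen (JJ x) = r0) {n : ℕ} {w : R}
    (hw : w ∈ ic x n) : w ^ r0 ∈ JJ x ^ n := by
  classical
  let _ : Algebra (MvPolynomial (Fin d) R) (Polynomial R) := (phi x).toAlgebra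
  have hsm : ∀ (F : MvPolynomial (Fin d) R) (t : Polynomial R), F • t = phi x F * t := fun F t => rfl
  set 𝔪 := (maximalIdeal R).map (C : R →+* MvPolynomial (Fin d) R) with h𝔪
  obtain ⟨B, hB0, a, ha, hBw⟩ := integral_of_mem_ic hx hd hm hw
  let ω : Polynomial R := Polynomial.monomial n w
  have hω : ∀ b, ω ^ b = Polynomial.monomial (n * b) (w ^ b) := fun b => Polynomial.monomial_pow _ _ _
  let V : ℕ → Submodule (MvPolynomial (Fin d) R) (Polynomial R) :=
    fun r => Submodule.span _ ((ω ^ ·) '' Set.Iio r)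
  have hVm : ∀ {b r}, b < r → ω ^ b ∈ V r := fun {b r} hb => Submodule.subset_span ⟨b, hb, rfl⟩
  have hact : ∀ {s b : ℕ} {F : MvPolynomial (Fin d) R}, F.IsHomogeneous s → 
      F • ω ^ b = Polynomial.monomial (s + n * b) (eval x F * w ^ b) := by
    intro s b F hF
    rw [hsm, phi_hom x hF, hω, Polynomial.monomial_mul_monomial]
  have hωB : ω ^ B ∈ V B := by
    have : ∀ i, ∃ F : MvPolynomial (Fin d) R, i < B → F.IsHomogeneous (n * (B - i)) ∧ eval x F = a i := by
      intro i
      by_cases hi : i < B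
      · obtain ⟨F, h1, h2⟩ := (Ideal.mem_span_pow_iff_exists_isHomogeneous x (a i)).1 (ha i hi)
        exact ⟨F, fun _ => ⟨h1, h2⟩⟩
      · exact ⟨0, fun h => absurd h hi⟩
    choose F hF using this
    have e : ω ^ B = ∑ i ∈ range B, F i • ω ^ i := by
      rw [hω, hBw, map_sum]
      refine Finset.sum_congr rfl fun i hi => ?_
      rw [mem_range] at hi
      rw [hact (hF i hi).1, (hF i hi).2, ← mul_add]
      congr 2; congr 1; omega
    rw [e]
    exact Submodule.sum_mem _ fun i hi => Submodule.smul_mem _ _ (hVm (mem_range.1 hi))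
  have hex : ∃ r, ∃ G ∉ 𝔪, G • ω ^ r ∈ V r ⊔ 𝔪 • V B :=
    ⟨B, 1, good_one, by rw [one_smul]; exact Submodule.mem_sup_left hωB⟩
  let r := Nat.find hex
  obtain ⟨G, hG, hGr⟩ := Nat.find_spec hex
  have hrB : r ≤ B := Nat.find_min' hex ⟨1, good_one, by rw [one_smul]; exact Submodule.mem_sup_left hωB⟩
  have hrr0 : r ≤ r0 := by
    let E : ℕ → Ideal R := fun N => ⨆ b ∈ range B, JJ x ^ (N + n * (B - b)) * Ideal.span {w ^ b}
    have hmemE : ∀ {N b : ℕ} {y : R}, b < B → y ∈ JJ x ^ (N + n * (B - b)) → y * w ^ b ∈ E N := by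
      intro N b y hb hy
      exact (le_iSup₂_of_le (f := fun b (_ : b ∈ range B) => JJ x ^ (N + n * (B - b)) * Ideal.span {w ^ b})
        b (mem_range.2 hb) le_rfl) (Ideal.mul_mem_mul hy (Ideal.mem_span_singleton_self _))
    have hmE : ∀ {N : ℕ} {y : R}, y ∈ maximalIdeal R * E N → ∃ H : ℕ → MvPolynomial (Fin d) R,
        (∀ b < B, (H b).IsHomogeneous (N + n * (B - b)) ∧ H b ∈ 𝔪) ∧ 
        y = ∑ b ∈ range B, eval x (H b) * w ^ b := by
      intro N y hy
      have h1 : maximalIdeal R * E N = ⨆ b ∈ range B, 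
          (maximalIdeal R * JJ x ^ (N + n * (B - b))) * Ideal.span {w ^ b} := by
        simp only [E, Ideal.mul_iSup, mul_assoc]
      rw [h1, Submodule.mem_iSup_finset_iff_exists_sum] at hy
      obtain ⟨μ, hμ⟩ := hy
      have : ∀ b, ∃ H : MvPolynomial (Fin d) R, b < B → (H.IsHomogeneous (N + n * (B - b)) ∧ H ∈ 𝔪) ∧ 
          eval x H * w ^ b = μ b := by
        intro b
        obtain ⟨z, hz, hz'⟩ := Ideal.mem_mul_span_singleton.1 (μ b).2
        obtain ⟨H, h1, h2, h3⟩ := (mem_mul_pow x _ _ z).1 hz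
        exact ⟨H, fun _ => ⟨⟨h1, h2⟩, by rw [h3, hz']⟩⟩
      choose H hH using this
      refine ⟨H, fun b hb => (hH b hb).1, ?_⟩
      rw [← hμ]
      exact Finset.sum_congr rfl fun b hb => ((hH b (mem_range.1 hb)).2).symm
    have := growthN hd hx hr0 (ι := Fin r) (fun i => x ⟨0, hd⟩ ^ (n * (B - i)) * w ^ (i : ℕ)) (fun _ => 0)
      E (fun N => maximalIdeal R * E N) (fun N => Ideal.mul_le_right) ?_ ?_ (n * B + 1) ?_ ?_
    · simpa using this
    · intro N
      refine iSup₂_le fun b hb => ?_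
      rw [mem_range] at hb
      have e : N + 1 + n * (B - b) = 1 + (N + n * (B - b)) := by ring
      rw [e, pow_add, pow_one, mul_assoc]
      refine Ideal.mul_mono hm ?_
      exact (le_iSup₂_of_le (f := fun b (_ : b ∈ range B) => JJ x ^ (N + n * (B - b)) * Ideal.span {w ^ b})
        b (mem_range.2 hb) le_rfl) 
    · intro i s F hF
      rw [zero_add, ← mul_assoc]
      refine hmemE (i.2.trans_le hrB) ?_
      exact pow_mem_add le_rfl (eval_mem_pow x hF) (Ideal.pow_mem_pow (x_mem x _) _)
    · intro i s t hst y hy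
      rw [zero_add]
      have h1 : y ∈ JJ x ^ (1 + (s + n * B)) := Ideal.pow_le_pow_right (by omega) hy
      rw [pow_add, pow_one] at h1
      refine Ideal.mul_mono hm ?_ h1
      intro u hu
      have := hmemE (N := s) (b := 0) (y := u) hB0 (by simpa using hu)
      simpa using this
    · intro N F hF hsum i hgi
      have hF' : ∀ i, (F i).IsHomogeneous N := by
        intro i
        rcases hF i with h | ⟨s, h, hs⟩
        · rw [h]; exact isHomogeneous_zero _ _ _
        · rw [zero_add] at hs; rwa [← hs]
      obtain ⟨c, hc, hcmax⟩ := (Finset.univ.filter fun i => Good (F i)).exists_max_image id ⟨i, by simpa using hgi⟩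
      simp only [mem_filter, mem_univ, true_and, id] at hc hcmax
      obtain ⟨H, hH, hHs⟩ := hmE hsum
      let F' : Fin r → MvPolynomial (Fin d) R := fun i => F i * X ⟨0, hd⟩ ^ (n * (B - i))
      have hF'h : ∀ i, (F' i).IsHomogeneous (N + n * (B - i)) := fun i =>
        (hF' i).mul (by simpa using (isHomogeneous_X R (⟨0, hd⟩ : Fin d)).pow (n * (B - i)))
      have key : ∑ i, F' i • ω ^ (i : ℕ) = ∑ b ∈ range B, H b • ω ^ b := by
        have e1 : ∀ i : Fin r, F' i • ω ^ (i : ℕ) = Polynomial.monomial (N + n * B) 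
            (eval x (F i) * (x ⟨0, hd⟩ ^ (n * (B - i)) * w ^ (i : ℕ))) := by
          intro i
          rw [hact (hF'h i)]
          congr 1
          · congr 1
            have := i.2.trans_le hrB
            rw [add_assoc, ← mul_add]; congr 2; omega
          · simp [F', mul_assoc]
        have e2 : ∀ b ∈ range B, H b • ω ^ b = Polynomial.monomial (N + n * B) (eval x (H b) * w ^ b) := by
          intro b hb
          rw [mem_range] at hb
          rw [hact (hH b hb).1]
          congr 2
          rw [add_assoc, ← mul_add]; congr 2; omega
        rw [Finset.sum_congr rfl fun i _ => e1 i, Finset.sum_congr rfl e2, ← map_sum, ← map_sum, hHs]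
      refine Nat.find_min hex (m := c) c.2 ⟨F' c, Good.mul hc ((good_X _).pow _), ?_⟩
      have e3 : F' c • ω ^ (c : ℕ) = ∑ b ∈ range B, H b • ω ^ b - 
          ∑ i ∈ univ.erase c, F' i • ω ^ (i : ℕ) := by
        rw [← key, ← Finset.add_sum_erase _ _ (mem_univ c)]; ring
      rw [e3]
      refine sub_mem (Submodule.sum_mem _ fun b hb => Submodule.mem_sup_right ?_) 
        (Submodule.sum_mem _ fun i hi => ?_)
      · rw [mem_range] at hb
        exact Submodule.smul_mem_smul (hH b hb).2 (hVm hb)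
      · by_cases hgi : Good (F i)
        · have := hcmax i hgi
          have h2 : i ≠ c := (mem_erase.1 hi).1
          exact Submodule.mem_sup_left (Submodule.smul_mem _ _ (hVm (lt_of_le_of_ne this fun h => h2 (Fin.ext h))))
        · refine Submodule.mem_sup_right (Submodule.smul_mem_smul ?_ (hVm (i.2.trans_le hrB)))
          exact Ideal.mul_mem_right _ _ (not_not.1 hgi)
  obtain ⟨G', hG', hV'⟩ := CHlem ω 𝔪 hrB hωB hG hGr
  obtain ⟨s, hs⟩ := good_comp hG'
  have hsum : ∀ y ∈ (Submodule.span (MvPolynomial (Fin d) R) ((ω ^ ·) '' Set.Iio r)), 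
      ∃ H : ℕ → MvPolynomial (Fin d) R, y = ∑ b ∈ range r, H b • ω ^ b := by
    intro y hy
    induction hy using Submodule.span_induction with
    | mem y h => 
      obtain ⟨b, hb, rfl⟩ := h
      refine ⟨fun c => if c = b then 1 else 0, ?_⟩
      simp only [ite_smul, one_smul, zero_smul, Finset.sum_ite_eq']
      rw [if_pos (mem_range.2 hb)]
    | zero => exact ⟨0, by simp⟩
    | add y z _ _ hy hz => 
      obtain ⟨H, rfl⟩ := hy
      obtain ⟨H', rfl⟩ := hz
      exact ⟨fun b => H b + H' b, by simp only [add_smul, Finset.sum_add_distrib]⟩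
    | smul a y _ hy =>
      obtain ⟨H, rfl⟩ := hy
      exact ⟨fun b => a * H b, by simp only [mul_smul, Finset.smul_sum]⟩
  have hcf : ∀ (F : MvPolynomial (Fin d) R) (b t : ℕ), n * b ≤ t → 
      (F • ω ^ b).coeff t = eval x (homogeneousComponent (t - n * b) F) * w ^ b := by
    intro F b t h
    obtain ⟨u, rfl⟩ := Nat.exists_eq_add_of_le' h
    rw [hsm, hω, Polynomial.coeff_mul_monomial, phi_coeff, Nat.add_sub_cancel]
  obtain ⟨H, hH⟩ := hsum _ hV'
  have h1 := congrArg (fun p => Polynomial.coeff p (s + n * r)) hH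
  simp only [Polynomial.finsetSum_coeff] at h1
  rw [hcf _ _ _ (by omega), Nat.add_sub_cancel] at h1
  have h2 : eval x (homogeneousComponent s G') * w ^ r ∈ JJ x ^ (n + s) := by
    rw [h1]
    refine Ideal.sum_mem _ fun b hb => ?_
    rw [mem_range] at hb
    have h3 : n * b + n ≤ n * r := by
      rw [← Nat.mul_succ]; exact Nat.mul_le_mul_left n hb
    rw [hcf _ _ _ (by omega)]
    refine Ideal.mul_mem_right _ _ (Ideal.pow_le_pow_right ?_ 
      (eval_mem_pow x (homogeneousComponent_isHomogeneous _ _)))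
    omega
  have h3 := hx.tf (homogeneousComponent_isHomogeneous _ _) hs h2
  rw [← Nat.sub_add_cancel hrr0, pow_add]
  exact Ideal.mul_mem_left _ _ h3

end P9
end DA

namespace DA
section P10
open MvPolynomial IsLocalRing Finset

variable {R : Type*} [CommRing R] {d : ℕ}

theorem stab [IsLocalRing R] [IsNoetherianRing R] (f : ℕ → Ideal R) (hf : Antitone f) (k : ℕ)
     : ∃ n, ∀ m, n ≤ m → f m ⊔ maximalIdeal R ^ k = f n ⊔ maximalIdeal R ^ k := by
  rcases eq_or_ne k 0 with rfl | hk
  · exact ⟨0, fun m _ => by simp⟩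
  have h1 : IsArtinianRing (R ⧸ maximalIdeal R ^ k) :=
    IsLocalRing.quotient_artinian_of_mem_minimalPrimes_of_isLocalRing _ 
      ⟨⟨inferInstance, Ideal.pow_le_self hk⟩, fun p hp _ => hp.1.le_of_pow_le hp.2⟩
  obtain ⟨n, hn⟩ := IsArtinian.monotone_stabilizes (R := R ⧸ maximalIdeal R ^ k) (M := R ⧸ maximalIdeal R ^ k)
    ⟨fun n => OrderDual.toDual ((f n).map (Ideal.Quotient.mk (maximalIdeal R ^ k))), fun a b h =>
      OrderDual.toDual_le_toDual.2 (Ideal.map_mono (hf h))⟩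
  refine ⟨n, fun m hm => ?_⟩
  have h2 := OrderDual.toDual.injective (hn m hm)
  have h3 := congrArg (Ideal.comap (Ideal.Quotient.mk (maximalIdeal R ^ k))) h2
  have h4 : ∀ I : Ideal R, Ideal.comap (Ideal.Quotient.mk (maximalIdeal R ^ k)) 
    (I.map (Ideal.Quotient.mk (maximalIdeal R ^ k))) = I ⊔ maximalIdeal R ^ k := by
    intro I
    rw [Ideal.comap_map_of_surjective _ Ideal.Quotient.mk_surjective, ← RingHom.ker_eq_comap_bot, 
      Ideal.mk_ker]
  have h5 : Ideal.comap (Ideal.Quotient.mk (maximalIdeal R ^ k)) ((f n).map (Ideal.Quotient.mk (maximalIdeal R ^ k)))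
    = Ideal.comap (Ideal.Quotient.mk (maximalIdeal R ^ k)) ((f m).map (Ideal.Quotient.mk (maximalIdeal R ^ k))) := h3
  rw [h4, h4] at h5
  exact h5.symm

theorem chevalley [IsLocalRing R] [IsNoetherianRing R] (hAU : AnalyticallyUnramified R) (f : ℕ → Ideal R)
    (hf : Antitone f) (r0 : ℕ) (hr : ∀ n w, w ∈ f n → w ^ r0 ∈ maximalIdeal R ^ n) (k : ℕ) :
    ∃ N, f N ≤ maximalIdeal R ^ k := by
  classical
  set m := maximalIdeal R with hm
  by_contra hc
  push Not at hc
  choose t ht using stab f hf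
  -- Sk k = f (t k) ⊔ m ^ k
  have hS : ∀ k n, f (t k) ⊔ m ^ k ≤ f n ⊔ m ^ k := by
    intro k n
    rcases le_total (t k) n with h | h
    · rw [ht k n h]
    · exact sup_le_sup_right (hf h) _
  obtain ⟨s0, hs0, hs0'⟩ := Set.not_subset.1 (hc (t k))
  have hstep : ∀ j (s : R), ∃ s', s ∈ f (t j) ⊔ m ^ j → s' ∈ f (t (j + 1)) ⊔ m ^ (j + 1) ∧ s' - s ∈ m ^ j := by
    intro j s
    by_cases hs : s ∈ f (t j) ⊔ m ^ j
    · obtain ⟨u, hu, v, hv, rfl⟩ := Submodule.mem_sup.1 (hS j (t (j + 1)) hs)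
      exact ⟨u, fun _ => ⟨Submodule.mem_sup_left hu, by simpa using hv⟩⟩
    · exact ⟨0, fun h => absurd h hs⟩
  choose nx hnx using hstep
  let s : ℕ → R := fun j => Nat.rec s0 (fun j s => nx (k + j) s) j
  have hsS : ∀ j, s j ∈ f (t (k + j)) ⊔ m ^ (k + j) := by
    intro j
    induction j with
    | zero => exact Submodule.mem_sup_left hs0
    | succ j ih => exact (hnx (k + j) (s j) ih).1
  have hsd : ∀ j, s (j + 1) - s j ∈ m ^ (k + j) := fun j => (hnx (k + j) (s j) (hsS j)).2
  have hs0k : ∀ j, s j - s0 ∈ m ^ k := by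
    intro j
    induction j with
    | zero => simp [s]
    | succ j ih => 
      have := add_mem (Ideal.pow_le_pow_right (by omega) (hsd j)) ih
      simpa using this
  let a : AdicCompletion.AdicCauchySequence m R := AdicCompletion.AdicCauchySequence.mk m R s (by
    intro n
    rw [SModEq.comm, SModEq.sub_mem]
    rw [smul_eq_mul, Ideal.mul_top]
    exact Ideal.pow_le_pow_right (by omega) (hsd n))
  have hred : IsReduced (AdicCompletion m R) := hAU
  have hnil : AdicCompletion.mk m R a ^ r0 = 0 := by
    refine AdicCompletion.ext_evalₐ fun n => ?_
    rw [map_pow, map_zero, AdicCompletion.evalₐ_mk, ← map_pow, Ideal.Quotient.eq_zero_iff_mem]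
    show s n ^ r0 ∈ m ^ n
    obtain ⟨u, hu, v, hv, huv⟩ := Submodule.mem_sup.1 (hS _ n (hsS n))
    have h1 := hr n u hu
    have h2 : s n - u ∣ s n ^ r0 - u ^ r0 := sub_dvd_pow_sub_pow _ _ _
    have h3 : s n - u ∈ m ^ n := by
      rw [← huv]; simpa using Ideal.pow_le_pow_right (by omega) hv
    have h4 := Ideal.mem_of_dvd _ h2 h3
    simpa using add_mem h4 h1
  have h0 : AdicCompletion.mk m R a = 0 := hred.eq_zero _ ⟨r0, hnil⟩
  have h1 := congrArg (AdicCompletion.evalₐ m k) h0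
  rw [map_zero, AdicCompletion.evalₐ_mk, Ideal.Quotient.eq_zero_iff_mem] at h1
  have h2 : s k ∈ m ^ k := h1
  exact hs0' (by simpa using sub_mem h2 (hs0k k))

end P10
end DA

namespace DA
section P11
open MvPolynomial IsLocalRing Finset

variable {R : Type*} [CommRing R] {d : ℕ}

theorem Er_aux {x : Fin d → R} {α : ℝ} {w : R} 
    (hw : ∀ a b : ℕ, 0 < b → (a : ℝ) < b * α → w ^ b ∈ ic x a) (N : ℕ) :
    ∃ a : ℕ, N * α ≤ a + 1 ∧ w ^ N ∈ ic x a := by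
  rcases Nat.eq_zero_or_pos N with rfl | hN
  · exact ⟨0, by simp, by simp [ic_zero]⟩
  rcases le_or_gt (N * α) 1 with h | h
  · exact ⟨0, by simpa using h, by simp [ic_zero]⟩
  · have h1 : 0 < ⌈N * α⌉₊ := Nat.ceil_pos.2 (by linarith)
    refine ⟨⌈N * α⌉₊ - 1, ?_, hw _ _ hN ?_⟩
    · have := Nat.le_ceil (N * α)
      have e : ((⌈N * α⌉₊ - 1 : ℕ) : ℝ) + 1 = ⌈N * α⌉₊ := by
        norm_cast; omega
      rw [e]; exact this
    · exact Nat.lt_ceil.1 (by omega)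

theorem arch {u v : ℝ} (h : u < v) : ∃ t : ℕ, 0 < t ∧ t * u + 2 ≤ t * v := by
  obtain ⟨t, ht⟩ := exists_nat_gt (2 / (v - u))
  have h0 : 0 < v - u := by linarith
  rw [div_lt_iff₀ h0] at ht
  refine ⟨t, ?_, by nlinarith⟩
  rcases Nat.eq_zero_or_pos t with rfl | h
  · simp at ht; linarith
  · exact h

/-- real powers of the integral closure filtration -/
def Er (x : Fin d → R) (α : ℝ) : Ideal R where
  carrier := {w | ∀ a b : ℕ, 0 < b → (a : ℝ) < b * α → w ^ b ∈ ic x a}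
  zero_mem' := by
    intro a b hb _
    rw [zero_pow hb.ne']; exact zero_mem _
  add_mem' := by
    intro w z hw hz a b hb hab
    obtain ⟨t, ht, h2⟩ := arch hab
    refine ic_root ht ?_
    rw [← pow_mul, add_pow]
    refine Ideal.sum_mem _ fun i hi => Ideal.mul_mem_right _ _ ?_
    rw [mem_range] at hi
    obtain ⟨a1, h1, h1'⟩ := Er_aux hw i
    obtain ⟨a2, h3, h3'⟩ := Er_aux hz (b * t - i)
    refine ic_anti x ?_ (ic_mul h1' h3')
    have e : ((b * t - i : ℕ) : ℝ) = b * t - i := by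
      rw [Nat.cast_sub (by omega)]; push_cast; rfl
    rw [e] at h3
    have : ((t * a : ℕ) : ℝ) ≤ (a1 + a2 : ℕ) := by push_cast; nlinarith
    exact_mod_cast this
  smul_mem' := by
    intro r w hw a b hb hab
    rw [smul_eq_mul, mul_pow]
    exact Ideal.mul_mem_left _ _ (hw a b hb hab)

theorem mem_Er {x : Fin d → R} {α : ℝ} {w : R} : 
    w ∈ Er x α ↔ ∀ a b : ℕ, 0 < b → (a : ℝ) < b * α → w ^ b ∈ ic x a := Iff.rfl

theorem Er_anti (x : Fin d → R) {α β : ℝ} (h : α ≤ β) : Er x β ≤ Er x α := fun w hw a b hb hab =>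
  hw a b hb (hab.trans_le (mul_le_mul_of_nonneg_left h (Nat.cast_nonneg _)))

theorem ic_le_Er (x : Fin d → R) (n : ℕ) : ic x n ≤ Er x n := fun w hw a b hb hab =>
  ic_anti x (by have : a < b * n := by exact_mod_cast hab
                exact this.le) (ic_pow hw b)

theorem Er_le_ic (x : Fin d → R) {n : ℕ} {α : ℝ} (h : (n : ℝ) < α) : Er x α ≤ ic x n := fun w hw => by
  simpa using hw n 1 one_pos (by simpa using h)

theorem Er_mul {x : Fin d → R} {α β : ℝ} {w z : R} (hw : w ∈ Er x α) (hz : z ∈ Er x β) :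
    w * z ∈ Er x (α + β) := by
  intro a b hb hab
  obtain ⟨t, ht, h2⟩ := arch hab
  refine ic_root ht ?_
  rw [← pow_mul, mul_pow]
  obtain ⟨a1, h1, h1'⟩ := Er_aux hw (b * t)
  obtain ⟨a2, h3, h3'⟩ := Er_aux hz (b * t)
  refine ic_anti x ?_ (ic_mul h1' h3')
  push_cast at h1 h3
  have : ((t * a : ℕ) : ℝ) ≤ (a1 + a2 : ℕ) := by push_cast; nlinarith
  exact_mod_cast this

theorem Er_key [IsLocalRing R] {x : Fin d → R} (hx : QR x) {s : ℕ} {α : ℝ}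
    {F : MvPolynomial (Fin d) R} (hF : F.IsHomogeneous s) (hg : Good F) {w : R}
    (h : eval x F * w ∈ Er x (α + s)) : w ∈ Er x α := by
  intro a b hb hab
  have h1 := h (a + s * b) b hb (by push_cast; nlinarith)
  rw [mul_pow, ← map_pow] at h1
  exact ic_key hx (hF.pow b) (hg.pow b) h1

theorem Er_root {x : Fin d → R} {α : ℝ} {b : ℕ} (hb : 0 < b) {w : R} (h : w ^ b ∈ Er x (b * α)) :
    w ∈ Er x α := by
  intro a c hc hac
  have hb' : (0 : ℝ) < b := by exact_mod_cast hb
  have h1 := h (b * a) c hc (by push_cast; nlinarith)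
  refine ic_root hb ?_
  rwa [← pow_mul, mul_comm c, pow_mul]

theorem Er_pow {x : Fin d → R} {α : ℝ} {w : R} (h : w ∈ Er x α) (i : ℕ) :
    w ^ i ∈ Er x (i * α) := by
  intro a b hb hab
  rcases Nat.eq_zero_or_pos i with rfl | hi
  · simp at hab
    exact absurd hab (by have : (0 : ℝ) ≤ a := Nat.cast_nonneg a
                         linarith)
  · rw [← pow_mul]
    exact h a (i * b) (by positivity) (by push_cast; linarith)

/-- the next step of the real filtration -/
def Erp (x : Fin d → R) (α : ℝ) : Ideal R where
  carrier := {w | ∃ β, α < β ∧ w ∈ Er x β}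
  zero_mem' := ⟨α + 1, by linarith, zero_mem _⟩
  add_mem' := by
    rintro w z ⟨β, h, hw⟩ ⟨γ, h', hz⟩
    exact ⟨min β γ, lt_min h h', add_mem (Er_anti x (min_le_left _ _) hw) (Er_anti x (min_le_right _ _) hz)⟩
  smul_mem' := by
    rintro r w ⟨β, h, hw⟩
    exact ⟨β, h, Ideal.mul_mem_left _ _ hw⟩

theorem mem_Erp {x : Fin d → R} {α : ℝ} {w : R} : 
    w ∈ Erp x α ↔ ∃ β, α < β ∧ w ∈ Er x β := Iff.rfl

theorem Erp_le (x : Fin d → R) (α : ℝ) : Erp x α ≤ Er x α := by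
  rintro w ⟨β, h, hw⟩
  exact Er_anti x h.le hw

theorem Erp_nat_le (x : Fin d → R) (n : ℕ) : Erp x n ≤ ic x n := by
  rintro w ⟨β, h, hw⟩
  exact Er_le_ic x h hw

theorem m_Er [IsLocalRing R] {x : Fin d → R} {k : ℕ} (hk : maximalIdeal R ^ k ≤ JJ x) {α : ℝ} {y w : R}
    (hy : y ∈ maximalIdeal R) (hw : w ∈ Er x α) : y * w ∈ Erp x α := by
  have hk1 : maximalIdeal R ^ (k + 1) ≤ JJ x := (Ideal.pow_le_pow_right (by omega)).trans hk
  have h0 : (0 : ℝ) < (k + 1 : ℕ) := by positivity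
  have h1 : y ∈ Er x (1 / (k + 1 : ℕ)) := by
    refine Er_root (b := k + 1) (by omega) ?_
    rw [mul_one_div_cancel h0.ne']
    have := ic_le_Er x 1 (pow_le_ic x 1 (by rw [pow_one]; exact hk1 (Ideal.pow_mem_pow hy _)))
    simpa using this
  refine ⟨1 / (k + 1 : ℕ) + α, ?_, Er_mul h1 hw⟩
  have : (0 : ℝ) < 1 / (k + 1 : ℕ) := by positivity
  linarith

theorem nongood [IsLocalRing R] {x : Fin d → R} {k : ℕ} (hk : maximalIdeal R ^ k ≤ JJ x) {α : ℝ} {w : R}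
    {s : ℕ} {F : MvPolynomial (Fin d) R} (hF : F.IsHomogeneous s) (hg : ¬ Good F)
    (hw : w ∈ Er x α) : eval x F * w ∈ Erp x (α + s) := by
  have h1 : eval x F ∈ maximalIdeal R * JJ x ^ s := (mem_mul_pow x _ _ _).2 ⟨F, hF, not_not.1 hg, rfl⟩
  have h2 : eval x F ∈ Submodule.comap (LinearMap.mulRight R w) (Erp x (α + s)) := by
    refine (Ideal.mul_le.2 ?_) h1
    intro r hr u hu
    show r * u * w ∈ Erp x (α + s)
    have h3 := Er_mul (ic_le_Er x s (pow_le_ic x s hu)) hw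
    have h4 := m_Er hk hr h3
    rw [← mul_assoc, add_comm] at h4
    exact h4
  exact h2

theorem form_Er {x : Fin d → R} {α : ℝ} {w : R}
    {s : ℕ} {F : MvPolynomial (Fin d) R} (hF : F.IsHomogeneous s)
    (hw : w ∈ Er x α) : eval x F * w ∈ Er x (α + s) := by
  rw [add_comm]
  exact Er_mul (ic_le_Er x s (pow_le_ic x s (eval_mem_pow x hF))) hw

theorem exists_val [IsLocalRing R] [IsNoetherianRing R] {x : Fin d → R} 
    (hch : ∀ k, ∃ N, ic x N ≤ maximalIdeal R ^ k) {z : R} (hz : z ≠ 0) :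
    ∃ α : ℝ, z ∈ Er x α ∧ z ∉ Erp x α := by
  have h1 : ∃ k, z ∉ maximalIdeal R ^ k := by
    by_contra hc
    push Not at hc
    have h2 := Ideal.iInf_pow_eq_bot_of_isLocalRing (maximalIdeal R) (Ideal.IsPrime.ne_top inferInstance)
    have : z ∈ ⨅ i, maximalIdeal R ^ i := (Submodule.mem_iInf _).2 hc
    rw [h2] at this
    exact hz (by simpa using this)
  obtain ⟨k, hk⟩ := h1
  obtain ⟨N, hN⟩ := hch k
  have hzN : z ∉ ic x N := fun h => hk (hN h)
  let S : Set ℝ := {α | z ∈ Er x α}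
  have hbdd : BddAbove S := ⟨N, fun α hα => by
    by_contra h
    exact hzN (Er_le_ic x (not_le.1 h) hα)⟩
  have hne : S.Nonempty := ⟨0, by
    have := ic_le_Er x 0
    rw [ic_zero] at this
    have h2 : z ∈ Er x ((0:ℕ):ℝ) := this trivial
    show z ∈ Er x 0
    simpa using h2⟩
  refine ⟨sSup S, ?_, ?_⟩
  · intro a b hb hab
    have hb' : (0 : ℝ) < b := by exact_mod_cast hb
    have h3 : (a : ℝ) / b < sSup S := by rw [div_lt_iff₀ hb']; linarith
    obtain ⟨α', h4, h5⟩ := exists_lt_of_lt_csSup hne h3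
    refine h4 a b hb ?_
    rw [div_lt_iff₀ hb'] at h5; linarith
  · rintro ⟨β, h4, h5⟩
    exact absurd (le_csSup hbdd h5) (not_le.2 h4)

theorem pig [IsLocalRing R] {x : Fin d → R} (hd : 0 < d) (hx : QR x)
    {k : ℕ} (hk : maximalIdeal R ^ k ≤ JJ x) {r0 : ℕ} (hr0 : qlen (JJ x) = r0) {z : R} {α : ℝ}
    (hz : z ∈ Er x α) (hz' : z ∉ Erp x α) : ∃ e : ℕ, 0 < e ∧ e ≤ r0 ∧ ∃ n : ℤ, e * α = n := by
  classical
  by_contra hcon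
  push Not at hcon
  obtain ⟨c, hc⟩ := exists_nat_gt (∑ i : Fin (r0 + 1), |((i + 1 : ℕ) : ℝ) * α|)
  have := growth hd hx hr0 (ι := Fin (r0 + 1)) (fun i => z ^ (i + 1 : ℕ)) (fun i => ((i + 1 : ℕ) : ℝ) * α)
    (Er x) (Erp x) (Erp_le x) (fun β β' h w hw => ⟨β', h, hw⟩) (fun i s F hF => form_Er hF (Er_pow hz _))
    c ?_ ?_
  · simp at this
  · intro i s n hn w hw
    refine ⟨n, ?_, ic_le_Er x n (pow_le_ic x n hw)⟩
    have h1 : |((i + 1 : ℕ) : ℝ) * α| ≤ ∑ i : Fin (r0 + 1), |((i + 1 : ℕ) : ℝ) * α| :=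
      Finset.single_le_sum (f := fun i : Fin (r0 + 1) => |((i + 1 : ℕ) : ℝ) * α|) 
        (fun _ _ => abs_nonneg _) (mem_univ i)
    have h2 := le_abs_self (((i + 1 : ℕ) : ℝ) * α)
    have h3 : ((s + c : ℕ) : ℝ) ≤ n := by exact_mod_cast hn
    push_cast at *
    linarith
  · intro β F hF hsum i hgi
    have hother : ∀ j, j ≠ i → eval x (F j) * z ^ (j + 1 : ℕ) ∈ Erp x β := by
      intro j hj
      rcases hF j with h0 | ⟨s, hs, hsβ⟩
      · rw [h0]; simp
      by_cases hgj : Good (F j)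
      · exfalso
        rcases hF i with h0 | ⟨s', hs', hsβ'⟩
        · rw [h0] at hgi; exact hgi (Ideal.zero_mem _)
        push_cast at hsβ hsβ'
        rcases lt_trichotomy (i : ℕ) j with h | h | h
        · refine hcon (j - i) (by omega) (by omega) (s' - s) ?_
          rw [Nat.cast_sub h.le]; push_cast; linarith
        · exact hj (Fin.ext h.symm)
        · refine hcon (i - j) (by omega) (by omega) (s - s') ?_
          rw [Nat.cast_sub h.le]; push_cast; linarith
      · rw [← hsβ]
        exact nongood hk hs hgj (Er_pow hz _)
    rw [← Finset.add_sum_erase _ _ (mem_univ i)] at hsum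
    have h1 := (Submodule.add_mem_iff_left _ 
      (Ideal.sum_mem _ fun j hj => hother j (mem_erase.1 hj).1)).1 hsum
    rcases hF i with h0 | ⟨s', hs', hsβ'⟩
    · rw [h0] at hgi; exact hgi (Ideal.zero_mem _)
    obtain ⟨γ, h2, h3⟩ := h1
    have h4 : z ^ (i + 1 : ℕ) ∈ Er x (γ - s') := Er_key hx hs' hgi (by simpa using h3)
    have hi0 : (0 : ℝ) < ((i + 1 : ℕ) : ℝ) := by positivity
    refine hz' ⟨(γ - s') / ((i + 1 : ℕ) : ℝ), ?_, Er_root (b := (i + 1 : ℕ)) (by omega) ?_⟩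
    · rw [lt_div_iff₀ hi0]; linarith
    · rwa [mul_div_cancel₀ _ hi0.ne']

theorem Er_nat [IsLocalRing R] {x : Fin d → R} (hd : 0 < d) (hx : QR x)
    {k : ℕ} (hk : maximalIdeal R ^ k ≤ JJ x) {r0 : ℕ} (hr0 : qlen (JJ x) = r0) (n : ℕ) :
    Er x n = ic x n := by
  classical
  refine le_antisymm (fun z hz => ?_) (ic_le_Er x n)
  by_contra hcon
  let x0 := x ⟨0, hd⟩
  have hx0 : ∀ t, x0 ^ t ∈ ic x t := fun t => pow_le_ic x t (Ideal.pow_mem_pow (x_mem x _) t)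
  have hxh : ∀ t, (X ⟨0, hd⟩ ^ t : MvPolynomial (Fin d) R).IsHomogeneous t := fun t => by
    simpa using (isHomogeneous_X R (⟨0, hd⟩ : Fin d)).pow t
  have hzi : ∀ i ≤ r0, z ^ (i + 1) * x0 ^ ((r0 - i) * n) ∈ Er x ((r0 + 1) * n : ℕ) := by
    intro i hi
    have := Er_mul (Er_pow hz (i + 1)) (ic_le_Er x _ (hx0 ((r0 - i) * n)))
    have e : ((i + 1 : ℕ) : ℝ) * n + ((r0 - i) * n : ℕ) = ((r0 + 1) * n : ℕ) := by
      norm_cast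
      rw [← add_mul]; congr 1; omega
    rwa [e] at this
  have := growthN hd hx hr0 (ι := Fin (r0 + 1)) (fun i => z ^ (i + 1 : ℕ) * x0 ^ ((r0 - i) * n)) 
    (fun i => (r0 + 1) * n) (fun N => Er x N) (fun N => ic x N) (fun N => ic_le_Er x N) 
    (fun N => Er_le_ic x (by push_cast; linarith)) 
    (fun i s F hF => by 
      have := form_Er hF (hzi i (by omega))
      push_cast at this ⊢
      exact this)
    ((r0 + 1) * n) (fun i s t hst => (pow_le_ic x t).trans (ic_anti x (by omega))) ?_
  · simp at this
  intro N F hF hsum i hgi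
  obtain ⟨s, hsN⟩ : ∃ s, (r0 + 1) * n + s = N := by
    rcases hF i with h0 | ⟨s, _, h⟩
    · rw [h0] at hgi; exact absurd (Ideal.zero_mem _) hgi
    · exact ⟨s, h⟩
  have hF' : ∀ i, (F i).IsHomogeneous s := by
    intro i
    rcases hF i with h | ⟨s', h, hs⟩
    · rw [h]; exact isHomogeneous_zero _ _ _
    · have : s' = s := by omega
      rwa [← this]
  obtain ⟨c, hc, hcmax⟩ := (Finset.univ.filter fun i => Good (F i)).exists_max_image id ⟨i, by simpa using hgi⟩
  simp only [mem_filter, mem_univ, true_and, id] at hc hcmax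
  let f : ℕ → R := fun i => if h : i < r0 + 1 then eval x (F ⟨i, h⟩) else 0
  have hfF : ∀ i : Fin (r0 + 1), eval x (F i) = f i := fun i => by simp only [f]; rw [dif_pos i.2]
  have hfs : ∀ i, f i ∈ ic x s := by
    intro i
    simp only [f]
    split_ifs with h
    · exact pow_le_ic x s (eval_mem_pow x (hF' _))
    · exact zero_mem _
  have hbig : ∀ i : Fin (r0 + 1), c < i → eval x (F i) * (z ^ (i + 1 : ℕ) * x0 ^ ((r0 - i) * n)) ∈ ic x N := by
    intro i hi
    have hng : ¬ Good (F i) := fun h => absurd (hcmax i h) (not_le.2 hi)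
    have := nongood hk (hF' i) hng (hzi i (by omega))
    rw [← hsN]
    refine Erp_nat_le x _ ?_
    push_cast at this ⊢
    exact this
  let W : R := ∑ i ∈ range (c + 1), f i * (z ^ (i + 1) * x0 ^ ((c - i) * n))
  have hW : x0 ^ ((r0 - c) * n) * W ∈ ic x N := by
    have e1 : x0 ^ ((r0 - c) * n) * W = ∑ i ∈ range (c + 1), f i * (z ^ (i + 1) * x0 ^ ((r0 - i) * n)) := by
      rw [Finset.mul_sum]
      refine Finset.sum_congr rfl fun i hi => ?_
      rw [mem_range] at hi
      have : (r0 - i) * n = (r0 - c) * n + (c - i) * n := by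
        rw [← add_mul]; congr 1; omega
      rw [this, pow_add]; ring
    have e2 : ∑ i : Fin (r0 + 1), eval x (F i) * (z ^ (i + 1 : ℕ) * x0 ^ ((r0 - i) * n)) = 
        ∑ i ∈ range (r0 + 1), f i * (z ^ (i + 1) * x0 ^ ((r0 - i) * n)) := by
      rw [Finset.sum_range]
      exact Finset.sum_congr rfl fun i _ => by rw [hfF]
    rw [e2] at hsum
    have e3 := Finset.sum_range_add_sum_Ico (fun i => f i * (z ^ (i + 1) * x0 ^ ((r0 - i) * n))) 
      (show (c : ℕ) + 1 ≤ r0 + 1 by omega)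
    rw [← e3] at hsum
    rw [e1]
    refine (Submodule.add_mem_iff_left _ (Ideal.sum_mem _ fun i hi => ?_)).1 hsum
    rw [mem_Ico] at hi
    have := hbig ⟨i, hi.2⟩ (by rw [Fin.lt_def]; simp; omega)
    rw [hfF] at this
    exact this
  have hW' : W ∈ ic x ((c + 1) * n + s) := by
    refine ic_key hx (hxh ((r0 - c) * n)) ((good_X _).pow _) ?_
    rw [map_pow, eval_X]
    have : (c + 1) * n + s + (r0 - c) * n = N := by
      rw [← hsN, add_right_comm, ← add_mul]; congr 2; omega
    rwa [this]
  refine hcon (ic_L hx (hF' c) hc (m := c + 1) 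
    (fun b => if b = 0 then W else - (f (b - 1) * x0 ^ ((c - (b - 1)) * n))) (by omega) ?_ ?_)
  · intro b hb
    show (if b = 0 then W else - (f (b - 1) * x0 ^ ((c - (b - 1)) * n))) ∈ _
    split_ifs with h
    · rw [h]; exact hW'
    · refine neg_mem ?_
      have := ic_mul (hfs (b - 1)) (hx0 ((c - (b - 1)) * n))
      rw [add_comm] at this
      have e : c - (b - 1) = c + 1 - b := by omega
      rw [e] at this ⊢
      exact this
  · rw [Finset.sum_range_succ']
    simp only [Nat.add_eq_zero_iff, one_ne_zero, and_false, if_false, if_true, Nat.add_sub_cancel, pow_zero, mul_one]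
    simp only [W]
    rw [Finset.sum_range_succ, hfF]
    simp only [Nat.sub_self, zero_mul, pow_zero, mul_one]
    have : ∑ i ∈ range c, -(f i * x0 ^ ((c - i) * n)) * z ^ (i + 1) = 
      - ∑ i ∈ range c, f i * (z ^ (i + 1) * x0 ^ ((c - i) * n)) := by
      rw [← Finset.sum_neg_distrib]
      exact Finset.sum_congr rfl fun i _ => by ring
    rw [this]; ring

theorem root_gap [IsLocalRing R] [IsNoetherianRing R] {x : Fin d → R} (hd : 0 < d) (hx : QR x)
    {k : ℕ} (hk : maximalIdeal R ^ k ≤ JJ x) {r0 : ℕ} (hr0 : qlen (JJ x) = r0) 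
    (hch : ∀ k, ∃ N, ic x N ≤ maximalIdeal R ^ k) {b j : ℕ} (hb : 0 < b) {w : R} 
    (h : (w ^ (r0.factorial)) ^ b ∈ ic x (b * j + 1)) : w ^ (r0.factorial) ∈ ic x (j + 1) := by
  rcases eq_or_ne w 0 with rfl | hw
  · rw [zero_pow (Nat.factorial_ne_zero _)]; exact zero_mem _
  obtain ⟨α, h1, h2⟩ := exists_val hch hw
  obtain ⟨e', he0, her, n, hn⟩ := pig hd hx hk hr0 h1 h2
  obtain ⟨q, hq⟩ := Nat.dvd_factorial he0 her
  have hE : (r0.factorial : ℝ) * α = (q * n : ℤ) := by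
    rw [hq]; push_cast; rw [← hn]; ring
  have he : (0 : ℝ) < r0.factorial := by exact_mod_cast Nat.factorial_pos _
  have hb' : (0 : ℝ) < b := by exact_mod_cast hb
  have h3 : w ∈ Er x ((j + 1 / b) / r0.factorial) := by
    refine Er_root (Nat.factorial_pos r0) (Er_root hb ?_)
    have := ic_le_Er x _ h
    convert this using 2
    push_cast
    field_simp
  have h4 : (j + 1 / b : ℝ) / r0.factorial ≤ α := by
    by_contra hc
    exact h2 ⟨_, not_le.1 hc, h3⟩
  rw [div_le_iff₀ he, mul_comm α, hE] at h4
  have h5 : (0 : ℝ) < 1 / b := by positivity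
  have h6 : (j : ℤ) < q * n := by
    have : ((j : ℤ) : ℝ) < (q * n : ℤ) := by push_cast at h4 ⊢; linarith
    exact_mod_cast this
  have h7 := Er_pow h1 (r0.factorial)
  rw [hE] at h7
  rw [← Er_nat hd hx hk hr0]
  refine Er_anti x ?_ h7
  have : ((j + 1 : ℤ) : ℝ) ≤ (q * n : ℤ) := by exact_mod_cast h6
  push_cast at this ⊢
  exact this

end P11
end DA

namespace DA
section P12
open MvPolynomial IsLocalRing Finset

variable {R : Type*} [CommRing R] {d : ℕ}

/-- a multiplicative filtration -/
structure Filt (R : Type*) [CommRing R] where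
  f : ℕ → Ideal R
  zero : f 0 = ⊤
  mul : ∀ i j, f i * f j ≤ f (i + j)
  succ : ∀ i, f (i + 1) ≤ f i

variable (𝓕 : Filt R)

theorem Filt.anti {i j : ℕ} (h : i ≤ j) : 𝓕.f j ≤ 𝓕.f i := antitone_nat_of_succ_le 𝓕.succ h

theorem Filt.mul_mem {i j : ℕ} {u v : R} (hu : u ∈ 𝓕.f i) (hv : v ∈ 𝓕.f j) : u * v ∈ 𝓕.f (i + j) :=
  𝓕.mul i j (Ideal.mul_mem_mul hu hv)

/-- Rees algebra -/
def AF : Subalgebra R (Polynomial R) where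
  carrier := {p | ∀ n, p.coeff n ∈ 𝓕.f n}
  mul_mem' := by
    intro p q hp hq n
    rw [Polynomial.coeff_mul]
    refine Ideal.sum_mem _ fun ij hij => ?_
    rw [← (HasAntidiagonal.mem_antidiagonal.1 hij)]
    exact 𝓕.mul_mem (hp _) (hq _)
  add_mem' := by
    intro p q hp hq n
    rw [Polynomial.coeff_add]; exact add_mem (hp n) (hq n)
  algebraMap_mem' := by
    intro r n
    rw [Polynomial.algebraMap_apply, Algebra.algebraMap_self_apply, Polynomial.coeff_C]
    split_ifs with h
    · rw [h, 𝓕.zero]; trivial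
    · exact zero_mem _

theorem mem_AF {p : Polynomial R} : p ∈ AF 𝓕 ↔ ∀ n, p.coeff n ∈ 𝓕.f n := Iff.rfl

/-- the kernel to the graded ring -/
def KF : Ideal (AF 𝓕) where
  carrier := {p | ∀ n, (p : Polynomial R).coeff n ∈ 𝓕.f (n + 1)}
  add_mem' := by
    intro p q hp hq n
    rw [AddMemClass.coe_add, Polynomial.coeff_add]; exact add_mem (hp n) (hq n)
  zero_mem' := by
    intro n
    simp
  smul_mem' := by
    intro p q hq n
    rw [smul_eq_mul, MulMemClass.coe_mul, Polynomial.coeff_mul]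
    refine Ideal.sum_mem _ fun ij hij => ?_
    rw [← (HasAntidiagonal.mem_antidiagonal.1 hij), add_assoc]
    exact 𝓕.mul_mem (p.2 _) (hq _)

theorem mem_KF {p : AF 𝓕} : p ∈ KF 𝓕 ↔ ∀ n, (p : Polynomial R).coeff n ∈ 𝓕.f (n + 1) := Iff.rfl

/-- the monomial elements -/
noncomputable def mono {j : ℕ} {w : R} (hw : w ∈ 𝓕.f j) : AF 𝓕 := ⟨Polynomial.monomial j w, fun n => by
  rw [Polynomial.coeff_monomial]
  split_ifs with h
  · rw [← h]; exact hw
  · exact zero_mem _⟩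

theorem mono_mem_KF {j : ℕ} {w : R} (hw : w ∈ 𝓕.f j) : mono 𝓕 hw ∈ KF 𝓕 ↔ w ∈ 𝓕.f (j + 1) := by
  rw [mem_KF]
  constructor
  · intro h; simpa [mono] using h j
  · intro h n
    simp only [mono, Polynomial.coeff_monomial]
    split_ifs with h'
    · rw [← h']; exact h
    · exact zero_mem _

theorem rep (b : AF 𝓕 ⧸ KF 𝓕) (hb : b ≠ 0) : ∃ a : AF 𝓕, Ideal.Quotient.mk (KF 𝓕) a = b ∧ 
    (a : Polynomial R).leadingCoeff ∉ 𝓕.f ((a : Polynomial R).natDegree + 1) := by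
  obtain ⟨a, rfl⟩ := Ideal.Quotient.mk_surjective b
  have : ∀ n, ∀ a : AF 𝓕, (a : Polynomial R).support.card ≤ n → Ideal.Quotient.mk (KF 𝓕) a ≠ 0 → 
      ∃ a' : AF 𝓕, Ideal.Quotient.mk (KF 𝓕) a' = Ideal.Quotient.mk (KF 𝓕) a ∧ 
    (a' : Polynomial R).leadingCoeff ∉ 𝓕.f ((a' : Polynomial R).natDegree + 1) := by
    intro n
    induction n with
    | zero =>
      intro a h h'
      exfalso
      apply h'
      have : (a : Polynomial R) = 0 := by simpa using h
      have : a = 0 := Subtype.ext this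
      rw [this, map_zero]
    | succ n ih =>
      intro a h h'
      by_cases hl : (a : Polynomial R).leadingCoeff ∈ 𝓕.f ((a : Polynomial R).natDegree + 1)
      · have ha0 : (a : Polynomial R) ≠ 0 := by
          intro h0
          have : a = 0 := Subtype.ext h0
          exact h' (by rw [this, map_zero])
        let a1 := a - mono 𝓕 (a.2 (a : Polynomial R).natDegree)
        have ha1 : (a1 : Polynomial R) = (a : Polynomial R).eraseLead := by
          simp only [a1, mono, AddSubgroupClass.coe_sub]
          rw [sub_eq_iff_eq_add]
          exact ((a : Polynomial R).eraseLead_add_monomial_natDegree_leadingCoeff).symm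
        have e : Ideal.Quotient.mk (KF 𝓕) a1 = Ideal.Quotient.mk (KF 𝓕) a := by
          rw [Ideal.Quotient.eq]
          simp only [a1, sub_sub_cancel_left]
          exact neg_mem ((mono_mem_KF 𝓕 _).2 hl)
        rw [← e] at h' ⊢
        refine ih a1 ?_ h'
        rw [ha1]
        have := Polynomial.eraseLead_support_card_lt ha0
        omega
      · exact ⟨a, rfl, hl⟩
  exact this _ a le_rfl hb

theorem isReduced_gr (hroot : ∀ b j w, 0 < b → w ∈ 𝓕.f j → w ^ b ∈ 𝓕.f (b * j + 1) → w ∈ 𝓕.f (j + 1)) :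
    IsReduced (AF 𝓕 ⧸ KF 𝓕) := by
  refine ⟨fun b hb => ?_⟩
  by_contra h0
  obtain ⟨a, rfl, ha⟩ := rep 𝓕 b h0
  obtain ⟨n, hn⟩ := hb
  rw [← map_pow, Ideal.Quotient.eq_zero_iff_mem] at hn
  rcases Nat.eq_zero_or_pos n with rfl | hn0
  · rw [pow_zero] at hn
    refine h0 ?_
    rw [Ideal.Quotient.eq_zero_iff_mem, ← mul_one a]
    exact Ideal.mul_mem_left _ _ hn
  · have h1 := hn (n * (a : Polynomial R).natDegree)
    rw [SubmonoidClass.coe_pow, Polynomial.coeff_pow_mul_natDegree] at h1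
    exact ha (hroot n _ _ hn0 (a.2 _) h1)

variable [IsLocalRing R] {x : Fin d → R} {e : ℕ} 

/-- action of the polynomial ring -/
noncomputable def psi (he : 0 < e) (hJ : ∀ s, JJ x ^ s ≤ 𝓕.f (e * s)) : MvPolynomial (Fin d) R →ₐ[R] AF 𝓕 :=
  ((Polynomial.expand R e).comp (phi x)).codRestrict (AF 𝓕) (fun F n => by
    rw [AlgHom.comp_apply, Polynomial.coeff_expand he]
    split_ifs with h
    · rw [phi_coeff]
      obtain ⟨t, rfl⟩ := h
      rw [Nat.mul_div_cancel_left _ he]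
      exact hJ t (eval_mem_pow x (homogeneousComponent_isHomogeneous _ _))
    · exact zero_mem _)

variable {𝓕} (he : 0 < e) (hJ : ∀ s, JJ x ^ s ≤ 𝓕.f (e * s)) (hm : maximalIdeal R ≤ 𝓕.f 1)

theorem psi_val (F : MvPolynomial (Fin d) R) : (psi 𝓕 he hJ F : Polynomial R) = Polynomial.expand R e (phi x F) := rfl


variable (𝓕) in
/-- the graded ring -/
def GrF : Type _ := AF 𝓕 ⧸ KF 𝓕

noncomputable instance : CommRing (GrF 𝓕) := inferInstanceAs (CommRing (AF 𝓕 ⧸ KF 𝓕))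

variable (𝓕) in
/-- projection -/
noncomputable def pr : AF 𝓕 →+* GrF 𝓕 := Ideal.Quotient.mk (KF 𝓕)

theorem pr_surj (b : GrF 𝓕) : ∃ a, pr 𝓕 a = b := Ideal.Quotient.mk_surjective b

theorem pr_eq_zero {a : AF 𝓕} : pr 𝓕 a = 0 ↔ ∀ n, (a : Polynomial R).coeff n ∈ 𝓕.f (n + 1) := 
  Ideal.Quotient.eq_zero_iff_mem

/-- the residue field acts -/
noncomputable def kap (hm : maximalIdeal R ≤ 𝓕.f 1) : ResidueField R →+* GrF 𝓕 :=
  Ideal.Quotient.lift (maximalIdeal R) ((pr 𝓕).comp (algebraMap R (AF 𝓕))) (fun r hr => by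
    rw [RingHom.comp_apply, pr_eq_zero]
    intro n
    show (Polynomial.C r).coeff n ∈ _
    rw [Polynomial.coeff_C]
    split_ifs with h
    · rw [h]; exact hm hr
    · exact zero_mem _)

theorem kap_residue (r : R) : kap hm (residue R r) = pr 𝓕 (algebraMap R (AF 𝓕) r) := rfl

/-- the structure map -/
noncomputable def theta : MvPolynomial (Fin d) (ResidueField R) →+* GrF 𝓕 :=
  eval₂Hom (kap hm) (fun i => pr 𝓕 (psi 𝓕 he hJ (X i)))

theorem theta_map (G : MvPolynomial (Fin d) R) : 
    theta he hJ hm (map (residue R) G) = pr 𝓕 (psi 𝓕 he hJ G) := by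
  have : (theta he hJ hm).comp (map (residue R)) = (pr 𝓕).comp (psi 𝓕 he hJ : MvPolynomial (Fin d) R →+* AF 𝓕) := by
    refine MvPolynomial.ringHom_ext ?_ ?_
    · intro r
      rw [RingHom.comp_apply, map_C, theta, eval₂Hom_C, kap_residue, RingHom.comp_apply]
      congr 1
      exact ((psi 𝓕 he hJ).commutes r).symm
    · intro i
      rw [RingHom.comp_apply, map_X, theta, eval₂Hom_X']
      rfl
  exact RingHom.congr_fun this G

end P12
end DA

namespace DA
section P13
open MvPolynomial IsLocalRing Finset

variable {R : Type*} [CommRing R] {d : ℕ}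

theorem good_iff [IsLocalRing R] {F : MvPolynomial (Fin d) R} : Good F ↔ map (residue R) F ≠ 0 := by
  unfold Good
  rw [not_iff_comm, not_not, MvPolynomial.mem_map_C_iff, MvPolynomial.ext_iff]
  refine forall_congr' fun m => ?_
  rw [coeff_map, coeff_zero, residue_eq_zero_iff]

theorem isIntegral_of_rel {P B : Type*} [CommRing P] [CommRing B] [Algebra P B] (y : B) (k : ℕ) (hk : 0 < k)
    (c : ℕ → P) (h : y ^ k = ∑ i ∈ range k, c i • y ^ i) : IsIntegral P y := by
  obtain ⟨n, rfl⟩ : ∃ n, k = n + 1 := ⟨k - 1, by omega⟩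
  refine ⟨Polynomial.X ^ (n + 1) - ∑ i ∈ range (n + 1), Polynomial.C (c i) * Polynomial.X ^ i, ?_, ?_⟩
  · apply Polynomial.monic_X_pow_sub
    refine lt_of_le_of_lt (b := (n : WithBot ℕ)) ((Polynomial.degree_sum_le (range (n + 1)) (fun i => Polynomial.C (c i) * Polynomial.X ^ i)).trans ?_) (by exact_mod_cast Nat.lt_succ_self n)
    refine Finset.sup_le fun i hi => ?_
    refine (Polynomial.degree_C_mul_X_pow_le _ _).trans ?_
    have := mem_range.1 hi
    exact_mod_cast (by omega : i ≤ n)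
  · rw [Polynomial.eval₂_sub, Polynomial.eval₂_X_pow, Polynomial.eval₂_finsetSum, h, sub_eq_zero]
    refine Finset.sum_congr rfl fun i _ => ?_
    rw [Polynomial.eval₂_mul, Polynomial.eval₂_C, Polynomial.eval₂_X_pow, Algebra.smul_def] 

theorem lift_top [IsLocalRing R] (p : MvPolynomial (Fin d) (ResidueField R)) (hp : p ≠ 0) :
    ∃ (s : ℕ) (G : MvPolynomial (Fin d) R), map (residue R) G = p ∧ Good (homogeneousComponent s G) ∧
      ∀ t, s < t → homogeneousComponent t G = 0 := by
  obtain ⟨G', rfl⟩ := MvPolynomial.map_surjective (residue R) residue_surjective p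
  have hmap : ∀ t (H : MvPolynomial (Fin d) R), map (residue R) (homogeneousComponent t H) = homogeneousComponent t (map (residue R) H) := by
    intro t H
    ext m
    simp only [coeff_map, coeff_homogeneousComponent]
    split_ifs <;> simp
  set p := map (residue R) G' with hpdef
  set s := p.totalDegree with hs
  have hG : ∀ t, homogeneousComponent t (∑ i ∈ range (s + 1), homogeneousComponent i G') = 
      if t ≤ s then homogeneousComponent t G' else 0 := by
    intro t
    rw [map_sum]
    simp_rw [homogeneousComponent_of_mem (homogeneousComponent_mem _ _)]
    rw [Finset.sum_ite_eq]
    simp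
  refine ⟨s, ∑ i ∈ range (s + 1), homogeneousComponent i G', ?_, ?_, ?_⟩
  · rw [map_sum]
    simp_rw [hmap]
    exact sum_homogeneousComponent p
  · rw [hG, if_pos le_rfl, good_iff, hmap, ← hpdef]
    intro h0
    obtain ⟨m, hm, hm'⟩ := Finset.exists_mem_eq_sup p.support (support_nonempty.2 hp) (fun m => m.degree)
    have : coeff m (homogeneousComponent s p) = coeff m p := by
      rw [coeff_homogeneousComponent, if_pos]
      rw [hs, ← hm']
      rfl
    rw [h0, coeff_zero] at this
    exact (mem_support_iff.1 hm) this.symm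
  · intro t ht
    rw [hG, if_neg (by omega)]

variable [IsLocalRing R] {x : Fin d → R} {e : ℕ} {𝓕 : Filt R} (he : 0 < e) (hJ : ∀ s, JJ x ^ s ≤ 𝓕.f (e * s)) (hm : maximalIdeal R ≤ 𝓕.f 1)

theorem gr_tf (hkey : ∀ (s j : ℕ) (F : MvPolynomial (Fin d) R) (w : R), F.IsHomogeneous s → Good F → 
      eval x F * w ∈ 𝓕.f (j + e * s) → w ∈ 𝓕.f j) (p : MvPolynomial (Fin d) (ResidueField R)) (b : GrF 𝓕)
    (h : theta he hJ hm p * b = 0) : p = 0 ∨ b = 0 := by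
  by_contra hcon
  push Not at hcon
  obtain ⟨hp, hb⟩ := hcon
  obtain ⟨s, G, rfl, hg, ht⟩ := lift_top p hp
  obtain ⟨a, ha, hl⟩ := rep 𝓕 b hb
  replace ha : pr 𝓕 a = b := ha
  rw [← ha, theta_map, ← map_mul, pr_eq_zero] at h
  have h1 := h (e * s + (a : Polynomial R).natDegree)
  rw [MulMemClass.coe_mul, psi_val] at h1
  have h2 : (Polynomial.expand R e (phi x G)).natDegree ≤ e * s := by
    rw [Polynomial.natDegree_expand, mul_comm]
    refine Nat.mul_le_mul_left _ ?_
    rw [Polynomial.natDegree_le_iff_coeff_eq_zero]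
    intro N hN
    rw [phi_coeff, ht N hN, map_zero]
  rw [Polynomial.coeff_mul_add_eq_of_natDegree_le h2 le_rfl, mul_comm e s, Polynomial.coeff_expand_mul he, phi_coeff] at h1
  apply hl
  refine hkey s _ _ _ (homogeneousComponent_isHomogeneous s G) hg ?_
  rw [Polynomial.leadingCoeff]
  convert h1 using 2
  ring

theorem sum_mono (a : AF 𝓕) : a = ∑ n ∈ (a : Polynomial R).support, mono 𝓕 (a.2 n) := by
  apply Subtype.ext
  rw [AddSubmonoidClass.coe_finsetSum]
  exact (a : Polynomial R).as_sum_support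

theorem psi_mono {s j : ℕ} {F : MvPolynomial (Fin d) R} (hF : F.IsHomogeneous s) {w : R} (hw : w ∈ 𝓕.f j) :
    (psi 𝓕 he hJ F * mono 𝓕 hw : AF 𝓕) = (Polynomial.monomial (e * s + j) (eval x F * w) : Polynomial R) := by
  rw [MulMemClass.coe_mul, psi_val, phi_hom x hF, Polynomial.expand_monomial]
  simp only [mono]
  rw [Polynomial.monomial_mul_monomial, mul_comm s e]

theorem mono_pow_val {j : ℕ} {w : R} (hw : w ∈ 𝓕.f j) (i : ℕ) : 
    ((mono 𝓕 hw ^ i : AF 𝓕) : Polynomial R) = Polynomial.monomial (j * i) (w ^ i) := by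
  rw [SubmonoidClass.coe_pow]
  simp only [mono]
  rw [Polynomial.monomial_pow]

theorem gr_integral (hintg : ∀ j w, w ∈ 𝓕.f j → ∃ k > 0, ∃ a : ℕ → R, (∀ i < k, a i ∈ JJ x ^ (j * (k - i))) ∧
      (w ^ e) ^ k = ∑ i ∈ range k, a i * (w ^ e) ^ i) (b : GrF 𝓕) : (theta he hJ hm).IsIntegralElem b := by
  let _ : Algebra (MvPolynomial (Fin d) (ResidueField R)) (GrF 𝓕) := (theta he hJ hm).toAlgebra
  show IsIntegral (MvPolynomial (Fin d) (ResidueField R)) b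
  obtain ⟨a, rfl⟩ := pr_surj b
  rw [sum_mono a, map_sum]
  refine IsIntegral.sum _ fun n _ => ?_
  set w := (a : Polynomial R).coeff n
  have hw : w ∈ 𝓕.f n := a.2 n
  show IsIntegral (MvPolynomial (Fin d) (ResidueField R)) (pr 𝓕 (mono 𝓕 hw))
  refine IsIntegral.of_pow he ?_
  obtain ⟨k, hk, c, hc, hrel⟩ := hintg n w hw
  have : ∀ i, ∃ F : MvPolynomial (Fin d) R, i < k → F.IsHomogeneous (n * (k - i)) ∧ eval x F = c i := by
    intro i
    by_cases hi : i < k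
    · obtain ⟨F, hF⟩ := (Ideal.mem_span_pow_iff_exists_isHomogeneous x (c i)).1 (hc i hi)
      exact ⟨F, fun _ => hF⟩
    · exact ⟨0, fun h => absurd h hi⟩
  choose F hF using this
  refine isIntegral_of_rel _ k hk (fun i => map (residue R) (F i)) ?_
  have : ∀ i, map (residue R) (F i) • (pr 𝓕 (mono 𝓕 hw) ^ e) ^ i = pr 𝓕 (psi 𝓕 he hJ (F i) * (mono 𝓕 hw ^ e) ^ i) := by
    intro i
    rw [map_mul, map_pow, map_pow, ← theta_map he hJ hm]
    rfl
  simp_rw [this]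
  rw [← map_pow, ← map_pow, ← map_sum]
  congr 1
  apply Subtype.ext
  rw [AddSubmonoidClass.coe_finsetSum, ← pow_mul, mono_pow_val, pow_mul w, hrel, map_sum]
  refine Finset.sum_congr rfl fun i hi => ?_
  have hi := mem_range.1 hi
  rw [MulMemClass.coe_mul, psi_val, phi_hom x (hF i hi).1, Polynomial.expand_monomial, ← pow_mul (mono 𝓕 hw), mono_pow_val, 
    Polynomial.monomial_mul_monomial, (hF i hi).2, pow_mul w]
  congr 2
  obtain ⟨t, rfl⟩ : ∃ t, k = i + t := ⟨k - i, by omega⟩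
  rw [Nat.add_sub_cancel_left]
  ring

theorem gr_rank {r0 : ℕ} (hgr : ∀ (n : ℕ) (z : Fin n → R) (j : Fin n → ℕ), (∀ i, z i ∈ 𝓕.f (j i)) → 
      (∀ (N : ℕ) (F : Fin n → MvPolynomial (Fin d) R), (∀ i, F i = 0 ∨ ∃ s, (F i).IsHomogeneous s ∧ e * s + j i = N) → 
        ∑ i, eval x (F i) * z i ∈ 𝓕.f (N + 1) → ∀ i, ¬ Good (F i)) → n ≤ r0) :
    let _ : Algebra (MvPolynomial (Fin d) (ResidueField R)) (GrF 𝓕) := (theta he hJ hm).toAlgebra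
    ∃ S : Finset (GrF 𝓕), ∀ b : GrF 𝓕, ∃ p : MvPolynomial (Fin d) (ResidueField R), p ≠ 0 ∧ 
      p • b ∈ Submodule.span (MvPolynomial (Fin d) (ResidueField R)) (S : Set (GrF 𝓕)) := by
  classical
  intro alg
  let P := MvPolynomial (Fin d) (ResidueField R)
  let Q := {q : ℕ × R // q.2 ∈ 𝓕.f q.1}
  let v : Q → GrF 𝓕 := fun q => pr 𝓕 (mono 𝓕 q.2)
  obtain ⟨s, hs, hs'⟩ := exists_maximal_linearIndepOn P v
  have hfin : s.Finite := by
    by_contra hinf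
    obtain ⟨t, hts, htc⟩ := Set.Infinite.exists_subset_card_eq hinf (r0 + 1)
    let q : Fin (r0 + 1) → Q := fun i => (t.equivFinOfCardEq htc).symm i
    have hq : Function.Injective q := Subtype.val_injective.comp (Equiv.injective _)
    have hli : LinearIndependent P (fun i => v (q i)) := by
      have := hs.linearIndependent.comp (fun i => (⟨q i, hts ((t.equivFinOfCardEq htc).symm i).2⟩ : s)) 
        (fun i j h => hq (by simpa using h))
      exact this
    have := hgr (r0 + 1) (fun i => (q i).1.2) (fun i => (q i).1.1) (fun i => (q i).2) (by
      intro N F hF hsum i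
      rw [good_iff, not_not]
      refine Fintype.linearIndependent_iff.1 hli (fun i => map (residue R) (F i)) ?_ i
      have : ∀ i, map (residue R) (F i) • v (q i) = pr 𝓕 (psi 𝓕 he hJ (F i) * mono 𝓕 (q i).2) := by
        intro i
        rw [map_mul, ← theta_map he hJ hm]
        rfl
      simp_rw [this]
      rw [← map_sum, pr_eq_zero]
      have : ((∑ i, psi 𝓕 he hJ (F i) * mono 𝓕 (q i).2 : AF 𝓕) : Polynomial R) = Polynomial.monomial N (∑ i, eval x (F i) * (q i).1.2) := by
        rw [AddSubmonoidClass.coe_finsetSum, map_sum]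
        refine Finset.sum_congr rfl fun i _ => ?_
        rcases hF i with h0 | ⟨s, h1, h2⟩
        · rw [h0, map_zero, map_zero, zero_mul, zero_mul, map_zero]; rfl
        · rw [psi_mono he hJ h1, h2]
      rw [this]
      intro n
      rw [Polynomial.coeff_monomial]
      split_ifs with h
      · rw [← h]; exact hsum
      · exact zero_mem _)
    omega
  refine ⟨(hfin.image v).toFinset, fun b => ?_⟩
  rw [Set.Finite.coe_toFinset]
  obtain ⟨a, rfl⟩ := pr_surj b
  rw [sum_mono a, map_sum]
  generalize (a : Polynomial R).support = T
  induction T using Finset.induction_on with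
  | empty => exact ⟨1, one_ne_zero, by simp⟩
  | insert n T hn ih =>
    obtain ⟨p, hp, hp'⟩ := ih
    have : ∃ p : P, p ≠ 0 ∧ p • (v ⟨(n, _), a.2 n⟩) ∈ Submodule.span P (v '' s) := by
      by_cases h : (⟨(n, _), a.2 n⟩ : Q) ∈ s
      · exact ⟨1, one_ne_zero, by rw [one_smul]; exact Submodule.subset_span ⟨_, h, rfl⟩⟩
      · exact hs' _ h
    obtain ⟨p', hp1, hp2⟩ := this
    refine ⟨p' * p, mul_ne_zero hp1 hp, ?_⟩
    rw [Finset.sum_insert hn, smul_add]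
    refine add_mem ?_ ?_
    · rw [mul_comm, mul_smul]
      exact Submodule.smul_mem _ _ hp2
    · rw [mul_smul]
      exact Submodule.smul_mem _ _ hp'

end P13
end DA

namespace DA
section P14
open MvPolynomial IsLocalRing Finset

variable {R : Type*} [CommRing R] {d : ℕ} [IsLocalRing R] 

theorem fin_step {x : Fin d → R} {e : ℕ} {𝓕 : Filt R} (he : 0 < e) (hJ : ∀ s, JJ x ^ s ≤ 𝓕.f (e * s)) (hm : maximalIdeal R ≤ 𝓕.f 1)
    (hfin : (theta he hJ hm).Finite) : ∃ c0, ∀ j, c0 ≤ j → 𝓕.f j ≤ JJ x * 𝓕.f (j - e) ⊔ 𝓕.f (j + 1) := by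
  classical
  let _ : Algebra (MvPolynomial (Fin d) (ResidueField R)) (GrF 𝓕) := (theta he hJ hm).toAlgebra
  have hfin' : Module.Finite (MvPolynomial (Fin d) (ResidueField R)) (GrF 𝓕) := hfin
  obtain ⟨n, b, hb⟩ := Module.Finite.exists_fin (R := MvPolynomial (Fin d) (ResidueField R)) (M := GrF 𝓕)
  choose a ha using fun i => pr_surj (b i)
  refine ⟨∑ i, (a i : Polynomial R).natDegree + e + 1, fun j hj w hw => ?_⟩
  have h1 : pr 𝓕 (mono 𝓕 hw) ∈ Submodule.span (MvPolynomial (Fin d) (ResidueField R)) (Set.range b) := by rw [hb]; trivial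
  rw [Submodule.mem_span_range_iff_exists_fun] at h1
  obtain ⟨p, hp⟩ := h1
  choose G hG using fun i => MvPolynomial.map_surjective (σ := Fin d) (residue R) residue_surjective (p i)
  have h2 : ∀ i, p i • b i = pr 𝓕 (psi 𝓕 he hJ (G i) * a i) := by
    intro i
    rw [map_mul, ← theta_map he hJ hm, hG, ha]
    rfl
  simp_rw [h2] at hp
  rw [← map_sum, ← sub_eq_zero, ← map_sub, pr_eq_zero] at hp
  have h3 := hp j
  rw [AddSubgroupClass.coe_sub, AddSubmonoidClass.coe_finsetSum, Polynomial.coeff_sub, Polynomial.finsetSum_coeff] at h3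
  have h4 : ((mono 𝓕 hw : AF 𝓕) : Polynomial R).coeff j = w := by simp [mono]
  rw [h4] at h3
  set S := ∑ i, ((psi 𝓕 he hJ (G i) * a i : AF 𝓕) : Polynomial R).coeff j with hS
  have h5 : S ∈ JJ x * 𝓕.f (j - e) := by
    refine Ideal.sum_mem _ fun i _ => ?_
    rw [MulMemClass.coe_mul, psi_val, Polynomial.coeff_mul]
    refine Ideal.sum_mem _ fun q hq => ?_
    have hq := HasAntidiagonal.mem_antidiagonal.1 hq
    by_cases hq2 : (a i : Polynomial R).coeff q.2 = 0
    · rw [hq2, mul_zero]; exact zero_mem _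
    have hq3 := Polynomial.le_natDegree_of_ne_zero hq2
    have hq4 : (a i : Polynomial R).natDegree ≤ ∑ i, (a i : Polynomial R).natDegree := 
      Finset.single_le_sum (f := fun i => (a i : Polynomial R).natDegree) (fun _ _ => Nat.zero_le _) (mem_univ i)
    rw [Polynomial.coeff_expand he]
    split_ifs with hdiv
    · obtain ⟨s, hs⟩ := hdiv
      rw [hs, Nat.mul_div_cancel_left _ he, phi_coeff]
      obtain ⟨t, rfl⟩ : ∃ t, s = t + 1 := ⟨s - 1, by
        have : s ≠ 0 := by rintro rfl; omega
        omega⟩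
      have h6 := eval_mem_pow x (homogeneousComponent_isHomogeneous (t + 1) (G i))
      rw [pow_succ'] at h6
      have h7 := Ideal.mul_mem_mul h6 ((a i).2 q.2)
      rw [mul_assoc] at h7
      refine Ideal.mul_mono_right ?_ h7
      refine (Ideal.mul_mono_left (hJ t)).trans ((𝓕.mul _ _).trans (𝓕.anti ?_))
      rw [hs] at hq
      rw [mul_add] at hq
      omega
    · rw [zero_mul]; exact zero_mem _
  rw [show w = S + (w - S) by ring]
  refine add_mem (Ideal.mem_sup_left h5) (Ideal.mem_sup_right ?_)
  rw [show w - S = -(S - w) by ring]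
  exact neg_mem h3

theorem fin_step2 {x : Fin d → R} {e : ℕ} {𝓕 : Filt R} (he : 0 < e) (hJ : ∀ s, JJ x ^ s ≤ 𝓕.f (e * s))
    {c0 : ℕ} (h : ∀ j, c0 ≤ j → 𝓕.f j ≤ JJ x * 𝓕.f (j - e) ⊔ 𝓕.f (j + 1)) (hch : ∀ k, ∃ N, 𝓕.f N ≤ JJ x ^ k) :
    ∀ j, c0 ≤ j → 𝓕.f j ≤ JJ x * 𝓕.f (j - e) := by
  intro j hj
  have h1 : ∀ M, 𝓕.f j ≤ JJ x * 𝓕.f (j - e) ⊔ 𝓕.f (j + M) := by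
    intro M
    induction M with
    | zero => exact le_sup_right
    | succ M ih =>
      refine ih.trans (sup_le le_sup_left ?_)
      refine (h (j + M) (by omega)).trans (sup_le ?_ le_sup_right)
      exact (Ideal.mul_mono_right (𝓕.anti (by omega))).trans le_sup_left
  obtain ⟨N, hN⟩ := hch (j + 1)
  refine (h1 N).trans (sup_le le_rfl ?_)
  refine (𝓕.anti (by omega : N ≤ j + N)).trans (hN.trans ?_)
  rw [pow_succ']
  exact Ideal.mul_mono_right ((hJ j).trans (𝓕.anti (by nlinarith [Nat.sub_le j e])))

variable {x : Fin d → R} 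

/-- the real filtration with denominator `e` -/
noncomputable def Ff (hd : 0 < d) (hx : QR x) {k : ℕ} (hk : maximalIdeal R ^ k ≤ JJ x) {r0 : ℕ} (hr0 : qlen (JJ x) = r0) : Filt R where
  f := fun j => Er x ((j : ℝ) / r0.factorial)
  zero := by
    have := Er_nat hd hx hk hr0 0
    rw [ic_zero] at this
    simpa using this
  mul := by
    intro i j
    refine Ideal.mul_le.2 fun u hu v hv => ?_
    have := Er_mul hu hv
    rw [← add_div] at this
    exact_mod_cast this
  succ := by
    intro i
    refine Er_anti x ?_
    have : (0 : ℝ) < r0.factorial := by exact_mod_cast Nat.factorial_pos _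
    gcongr
    linarith

variable [IsNoetherianRing R] (hd : 0 < d) (hx : QR x) {k : ℕ} (hk : maximalIdeal R ^ k ≤ JJ x) {r0 : ℕ} (hr0 : qlen (JJ x) = r0) 

theorem mem_Ff {j : ℕ} {w : R} : w ∈ (Ff hd hx hk hr0).f j ↔ w ∈ Er x ((j : ℝ) / r0.factorial) := Iff.rfl

theorem Ff_iff {j : ℕ} {w : R} : w ∈ (Ff hd hx hk hr0).f j ↔ w ^ r0.factorial ∈ ic x j := by
  have h0 : (0 : ℝ) < r0.factorial := by exact_mod_cast Nat.factorial_pos _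
  rw [mem_Ff, ← Er_nat hd hx hk hr0 j]
  constructor
  · intro h
    have := Er_pow h r0.factorial
    rwa [mul_div_cancel₀ _ h0.ne'] at this
  · intro h
    refine Er_root (Nat.factorial_pos r0) ?_
    rwa [mul_div_cancel₀ _ h0.ne']

theorem Ff_mul (n : ℕ) : (Ff hd hx hk hr0).f (r0.factorial * n) = ic x n := by
  have h0 : (0 : ℝ) < r0.factorial := by exact_mod_cast Nat.factorial_pos _
  rw [← Er_nat hd hx hk hr0 n]
  show Er x _ = _
  rw [Nat.cast_mul, mul_div_cancel_left₀ _ h0.ne']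

theorem Ff_root (hch : ∀ k, ∃ N, ic x N ≤ maximalIdeal R ^ k) (b j : ℕ) (w : R) (hb : 0 < b) 
    (h : w ^ b ∈ (Ff hd hx hk hr0).f (b * j + 1)) : w ∈ (Ff hd hx hk hr0).f (j + 1) := by
  rw [Ff_iff] at h ⊢
  refine root_gap hd hx hk hr0 hch hb ?_
  rwa [← pow_mul, mul_comm r0.factorial b, pow_mul]

theorem Erp_le_Ff (hch : ∀ k, ∃ N, ic x N ≤ maximalIdeal R ^ k) (N : ℕ) :
    Erp x ((N : ℝ) / r0.factorial) ≤ (Ff hd hx hk hr0).f (N + 1) := by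
  rintro w ⟨β, h, hw⟩
  have h0 : (0 : ℝ) < r0.factorial := by exact_mod_cast Nat.factorial_pos _
  rw [div_lt_iff₀ h0] at h
  obtain ⟨b, hb⟩ := exists_nat_gt (1 / (β * r0.factorial - N))
  have h1 : 0 < β * r0.factorial - N := by linarith
  rw [div_lt_iff₀ h1] at hb
  have hb0 : 0 < b := by
    rcases Nat.eq_zero_or_pos b with rfl | h
    · norm_num at hb
    · exact h
  refine Ff_root hd hx hk hr0 hch b N w hb0 ?_
  rw [mem_Ff]
  refine Er_anti x ?_ (Er_pow hw b)
  rw [div_le_iff₀ h0]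
  push_cast
  nlinarith

theorem linear_bound {R : Type*} [CommRing R] {d : ℕ} [IsLocalRing R] {x : Fin d → R} [IsNoetherianRing R] (hd : 0 < d) (hx : QR x) {k : ℕ} (hk : maximalIdeal R ^ k ≤ JJ x) {r0 : ℕ} (hr0 : qlen (JJ x) = r0)
    (hch : ∀ k, ∃ N, ic x N ≤ maximalIdeal R ^ k) (hmJ : JJ x ≤ maximalIdeal R): ∃ c, ∀ n, ic x (n + c) ≤ JJ x ^ n := by
  classical
  set e := r0.factorial with hedef
  have he : 0 < e := Nat.factorial_pos _
  have h0 : (0 : ℝ) < e := by exact_mod_cast he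
  set 𝓕 := Ff hd hx hk hr0 with h𝓕
  have hFm : ∀ n, 𝓕.f (e * n) = ic x n := Ff_mul hd hx hk hr0
  have hJ : ∀ s, JJ x ^ s ≤ 𝓕.f (e * s) := fun s => by rw [hFm]; exact pow_le_ic x s
  have hroot := Ff_root hd hx hk hr0 hch
  have hErp := Erp_le_Ff hd hx hk hr0 hch
  have hm : maximalIdeal R ≤ 𝓕.f 1 := by
    intro y hy
    have h1 : (1 : R) ∈ Er x (((0 : ℕ) : ℝ)) := by rw [Er_nat hd hx hk hr0, ic_zero]; trivial
    have h2 := m_Er hk hy h1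
    rw [mul_one] at h2
    refine hErp 0 ?_
    simpa using h2
  have hkey : ∀ (s j : ℕ) (F : MvPolynomial (Fin d) R) (w : R), F.IsHomogeneous s → Good F → 
      eval x F * w ∈ 𝓕.f (j + e * s) → w ∈ 𝓕.f j := by
    intro s j F w hF hg hw
    rw [h𝓕, mem_Ff] at hw ⊢
    refine Er_key hx hF hg (Er_anti x (le_of_eq ?_) hw)
    rw [← hedef]
    push_cast
    field_simp
  have hintg : ∀ j w, w ∈ 𝓕.f j → ∃ k > 0, ∃ a : ℕ → R, (∀ i < k, a i ∈ JJ x ^ (j * (k - i))) ∧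
      (w ^ e) ^ k = ∑ i ∈ range k, a i * (w ^ e) ^ i := by
    intro j w hw
    rw [h𝓕, Ff_iff] at hw
    exact integral_of_mem_ic hx hd hmJ hw
  have hgr : ∀ (n : ℕ) (z : Fin n → R) (j : Fin n → ℕ), (∀ i, z i ∈ 𝓕.f (j i)) → 
      (∀ (N : ℕ) (F : Fin n → MvPolynomial (Fin d) R), (∀ i, F i = 0 ∨ ∃ s, (F i).IsHomogeneous s ∧ e * s + j i = N) → 
        ∑ i, eval x (F i) * z i ∈ 𝓕.f (N + 1) → ∀ i, ¬ Good (F i)) → n ≤ r0 := by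
    intro n z j hz hF
    have := growth hd hx hr0 z (fun i => (j i : ℝ) / e) (Er x) (Erp x) (Erp_le x) (fun β β' h w hw => ⟨β', h, hw⟩)
      (fun i s F hF => form_Er hF (hz i)) (∑ i, j i + 1) (by
        intro i s n' hn w hw
        refine ⟨n', ?_, ic_le_Er x n' (pow_le_ic x n' hw)⟩
        have h1 : j i ≤ ∑ i, j i := Finset.single_le_sum (fun _ _ => Nat.zero_le _) (mem_univ i)
        have h2 : (j i : ℝ) / e ≤ j i := div_le_self (Nat.cast_nonneg _) (by exact_mod_cast he)
        have h3 : ((j i + s : ℕ) : ℝ) < n' := by exact_mod_cast (by omega)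
        push_cast at h3
        linarith) (by
        intro β F hF' hsum
        by_cases hall : ∀ i, F i = 0
        · intro i
          rw [hall i, good_iff]
          simp
        push Not at hall
        obtain ⟨i0, hi0⟩ := hall
        obtain ⟨s0, hs0, hβ⟩ := (hF' i0).resolve_left hi0
        have hβ' : β = ((e * s0 + j i0 : ℕ) : ℝ) / e := by
          rw [← hβ]; push_cast; field_simp; ring
        refine hF (e * s0 + j i0) F (fun i => ?_) (hErp _ (by rw [← hedef, ← hβ']; exact hsum))
        rcases hF' i with h | ⟨s, h1, h2⟩
        · exact Or.inl h
        · refine Or.inr ⟨s, h1, ?_⟩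
          rw [hβ', eq_div_iff h0.ne', add_mul, div_mul_cancel₀ _ h0.ne'] at h2
          have : ((j i + s * e : ℕ) : ℝ) = ((e * s0 + j i0 : ℕ) : ℝ) := by push_cast at h2 ⊢; exact h2
          have := Nat.cast_injective this
          rw [← this]; ring)
    simpa using this
  let alg : Algebra (MvPolynomial (Fin d) (ResidueField R)) (GrF 𝓕) := (theta he hJ hm).toAlgebra
  have hred : IsReduced (GrF 𝓕) := isReduced_gr 𝓕 (fun b j w hb _ h => hroot b j w hb h)
  obtain ⟨S, hS⟩ := gr_rank he hJ hm hgr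
  have hfin : (theta he hJ hm).Finite := N2 (fun p b h => gr_tf he hJ hm hkey p b h) (fun b => gr_integral he hJ hm hintg b) S hS
  obtain ⟨c0, hc0⟩ := fin_step he hJ hm hfin
  have hc1 := fin_step2 he hJ hc0 (by
    intro t
    obtain ⟨N, hN⟩ := hch (k * t)
    refine ⟨e * N, ?_⟩
    rw [hFm]
    refine hN.trans ?_
    rw [pow_mul]
    exact Ideal.pow_right_mono hk t)
  refine ⟨c0, fun n => ?_⟩
  have : ic x (n + c0) ≤ JJ x ^ n * ic x c0 := by
    induction n with
    | zero => simp
    | succ n ih =>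
      rw [pow_succ', mul_assoc]
      refine le_trans ?_ (Ideal.mul_mono_right ih)
      rw [← hFm, ← hFm]
      refine (hc1 _ (by nlinarith)).trans (Ideal.mul_mono_right (𝓕.anti (le_of_eq ?_)))
      rw [show n + 1 + c0 = (n + c0) + 1 by ring, mul_add e (n + c0) 1, mul_one, Nat.add_sub_cancel]
  exact this.trans Ideal.mul_le_left

end P14
end DA

namespace DA
section P15
open Finset Filter Topology

theorem lim_choose (k c : ℕ) : Tendsto (fun n : ℕ => ((n + c).choose k : ℝ) / (n : ℝ) ^ k) atTop (𝓝 (1 / k.factorial)) := by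
  have h1 : Tendsto (fun n : ℕ => (n : ℝ) ^ k / (n : ℝ) ^ k) atTop (𝓝 1) := by
    refine tendsto_const_nhds.congr' ?_
    filter_upwards [eventually_gt_atTop 0] with n hn
    have : (n : ℝ) ≠ 0 := by exact_mod_cast hn.ne'
    rw [div_self (pow_ne_zero _ this)]
  have hlin : ∀ a : ℝ, Tendsto (fun n : ℕ => ((n : ℝ) + a) / n) atTop (𝓝 1) := by
    intro a
    have : Tendsto (fun n : ℕ => 1 + a * (1 / (n : ℝ))) atTop (𝓝 (1 + a * 0)) := 
      (tendsto_one_div_atTop_nhds_zero_nat.const_mul a).const_add 1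
    rw [mul_zero, add_zero] at this
    refine this.congr' ?_
    filter_upwards [eventually_gt_atTop 0] with n hn
    have : (n : ℝ) ≠ 0 := by exact_mod_cast hn.ne'
    field_simp
  have : Tendsto (fun n : ℕ => (∏ i ∈ range k, (((n : ℝ) + (c - i)) / n)) / k.factorial) atTop (𝓝 ((∏ i ∈ range k, (1 : ℝ)) / k.factorial)) :=
    (tendsto_finsetProd _ fun i _ => hlin _).div_const _
  rw [prod_const_one] at this
  refine this.congr' ?_
  filter_upwards [eventually_gt_atTop k] with n hn
  have hd : ((n + c).descFactorial k : ℝ) = ∏ i ∈ range k, ((n : ℝ) + (c - i)) := by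
    rw [Nat.descFactorial_eq_prod_range]
    push_cast
    refine prod_congr rfl fun i hi => ?_
    have := mem_range.1 hi
    rw [Nat.cast_sub (by omega)]
    push_cast; ring
  rw [prod_div_distrib, prod_const, card_range, ← hd, Nat.descFactorial_eq_factorial_mul_choose]
  push_cast
  have : (k.factorial : ℝ) ≠ 0 := by exact_mod_cast Nat.factorial_ne_zero k
  field_simp

theorem lim_choose_lt (j k c : ℕ) (h : j < k) : Tendsto (fun n : ℕ => ((n + c).choose j : ℝ) / (n : ℝ) ^ k) atTop (𝓝 0) := by
  obtain ⟨t, rfl⟩ : ∃ t, k = j + (t + 1) := ⟨k - j - 1, by omega⟩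
  have h1 := lim_choose j c
  have h2 : Tendsto (fun n : ℕ => (1 / (n : ℝ)) ^ (t + 1)) atTop (𝓝 (0 ^ (t + 1))) := tendsto_one_div_atTop_nhds_zero_nat.pow _
  have h3 := h1.mul h2
  rw [zero_pow (by omega), mul_zero] at h3
  refine h3.congr fun n => ?_
  rw [pow_add (n : ℝ) j (t + 1), one_div, inv_pow, ← div_eq_mul_inv, div_div]

/-- limit of the tail of the Hilbert polynomial -/
theorem lim_tail (d c k m : ℕ) (hk : k ≤ d) (hm : d < m + k) (e : ℕ → ℤ) :
    Tendsto (fun n : ℕ => (∑ i ∈ Ico k (d + 1), (-1 : ℝ) ^ i * e i * ((n + c + d - i).choose (d - i) : ℝ)) / (n : ℝ) ^ m) atTop (𝓝 0) := by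
  have : Tendsto (fun n : ℕ => ∑ i ∈ Ico k (d + 1), (-1 : ℝ) ^ i * e i * (((n + (c + d - i)).choose (d - i) : ℝ) / (n : ℝ) ^ m)) atTop 
      (𝓝 (∑ i ∈ Ico k (d + 1), (-1 : ℝ) ^ i * e i * 0)) := by
    refine tendsto_finsetSum _ fun i hi => ?_
    rw [mem_Ico] at hi
    exact (lim_choose_lt _ _ _ (by omega)).const_mul _
  simp only [mul_zero, sum_const_zero] at this
  refine this.congr fun n => ?_
  rw [sum_div]
  refine sum_congr rfl fun i hi => ?_
  rw [mem_Ico] at hi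
  rw [show n + (c + d - i) = n + c + d - i by omega]
  ring

theorem e0_eq {d : ℕ} (hd : 0 < d) {L : ℕ → ℕ} {e : ℕ → ℤ} {N : ℕ} (hL : ∀ n ≥ N, (L n : ℤ) =
      ∑ i ∈ Finset.range (d + 1), (-1 : ℤ) ^ i * e i * ((n + d - i).choose (d - i)))
    {r0 c : ℕ} (h1 : ∀ n, L n ≤ (n + d).choose d * r0) (h2 : ∀ n, (n + d).choose d * r0 ≤ L (n + c)) : e 0 = r0 := by
  have key : ∀ c, Tendsto (fun n : ℕ => (L (n + c) : ℝ) / (n : ℝ) ^ d) atTop (𝓝 ((e 0 : ℝ) * (1 / d.factorial))) := by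
    intro c
    have := ((lim_choose d (c + d)).const_mul (e 0 : ℝ)).add (lim_tail d c 1 d hd (by omega) e)
    rw [add_zero] at this
    refine this.congr' ?_
    filter_upwards [eventually_ge_atTop N] with n hn
    have h3 : (L (n + c) : ℝ) = ((L (n + c) : ℤ) : ℝ) := by push_cast; rfl
    rw [h3, hL _ (by omega)]
    push_cast
    rw [range_eq_Ico, sum_eq_sum_Ico_succ_bot (show 0 < d + 1 by omega)]
    rw [add_div, pow_zero, one_mul, Nat.sub_zero, Nat.sub_zero, zero_add, mul_div_assoc, add_assoc n c d]
  have k1 : (e 0 : ℝ) * (1 / d.factorial) ≤ (r0 : ℝ) * (1 / d.factorial) := by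
    refine le_of_tendsto_of_tendsto (key 0) ((lim_choose d d).const_mul (r0 : ℝ)) (Eventually.of_forall fun n => ?_)
    show (L (n + 0) : ℝ) / (n : ℝ) ^ d ≤ (r0 : ℝ) * (((n + d).choose d : ℝ) / (n : ℝ) ^ d)
    rw [← mul_div_assoc]
    gcongr
    rw [mul_comm]
    exact_mod_cast h1 n
  have k2 : (r0 : ℝ) * (1 / d.factorial) ≤ (e 0 : ℝ) * (1 / d.factorial) := by
    refine le_of_tendsto_of_tendsto ((lim_choose d d).const_mul (r0 : ℝ)) (key c) (Eventually.of_forall fun n => ?_)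
    show (r0 : ℝ) * (((n + d).choose d : ℝ) / (n : ℝ) ^ d) ≤ (L (n + c) : ℝ) / (n : ℝ) ^ d 
    rw [← mul_div_assoc]
    gcongr
    rw [mul_comm]
    exact_mod_cast h2 n
  have : (e 0 : ℝ) * (1 / d.factorial) = (r0 : ℝ) * (1 / d.factorial) := le_antisymm k1 k2
  have h0 : (1 / (d.factorial : ℝ)) ≠ 0 := by positivity
  have := mul_right_cancel₀ h0 this
  exact_mod_cast this

theorem no_two {d : ℕ} (hd : 2 ≤ d) {L : ℕ → ℕ} {e : ℕ → ℤ} {N : ℕ} (hL : ∀ n ≥ N, (L n : ℤ) =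
      ∑ i ∈ Finset.range (d + 1), (-1 : ℤ) ^ i * e i * ((n + d - i).choose (d - i)))
    {r0 : ℕ} (h0 : e 0 = r0) (he1 : e 1 ≤ e 0 - L 0 + 1) (c : ℕ) 
    (h : ∀ n, L (n + c) + 2 * (n + d - 1).choose (d - 1) ≤ (n + c + d - 1).choose (d - 1) * L 0 + (n + c + d - 1).choose d * r0) : False := by
  obtain ⟨D, rfl⟩ : ∃ D, d = D + 1 := ⟨d - 1, by omega⟩
  have hD : 1 ≤ D := by omega
  have k1 : ((r0 : ℝ) - L 0 - e 1) * (1 / D.factorial) + 0 + 2 * (1 / D.factorial) ≤ 0 := by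
    refine le_of_tendsto_of_tendsto ((((lim_choose D (c + D)).const_mul ((r0 : ℝ) - L 0 - e 1)).add (lim_tail (D + 1) c 2 D (by omega) (by omega) e)).add ((lim_choose D D).const_mul 2)) tendsto_const_nhds ?_
    filter_upwards [eventually_ge_atTop N] with n hn
    have h2 := h n
    have h3 := hL (n + c) (by omega)
    have h4 : ((L (n + c) : ℝ)) = ((L (n + c) : ℤ) : ℝ) := by push_cast; rfl
    rw [h3] at h4
    push_cast at h4
    rw [range_eq_Ico, sum_eq_sum_Ico_succ_bot (by omega), sum_eq_sum_Ico_succ_bot (by omega)] at h4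
    simp only [pow_zero, one_mul, Nat.sub_zero, zero_add, pow_one, Nat.reduceAdd, Nat.add_sub_cancel] at h4
    rw [h0] at h4
    simp only [Nat.add_sub_cancel, ← add_assoc] at h2
    have h5 : ((n + c + (D + 1)).choose (D + 1) : ℝ) = (n + c + D).choose D + (n + c + D).choose (D + 1) := by
      rw [← add_assoc, Nat.choose_succ_succ]; push_cast; rfl
    have h6 : n + c + (D + 1) - 1 = n + c + D := by omega
    rw [h5, h6] at h4
    have h7 : ((L (n + c) + 2 * (n + D).choose D : ℕ) : ℝ) ≤ (((n + c + D).choose D * L 0 + (n + c + D).choose (D + 1) * r0 : ℕ) : ℝ) := by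
      exact_mod_cast h2
    push_cast at h7 h4
    rw [← mul_div_assoc, ← mul_div_assoc, ← add_div, ← add_div]
    refine div_nonpos_of_nonpos_of_nonneg ?_ (by positivity)
    rw [← add_assoc n c D]
    linarith
  have hp : (0 : ℝ) < 1 / D.factorial := by positivity
  have k2 : ((r0 : ℝ) - L 0 - e 1 + 2) ≤ 0 := by
    by_contra hc
    push Not at hc
    nlinarith [mul_pos hc hp]
  have k3 : ((r0 : ℤ) - L 0 - e 1 + 2) ≤ 0 := by exact_mod_cast k2
  omega

end P15
end DA

namespace DA
section P16
open MvPolynomial IsLocalRing Finset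
variable {R : Type*} [CommRing R] {d : ℕ}

/-- the ideal `ic 1 * J^n` -/
def BB (x : Fin d → R) (n : ℕ) : Ideal R := ic x 1 * JJ x ^ n

theorem JJ_le_ic (x : Fin d → R) : JJ x ≤ ic x 1 := by simpa using pow_le_ic x 1

theorem BB_le (x : Fin d → R) (n : ℕ) : BB x n ≤ ic x (n + 1) := by
  rw [add_comm]
  exact (Ideal.mul_mono_right (pow_le_ic x n)).trans (ic_mul_le x 1 n)

theorem BB_le_pow (x : Fin d → R) (n : ℕ) : BB x n ≤ JJ x ^ n := Ideal.mul_le_right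

theorem BB_zero (x : Fin d → R) : BB x 0 = ic x 1 := by
  rw [BB, pow_zero, mul_one]

theorem BB_mul {x : Fin d → R} {n s : ℕ} {w z : R} (hw : w ∈ BB x n) (hz : z ∈ JJ x ^ s) :
    z * w ∈ BB x (n + s) := by
  rw [BB, pow_add, ← mul_assoc, mul_comm z]
  exact Ideal.mul_mem_mul hw hz

theorem BB_tf [IsLocalRing R] {x : Fin d → R} (hx : QR x) 
    {s n : ℕ} {F : MvPolynomial (Fin d) R} (hF : F.IsHomogeneous s) (hg : Good F) {z : R}
    (h : eval x F * z ∈ BB x (n + s)) : z ∈ BB x n := hx.tf' (JJ_le_ic x) hF hg h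

theorem eval_form (x : Fin d → R) {n : ℕ} (r : Mon d n → R) (v : R) : 
    ∑ μ : Mon d n, r μ * (eval x (monomial μ.1 1) * v) = eval x (form r) * v := by
  rw [form, map_sum, sum_mul]
  refine sum_congr rfl fun μ _ => ?_
  rw [← mul_assoc]
  simp only [eval_monomial, one_mul]

theorem two_chain [IsLocalRing R] {x : Fin d → R} {c : ℕ} {u v : R} (hu : u ∈ ic x (c + 1)) (hv : v ∈ ic x (c + 1))
    (h1 : ∀ n (F : MvPolynomial (Fin d) R), F.IsHomogeneous n → Good F → eval x F * v ∉ BB x (c + n))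
    (h2 : ∀ n (F G : MvPolynomial (Fin d) R), F.IsHomogeneous n → Good F → G.IsHomogeneous n → 
      eval x F * u + eval x G * v ∉ BB x (c + n)) (n : ℕ) :
    qlen (ic x (n + c + 1)) + 2 * (Fintype.card (Mon d n) : ℕ∞) ≤ qlen (BB x (n + c)) := by
  have hmem : ∀ w ∈ ic x (c + 1), ∀ μ : Mon d n, eval x (monomial μ.1 1) * w ∈ ic x (n + c + 1) := by
    intro w hw μ
    rw [add_assoc]
    refine ic_mul (pow_le_ic x n (eval_mem_pow x (isHomogeneous_monomial _ (mem_mon.1 μ.2)))) hw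
  set V : Ideal R := Ideal.span (Set.range fun μ : Mon d n => eval x (monomial μ.1 1) * v) with hV
  have hle : V ≤ ic x (n + c + 1) := by
    rw [hV, Ideal.span_le]
    rintro _ ⟨μ, rfl⟩
    exact hmem v hv μ
  have k1 : (Fintype.card (Mon d n) : ℕ∞) ≤ ql (BB x (n + c) ⊔ V) (BB x (n + c)) := by
    refine card_le_ql (fun μ : Mon d n => eval x (monomial μ.1 1) * v) _ _ 
      (fun μ => Ideal.mem_sup_right (Ideal.subset_span ⟨μ, rfl⟩)) fun r hr μ => ?_
    rw [eval_form, add_comm] at hr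
    have : ¬ Good (form r) := fun hg => h1 n (form r) (form_hom r) hg hr
    rw [Good, not_not, form_mem] at this
    exact this μ
  have k2 : (Fintype.card (Mon d n) : ℕ∞) ≤ ql (ic x (n + c + 1)) (BB x (n + c) ⊔ V) := by
    refine card_le_ql (fun μ : Mon d n => eval x (monomial μ.1 1) * u) _ _ 
      (fun μ => hmem u hu μ) fun r hr μ => ?_
    rw [eval_form] at hr
    obtain ⟨b, hb, z, hz, hbz⟩ := Submodule.mem_sup.1 hr
    obtain ⟨s, hs⟩ := (Submodule.mem_span_range_iff_exists_fun R).1 hz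
    simp only [smul_eq_mul] at hs
    rw [eval_form] at hs
    have : ¬ Good (form r) := fun hg => h2 n (form r) (- form s) (form_hom r) hg (form_hom s).neg (by
      rw [← hbz, ← hs, map_neg, add_comm c n]
      convert hb using 1; ring)
    rw [Good, not_not, form_mem] at this
    exact this μ
  rw [qlen_eq_add (le_sup_left : BB x (n + c) ≤ BB x (n + c) ⊔ V), 
    qlen_eq_add (sup_le (BB_le x (n + c)) hle), two_mul, ← add_assoc, add_comm (qlen _ + _),
    add_comm (qlen _)]
  gcongr

/-- there is no room for two independent elements -/
def NT (x : Fin d → R) : Prop := ∀ c, ¬ ∀ n, 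
  qlen (ic x (n + c + 1)) + 2 * (Fintype.card (Mon d n) : ℕ∞) ≤ qlen (BB x (n + c))

theorem two_dep [IsLocalRing R] {x : Fin d → R} (hx : QR x) (hN : NT x) {c : ℕ} {u v : R} 
    (hu : u ∈ ic x (c + 1)) (hv : v ∈ ic x (c + 1)) (hv' : v ∉ BB x c) :
    ∃ (n : ℕ) (F G : MvPolynomial (Fin d) R), F.IsHomogeneous n ∧ Good F ∧ G.IsHomogeneous n ∧
      eval x F * u + eval x G * v ∈ BB x (c + n) := by
  by_contra hc
  push Not at hc
  refine hN c (two_chain hu hv (fun n F hF hg h => hv' (BB_tf hx hF hg h)) ?_)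
  intro n F G hF hg hG
  exact hc n F G hF hg hG

theorem good_add [IsLocalRing R] {F G : MvPolynomial (Fin d) R} (hF : Good F) 
    (hG : G ∈ (maximalIdeal R).map (C : R →+* MvPolynomial (Fin d) R)) : Good (F + G) := by
  intro h
  exact hF ((Ideal.add_mem_iff_left _ hG).1 h)

theorem mkill [IsLocalRing R] {x : Fin d → R} (hx : QR x) (hN : NT x) {a : ℕ} {u y : R} 
    (hu : u ∈ ic x (a + 1)) (hy : y ∈ maximalIdeal R) : y * u ∈ BB x a := by
  by_contra hc
  obtain ⟨n, F, G, hF, hg, hG, h⟩ := two_dep hx hN hu (Ideal.mul_mem_left _ y hu) hc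
  refine hc (Ideal.mul_mem_left _ y ?_)
  refine BB_tf (s := n) (F := F + C y * G) hx (hF.add (hG.C_mul y)) (good_add hg (Ideal.mul_mem_right _ _ (Ideal.mem_map_of_mem _ hy))) ?_
  convert h using 1
  simp only [map_add, map_mul, eval_C]
  ring

theorem mkill' [IsLocalRing R] {x : Fin d → R} (hx : QR x) (hN : NT x) {a s : ℕ} {u : R} 
    (hu : u ∈ ic x (a + 1)) {F : MvPolynomial (Fin d) R} (hF : F.IsHomogeneous s) (hg : ¬ Good F) : eval x F * u ∈ BB x (a + s) := by
  rw [Good, not_not] at hg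
  have := (mem_mul_pow x (maximalIdeal R) s (eval x F)).2 ⟨F, hF, hg, rfl⟩
  refine Submodule.mul_induction_on this ?_ ?_
  · intro r hr y hy
    rw [mul_comm r y, mul_assoc]
    exact BB_mul (mkill hx hN hu hr) hy
  · intro y z hy hz
    rw [add_mul]; exact add_mem hy hz

theorem drop [IsLocalRing R] {x : Fin d → R} (hx : QR x) (hd : 0 < d) (hm : JJ x ≤ maximalIdeal R) (hN : NT x) {a : ℕ} {u : R} 
    (hu : u ∈ ic x (a + 2)) : u ∈ BB x a := by
  refine BB_tf (s := 1) (F := X ⟨0, hd⟩) hx (isHomogeneous_X _ _) (good_X _) ?_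
  rw [eval_X]
  exact mkill hx hN hu (hm (x_mem x _))

theorem dep [IsLocalRing R] {x : Fin d → R} (hx : QR x) (hd : 0 < d) (hN : NT x) {a b : ℕ} {u v : R} 
    (hu : u ∈ ic x (a + 1)) (hu' : u ∉ BB x a) (hv : v ∈ ic x (b + 1)) (hv' : v ∉ BB x b) :
    ∃ (s t : ℕ) (F G : MvPolynomial (Fin d) R), a + s = b + t ∧ F.IsHomogeneous s ∧ Good F ∧ G.IsHomogeneous t ∧ Good G ∧
      eval x F * u + eval x G * v ∈ BB x (a + s) := by
  let i : Fin d := ⟨0, hd⟩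
  have hX : ∀ n, ((X i : MvPolynomial (Fin d) R) ^ n).IsHomogeneous n := fun n => isHomogeneous_X_pow _ _
  have hXg : ∀ n, Good ((X i : MvPolynomial (Fin d) R) ^ n) := fun n => (good_X i).pow n
  have hmm : ∀ {n m : ℕ} {w : R}, w ∈ ic x (n + 1) → eval x (X i ^ m) * w ∈ ic x (n + m + 1) := by
    intro n m w hw
    rw [add_right_comm, add_comm (n + 1) m]
    exact ic_mul (pow_le_ic x m (eval_mem_pow x (hX m))) hw
  obtain ⟨n, F, G, hF, hg, hG, h⟩ := two_dep hx hN (hmm (m := b) hu) (by rw [add_comm a b]; exact hmm (m := a) hv)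
    (by rw [add_comm a b]; exact fun h => hv' (BB_tf hx (hX a) (hXg a) h))
  refine ⟨n + b, n + a, F * X i ^ b, G * X i ^ a, by omega, hF.mul (hX _), hg.mul (hXg _), hG.mul (hX _), ?_, ?_⟩
  · by_contra hc
    have h1 := mkill' hx hN hv (hG.mul (hX a)) hc
    rw [show a + b + n = b + (n + a) by omega] at h
    rw [map_mul, mul_assoc] at h1
    have h2 := (Submodule.add_mem_iff_left _ h1).1 h
    refine hu' (BB_tf (s := n + b) (n := a) hx (hF.mul (hX b)) (hg.mul (hXg b)) ?_)
    rw [map_mul, mul_assoc]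
    rwa [show a + (n + b) = b + (n + a) by omega] 
  · rw [map_mul, map_mul, mul_assoc, mul_assoc, show a + (n + b) = a + b + n by omega]
    exact h

end P16
end DA

namespace DA
section P17
open MvPolynomial IsLocalRing Finset

/-- homogenisation as a ring map -/
noncomputable def hz {k : Type*} [CommRing k] {σ : Type*} : MvPolynomial σ k →ₐ[k] Polynomial (MvPolynomial σ k) :=
  aeval (fun i => Polynomial.C (X i) * Polynomial.X)

theorem hz_mon {k : Type*} [CommRing k] {σ : Type*} (μ : σ →₀ ℕ) (r : k) :
    hz (monomial μ r) = Polynomial.C (monomial μ r) * Polynomial.X ^ μ.degree := by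
  rw [hz, aeval_monomial, monomial_eq, map_mul]
  have h1 : (μ.prod fun i n => (Polynomial.C (X i : MvPolynomial σ k) * Polynomial.X) ^ n) = 
      Polynomial.C (μ.prod fun i n => (X i : MvPolynomial σ k) ^ n) * Polynomial.X ^ μ.degree := by
    simp only [mul_pow]
    rw [Finsupp.prod_mul]
    congr 1
    · simp only [Finsupp.prod, map_prod, map_pow]
    · rw [Finsupp.degree_apply, Finsupp.prod, prod_pow_eq_pow_sum]
  rw [h1, ← mul_assoc]
  rfl

theorem hz_hom {k : Type*} [CommRing k] {σ : Type*} {n : ℕ} {F : MvPolynomial σ k} (hF : F.IsHomogeneous n) :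
    hz F = Polynomial.C F * Polynomial.X ^ n := by
  have h1 : hz F = ∑ μ ∈ F.support, hz (monomial μ (coeff μ F)) := by
    rw [← map_sum, ← F.as_sum]
  have h2 : Polynomial.C F = ∑ μ ∈ F.support, Polynomial.C (monomial μ (coeff μ F)) := by
    rw [← map_sum, ← F.as_sum]
  rw [h1, h2, sum_mul]
  refine sum_congr rfl fun μ hμ => ?_
  have hdeg : μ.degree = n := (hF.degree_eq_sum_deg_support hμ).symm
  rw [hz_mon, hdeg]

theorem hz_coeff {k : Type*} [CommRing k] {σ : Type*} (F : MvPolynomial σ k) (n : ℕ) :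
    (hz F).coeff n = homogeneousComponent n F := by
  conv_lhs => rw [← sum_homogeneousComponent F]
  rw [map_sum, Polynomial.finsetSum_coeff]
  have : ∀ i ∈ range (F.totalDegree + 1), (hz (homogeneousComponent i F)).coeff n = 
      if n = i then homogeneousComponent n F else 0 := by
    intro i _
    rw [hz_hom (homogeneousComponent_isHomogeneous i F), Polynomial.coeff_C_mul_X_pow]
    split_ifs with h
    · rw [h]
    · rfl
  rw [sum_congr rfl this, sum_ite_eq]
  split_ifs with h
  · rfl
  · rw [homogeneousComponent_eq_zero]
    rw [mem_range] at h
    omega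

theorem hom_factor {k : Type*} [CommRing k] [IsDomain k] {σ : Type*} {n : ℕ} {p q : MvPolynomial σ k} 
    (h : (p * q).IsHomogeneous n) (h0 : p * q ≠ 0) : ∃ i, p.IsHomogeneous i := by
  have hp : p ≠ 0 := left_ne_zero_of_mul h0
  have hq : q ≠ 0 := right_ne_zero_of_mul h0
  have hinj : ∀ r : MvPolynomial σ k, r ≠ 0 → hz r ≠ 0 := by
    intro r hr h
    apply hr
    rw [← sum_homogeneousComponent r]
    refine sum_eq_zero fun i _ => ?_
    rw [← hz_coeff, h, Polynomial.coeff_zero]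
  have hpz := hinj p hp
  have hqz := hinj q hq
  have h1 : hz p * hz q = Polynomial.C (p * q) * Polynomial.X ^ n := by rw [← map_mul, hz_hom h]
  have h2 : (hz p).natDegree + (hz q).natDegree = n := by
    rw [← Polynomial.natDegree_mul hpz hqz, h1, Polynomial.natDegree_C_mul_X_pow _ _ h0]
  have h3 : (hz p).natTrailingDegree + (hz q).natTrailingDegree = n := by
    rw [← Polynomial.natTrailingDegree_mul hpz hqz, h1, Polynomial.C_mul_X_pow_eq_monomial, Polynomial.natTrailingDegree_monomial h0]
  have h4 := Polynomial.natTrailingDegree_le_natDegree (hz p)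
  have h5 := Polynomial.natTrailingDegree_le_natDegree (hz q)
  refine ⟨(hz p).natDegree, ?_⟩
  have : p = homogeneousComponent (hz p).natDegree p := by
    conv_lhs => rw [← sum_homogeneousComponent p]
    rw [sum_eq_single (hz p).natDegree]
    · intro i _ hi
      rw [← hz_coeff]
      rcases lt_or_gt_of_ne hi with h | h
      · exact Polynomial.coeff_eq_zero_of_lt_natTrailingDegree (by omega)
      · exact Polynomial.coeff_eq_zero_of_natDegree_lt h
    · intro h
      rw [mem_range] at h
      exact homogeneousComponent_eq_zero _ _ (by omega)
  have h9 := homogeneousComponent_isHomogeneous (hz p).natDegree p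
  rwa [← this] at h9

variable {R : Type*} [CommRing R] {d : ℕ}

theorem map_hc [IsLocalRing R] (t : ℕ) (H : MvPolynomial (Fin d) R) : MvPolynomial.map (residue R) (homogeneousComponent t H) = homogeneousComponent t (MvPolynomial.map (residue R) H) := by
  ext m
  simp only [coeff_map, coeff_homogeneousComponent]
  split_ifs <;> simp

theorem hom_lift [IsLocalRing R] {n : ℕ} {p : MvPolynomial (Fin d) (ResidueField R)} (hp : p.IsHomogeneous n) :
    ∃ P : MvPolynomial (Fin d) R, P.IsHomogeneous n ∧ map (residue R) P = p := by
  obtain ⟨P, rfl⟩ := MvPolynomial.map_surjective (residue R) residue_surjective p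
  refine ⟨homogeneousComponent n P, homogeneousComponent_isHomogeneous _ _, ?_⟩
  rw [map_hc, homogeneousComponent_eq_self hp]

theorem not_good_iff [IsLocalRing R] {F : MvPolynomial (Fin d) R} : 
    F ∈ (maximalIdeal R).map (C : R →+* MvPolynomial (Fin d) R) ↔ map (residue R) F = 0 := by
  have := good_iff (F := F)
  rw [Good] at this
  exact not_iff_not.1 this

theorem dep_coprime [IsLocalRing R] {x : Fin d → R} (hx : QR x) (hd : 0 < d) (hN : NT x) {a b : ℕ} {u v : R} 
    (hu : u ∈ ic x (a + 1)) (hu' : u ∉ BB x a) (hv : v ∈ ic x (b + 1)) (hv' : v ∉ BB x b) :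
    ∃ (s t : ℕ) (F G : MvPolynomial (Fin d) R), a + s = b + t ∧ F.IsHomogeneous s ∧ Good F ∧ G.IsHomogeneous t ∧ Good G ∧
      IsRelPrime (map (residue R) F) (map (residue R) G) ∧ eval x F * u - eval x G * v ∈ BB x (a + s) := by
  obtain ⟨s, t, F, G, hst, hF, hFg, hG, hGg, h⟩ := dep hx hd hN hu hu' hv hv'
  obtain ⟨f, g, c, hrel, hf, hg⟩ := UniqueFactorizationMonoid.exists_reduced_factors (map (residue R) F) (good_iff.1 hFg) (map (residue R) (- G))
  have hG' : map (residue R) (-G) ≠ 0 := by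
    rw [map_neg, neg_ne_zero]; exact good_iff.1 hGg
  have hFh := hF.map (residue R)
  have hGh := hG.neg.map (residue R)
  have hF0 := good_iff.1 hFg
  rw [← hf] at hFh hF0
  rw [← hg] at hGh hG'
  obtain ⟨h', hc⟩ := hom_factor hFh hF0
  obtain ⟨s', hfh⟩ := hom_factor (p := f) (q := c) (by rwa [mul_comm] at hFh) (by rwa [mul_comm] at hF0)
  obtain ⟨t', hgh⟩ := hom_factor (p := g) (q := c) (by rwa [mul_comm] at hGh) (by rwa [mul_comm] at hG')
  have e1 : s = h' + s' := hFh.inj_right (hc.mul hfh) hF0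
  have e2 : t = h' + t' := hGh.inj_right (hc.mul hgh) hG'
  subst e1 e2
  obtain ⟨H, hH, rfl⟩ := hom_lift hc
  obtain ⟨F', hF', rfl⟩ := hom_lift hfh
  obtain ⟨G', hG1, rfl⟩ := hom_lift hgh
  refine ⟨s', t', F', G', by omega, hF', good_iff.2 (right_ne_zero_of_mul hF0), hG1, good_iff.2 (right_ne_zero_of_mul hG'), hrel, ?_⟩
  have k1 := mkill' hx hN hu (hF.sub (hH.mul hF')) (by
    rw [Good, not_not, not_good_iff, map_sub, map_mul, hf, sub_self])
  have k2 := mkill' hx hN hv (hG.neg.sub (hH.mul hG1)) (by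
    rw [Good, not_not, not_good_iff, map_sub, map_mul, hg, sub_self])
  rw [← hst] at k2
  refine BB_tf (s := h') hx hH (good_iff.2 (left_ne_zero_of_mul hF0)) ?_
  rw [show a + s' + h' = a + (h' + s') by omega]
  have := sub_mem (add_mem h k2) k1
  convert this using 1
  simp only [map_sub, map_mul, map_neg]
  ring

theorem mem_sup_span {b : Ideal R} {e : R} {P : MvPolynomial (Fin d) R} 
    (h : P ∈ (b ⊔ Ideal.span {e}).map (C : R →+* MvPolynomial (Fin d) R)) : 
    ∃ P1, P - C e * P1 ∈ b.map (C : R →+* MvPolynomial (Fin d) R) := by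
  rw [Ideal.map_sup, Ideal.map_span, Set.image_singleton] at h
  obtain ⟨y, hy, z, hz, rfl⟩ := Submodule.mem_sup.1 h
  obtain ⟨w, rfl⟩ := Ideal.mem_span_singleton'.1 hz
  exact ⟨w, by simpa [mul_comm] using hy⟩

theorem exists_socle [IsLocalRing R] {b c : Ideal R} {k : ℕ} (hk : maximalIdeal R ^ k ≤ b) (hlt : b < c) :
    ∃ e ∈ c, e ∉ b ∧ ∀ y ∈ maximalIdeal R, y * e ∈ b := by
  have hex : ∃ k, maximalIdeal R ^ k * c ≤ b := ⟨k, Ideal.mul_le_left.trans hk⟩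
  classical
  have h1 := Nat.find_spec hex
  obtain ⟨j, hj⟩ : ∃ j, Nat.find hex = j + 1 := by
    refine ⟨Nat.find hex - 1, ?_⟩
    have : Nat.find hex ≠ 0 := by
      intro h
      rw [h, pow_zero, one_mul] at h1
      exact not_le_of_gt hlt h1
    omega
  have h2 := Nat.find_min hex (m := j) (by omega)
  rw [SetLike.not_le_iff_exists] at h2
  obtain ⟨e, he, heb⟩ := h2
  refine ⟨e, Ideal.mul_le_right he, heb, fun y hy => h1 ?_⟩
  rw [hj, pow_succ', mul_assoc]
  exact Ideal.mul_mem_mul hy he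

theorem coprime_div [IsLocalRing R] [IsNoetherianRing R] {F G : MvPolynomial (Fin d) R} (hrel : IsRelPrime (map (residue R) F) (map (residue R) G))
    (hG : Good G) {k : ℕ} {c : Ideal R} (b : Ideal R) (hk : maximalIdeal R ^ k ≤ b) (hbc : b ≤ c)
    {U V : MvPolynomial (Fin d) R} (hU : U ∈ c.map (C : R →+* MvPolynomial (Fin d) R)) (hV : V ∈ c.map (C : R →+* MvPolynomial (Fin d) R))
    (h : F * U - G * V ∈ b.map (C : R →+* MvPolynomial (Fin d) R)) : 
    ∃ W ∈ c.map (C : R →+* MvPolynomial (Fin d) R), U - G * W ∈ b.map (C : R →+* MvPolynomial (Fin d) R) ∧ 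
      V - F * W ∈ b.map (C : R →+* MvPolynomial (Fin d) R) := by
  induction b using WellFoundedGT.induction with
  | ind b ih =>
    rcases hbc.eq_or_lt with rfl | hlt
    · exact ⟨0, zero_mem _, by simpa using hU, by simpa using hV⟩
    obtain ⟨e, hec, heb, hme⟩ := exists_socle hk hlt
    have hlt' : b < b ⊔ Ideal.span {e} := by
      refine lt_of_le_of_ne le_sup_left fun he => heb ?_
      rw [he]
      exact Ideal.mem_sup_right (Ideal.mem_span_singleton_self e)
    have hle : b ⊔ Ideal.span {e} ≤ c := sup_le hbc ((Ideal.span_singleton_le_iff_mem _).2 hec)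
    obtain ⟨W, hW, h1, h2⟩ := ih _ hlt' (hk.trans hlt'.le) hle (Ideal.map_mono hlt'.le h)
    obtain ⟨U1, hU1⟩ := mem_sup_span h1
    obtain ⟨V1, hV1⟩ := mem_sup_span h2
    have h3 : (F * U1 - G * V1) * C e ∈ b.map (C : R →+* MvPolynomial (Fin d) R) := by
      have := sub_mem (sub_mem h (Ideal.mul_mem_left _ F hU1)) (neg_mem (Ideal.mul_mem_left _ G hV1))
      convert this using 1
      ring
    have h4 : ¬ Good (F * U1 - G * V1) := by
      intro hg
      have := mem_map_C_iff.1 (mccoy hg h3) 0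
      rw [coeff_C, if_pos rfl] at this
      exact heb this
    rw [Good, not_not, not_good_iff, map_sub, map_mul, map_mul, sub_eq_zero] at h4
    obtain ⟨w, hw⟩ : map (residue R) G ∣ map (residue R) U1 := 
      hrel.symm.dvd_of_dvd_mul_left ⟨_, h4⟩
    have hG0 := good_iff.1 hG
    have hw2 : map (residue R) V1 = map (residue R) F * w := by
      apply mul_left_cancel₀ hG0
      rw [← h4, hw]; ring
    obtain ⟨W1, rfl⟩ := MvPolynomial.map_surjective (residue R) residue_surjective w
    have hkill : ∀ P : MvPolynomial (Fin d) R, map (residue R) P = 0 → C e * P ∈ b.map (C : R →+* MvPolynomial (Fin d) R) := by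
      intro P hP
      rw [← not_good_iff, mem_map_C_iff] at hP
      rw [mem_map_C_iff]
      intro m
      rw [coeff_C_mul, mul_comm]
      exact hme _ (hP m)
    refine ⟨W + C e * W1, add_mem hW (Ideal.mul_mem_right _ _ (Ideal.mem_map_of_mem _ hec)), ?_, ?_⟩
    · convert add_mem hU1 (hkill (U1 - G * W1) (by rw [map_sub, map_mul, hw, sub_self])) using 1
      ring
    · convert add_mem hV1 (hkill (V1 - F * W1) (by rw [map_sub, map_mul, hw2, sub_self])) using 1
      ring

theorem hc_mem {b : Ideal R} {P : MvPolynomial (Fin d) R} (h : P ∈ b.map (C : R →+* MvPolynomial (Fin d) R)) (n : ℕ) :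
    homogeneousComponent n P ∈ b.map (C : R →+* MvPolynomial (Fin d) R) := by
  rw [mem_map_C_iff] at h ⊢
  intro m
  rw [coeff_homogeneousComponent]
  split_ifs
  · exact h m
  · exact zero_mem _

theorem hc_mul {G W : MvPolynomial (Fin d) R} {t : ℕ} (hG : G.IsHomogeneous t) (p : ℕ) : 
    homogeneousComponent p (G * W) = if t ≤ p then G * homogeneousComponent (p - t) W else 0 := by
  rw [← hz_coeff, map_mul, hz_hom hG, mul_assoc, Polynomial.coeff_C_mul, mul_comm (Polynomial.X ^ t), Polynomial.coeff_mul_X_pow', hz_coeff]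
  split_ifs
  · rfl
  · rw [mul_zero]

theorem coprime_hom [IsLocalRing R] [IsNoetherianRing R] {F G : MvPolynomial (Fin d) R} (hrel : IsRelPrime (map (residue R) F) (map (residue R) G))
    (hG : Good G) {s t p q : ℕ} (hFs : F.IsHomogeneous s) (hGt : G.IsHomogeneous t) (hpq : p + s = q + t) {k : ℕ} {c : Ideal R} (b : Ideal R) (hk : maximalIdeal R ^ k ≤ b) (hbc : b ≤ c)
    {U V : MvPolynomial (Fin d) R} (hUp : U.IsHomogeneous p) (hVq : V.IsHomogeneous q) (hU : U ∈ c.map (C : R →+* MvPolynomial (Fin d) R)) (hV : V ∈ c.map (C : R →+* MvPolynomial (Fin d) R))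
    (h : F * U - G * V ∈ b.map (C : R →+* MvPolynomial (Fin d) R)) : 
    ∃ W ∈ c.map (C : R →+* MvPolynomial (Fin d) R), U - G * W ∈ b.map (C : R →+* MvPolynomial (Fin d) R) ∧ 
      V - F * W ∈ b.map (C : R →+* MvPolynomial (Fin d) R) ∧ W.IsHomogeneous (p - t) ∧ (p < t → W = 0) := by
  obtain ⟨W, hW, h1, h2⟩ := coprime_div hrel hG b hk hbc hU hV h
  have h3 := hc_mem h1 p
  have h4 := hc_mem h2 q
  rw [map_sub, hc_mul hGt, homogeneousComponent_eq_self hUp] at h3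
  rw [map_sub, hc_mul hFs, homogeneousComponent_eq_self hVq] at h4
  by_cases hp : t ≤ p
  · rw [if_pos hp] at h3
    rw [if_pos (by omega), show q - s = p - t by omega] at h4
    exact ⟨homogeneousComponent (p - t) W, hc_mem hW _, h3, h4, homogeneousComponent_isHomogeneous _ _, fun h => by omega⟩
  · rw [if_neg hp] at h3
    rw [if_neg (by omega)] at h4
    exact ⟨0, zero_mem _, by simpa using h3, by simpa using h4, isHomogeneous_zero _ _ _, fun _ => rfl⟩

end P17
end DA

namespace DA
section P18
open MvPolynomial IsLocalRing Finset
variable {R : Type*} [CommRing R] {d : ℕ}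

theorem no_pos [IsLocalRing R] [IsNoetherianRing R] {x : Fin d → R} (hx : QR x) (hd : 0 < d) (hm : JJ x ≤ maximalIdeal R) 
    {k : ℕ} (hk : maximalIdeal R ^ k ≤ JJ x) (hN : NT x) {a b : ℕ} (hab : a ≤ b) {u v : R} 
    (hu : u ∈ ic x (a + 1)) (hu' : u ∉ BB x a) (hmin : ∀ n < a, ic x (n + 1) ≤ BB x n)
    (hv : v ∈ ic x (b + 1)) {s t : ℕ} {F G : MvPolynomial (Fin d) R} (hst : a + s = b + t) (hF : F.IsHomogeneous s)
    (hG : G.IsHomogeneous t) (hGg : Good G) (hrel : IsRelPrime (map (residue R) F) (map (residue R) G)) 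
    (h : eval x F * u - eval x G * v ∈ BB x (a + s)) (ht : 0 < t) : False := by
  obtain ⟨a, rfl⟩ : ∃ a', a = a' + 1 := by
    refine ⟨a - 1, ?_⟩
    have : a ≠ 0 := by
      rintro rfl
      exact hu' (by rw [BB_zero]; exact hu)
    omega
  obtain ⟨b, rfl⟩ : ∃ b', b = b' + 1 := ⟨b - 1, by omega⟩
  obtain ⟨U, hU, hUa, hUe⟩ := (mem_mul_pow x _ a _).1 (drop hx hd hm hN hu)
  obtain ⟨V, hV, hVa, hVe⟩ := (mem_mul_pow x _ b _).1 (drop hx hd hm hN hv)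
  have h1 : F * U - G * V ∈ (JJ x).map (C : R →+* MvPolynomial (Fin d) R) := by
    refine hx.coeff_mem_J (n := s + a) ((hF.mul hU).sub ?_) ?_
    · have := hG.mul hV
      rwa [show t + b = s + a by omega] at this
    · rw [map_sub, map_mul, map_mul, hUe, hVe, show s + a + 1 = a + 1 + s by omega]
      exact BB_le_pow _ _ h
  obtain ⟨W1, hW1, hU1, hV1, hW1h, hW10⟩ := coprime_hom hrel hGg hF hG (show a + s = b + t by omega) (JJ x) hk (JJ_le_ic x) hU hV hUa hVa h1
  have e1 : ∃ U1 : MvPolynomial (Fin d) R, U1.IsHomogeneous (a + 1) ∧ eval x U1 = eval x U - eval x G * eval x W1 := by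
    have : eval x U - eval x G * eval x W1 ∈ JJ x ^ (a + 1) := by
      rw [pow_succ', mem_mul_pow]
      by_cases hta : t ≤ a
      · refine ⟨U - G * W1, hU.sub ?_, hU1, by simp⟩
        have := hG.mul hW1h
        rwa [show t + (a - t) = a by omega] at this
      · rw [hW10 (by omega)] at hU1 ⊢
        exact ⟨U - G * 0, by simpa using hU, hU1, by simp⟩
    obtain ⟨U1, k1, k2⟩ := (Ideal.mem_span_pow_iff_exists_isHomogeneous x _).mp this
    exact ⟨U1, k1, k2⟩
  have e2 : ∃ V1 : MvPolynomial (Fin d) R, V1.IsHomogeneous (b + 1) ∧ eval x V1 = eval x V - eval x F * eval x W1 := by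
    have : eval x V - eval x F * eval x W1 ∈ JJ x ^ (b + 1) := by
      rw [pow_succ', mem_mul_pow]
      by_cases hta : t ≤ a
      · refine ⟨V - F * W1, hV.sub ?_, hV1, by simp⟩
        have := hF.mul hW1h
        rwa [show s + (a - t) = b by omega] at this
      · rw [hW10 (by omega)] at hV1 ⊢
        exact ⟨V - F * 0, by simpa using hV, hV1, by simp⟩
    obtain ⟨U1, k1, k2⟩ := (Ideal.mem_span_pow_iff_exists_isHomogeneous x _).mp this
    exact ⟨U1, k1, k2⟩
  obtain ⟨U1, hU1h, hU1e⟩ := e1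
  obtain ⟨V1, hV1h, hV1e⟩ := e2
  have h2 : F * U1 - G * V1 ∈ (ic x 1).map (C : R →+* MvPolynomial (Fin d) R) := by
    refine hx.coeff_mem (JJ_le_ic x) (n := s + (a + 1)) ((hF.mul hU1h).sub ?_) ?_
    · have := hG.mul hV1h
      rwa [show t + (b + 1) = s + (a + 1) by omega] at this
    · rw [map_sub, map_mul, map_mul, hU1e, hV1e, add_comm s, ← BB]
      convert h using 1
      rw [hUe, hVe]; ring
  obtain ⟨W2, -, hU2, -, hW2h, hW20⟩ := coprime_hom hrel hGg hF hG hst (c := ⊤) (ic x 1) (hk.trans (JJ_le_ic x)) le_top hU1h hV1h (by rw [Ideal.map_top]; trivial) (by rw [Ideal.map_top]; trivial) h2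
  by_cases hta : t ≤ a + 1
  · have hB : eval x (U1 - G * W2) ∈ BB x (a + 1) := by
      rw [BB, mem_mul_pow]
      refine ⟨U1 - G * W2, hU1h.sub ?_, hU2, rfl⟩
      have := hG.mul hW2h
      rwa [show t + (a + 1 - t) = a + 1 by omega] at this
    set w := eval x W1 + eval x W2 with hw
    have hB2 : u - eval x G * w ∈ BB x (a + 1) := by
      convert hB using 1
      rw [map_sub, map_mul, hU1e, hUe, hw]; ring
    have h5 : eval x G * w ∈ ic x (a + 1 - t + 1 + t) := by
      rw [show a + 1 - t + 1 + t = a + 1 + 1 by omega]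
      have := sub_mem hu (BB_le _ _ hB2)
      rwa [sub_sub_cancel] at this
    have h6 := hmin (a + 1 - t) (by omega) (ic_key hx hG hGg h5)
    have h7 := BB_mul h6 (eval_mem_pow x hG)
    rw [show a + 1 - t + t = a + 1 by omega] at h7
    apply hu'
    have := add_mem hB2 h7
    rwa [sub_add_cancel] at this
  · rw [hW20 (by omega), mul_zero, sub_zero] at hU2
    rw [hW10 (by omega), map_zero, mul_zero, sub_zero, hUe] at hU1e
    apply hu'
    rw [BB, mem_mul_pow]
    exact ⟨U1, hU1h, hU2, hU1e⟩

/-- the structure of the integral closure filtration -/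
def Str (x : Fin d → R) (m : Ideal R) (a : ℕ) (u : R) : Prop :=
  1 ≤ a ∧ u ∈ ic x (a + 1) ∧ u ∉ BB x a ∧ (∀ y ∈ m, y * u ∈ BB x a) ∧ 
  (∀ n < a, ic x (n + 1) ≤ BB x n) ∧ ∀ b ≥ a, ∀ v ∈ ic x (b + 1), ∃ P : MvPolynomial (Fin d) R, P.IsHomogeneous (b - a) ∧ 
    v - eval x P * u ∈ BB x b

theorem structure_thm [IsLocalRing R] [IsNoetherianRing R] {x : Fin d → R} (hx : QR x) (hd : 0 < d) (hm : JJ x ≤ maximalIdeal R) 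
    {k : ℕ} (hk : maximalIdeal R ^ k ≤ JJ x) (hN : NT x) : 
    (∀ n, ic x (n + 1) ≤ BB x n) ∨ ∃ a u, Str x (maximalIdeal R) a u := by
  classical
  by_cases hall : ∀ n, ic x (n + 1) ≤ BB x n
  · exact Or.inl hall
  right
  push Not at hall
  have hspec := Nat.find_spec hall
  have hmin : ∀ n < Nat.find hall, ic x (n + 1) ≤ BB x n := fun n hn => not_not.1 (Nat.find_min hall hn)
  set a := Nat.find hall
  obtain ⟨u, hu, hu'⟩ := SetLike.not_le_iff_exists.1 hspec
  refine ⟨a, u, ?_, hu, hu', fun y hy => mkill hx hN hu hy, hmin, ?_⟩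
  · by_contra h
    have : a = 0 := by omega
    rw [this] at hu hu'
    exact hu' (by rw [BB_zero]; exact hu)
  · intro b hb v hv
    by_cases hv' : v ∈ BB x b
    · exact ⟨0, isHomogeneous_zero _ _ _, by simpa using hv'⟩
    obtain ⟨s, t, F, G, hst, hF, hFg, hG, hGg, hrel, h⟩ := dep_coprime hx hd hN hu hu' hv hv'
    rcases Nat.eq_zero_or_pos t with rfl | ht
    · have hGc : G = C (coeff 0 G) := by
        rw [← homogeneousComponent_zero, homogeneousComponent_eq_self hG]
      set g := coeff 0 G
      have hgu : IsUnit g := by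
        by_contra hn
        apply hGg
        rw [hGc]
        exact Ideal.mem_map_of_mem _ ((mem_maximalIdeal g).2 hn)
      obtain ⟨g', hg'⟩ := hgu.exists_left_inv
      refine ⟨C g' * F, ?_, ?_⟩
      · rw [show b - a = s by omega]
        exact hF.C_mul g'
      · rw [hGc, eval_C] at h
        rw [show b = a + s by omega]
        convert (BB x (a + s)).mul_mem_left (-g') h using 1
        rw [map_mul, eval_C]
        linear_combination (-v) * hg'
    · exact (no_pos hx hd hm hk hN hb hu hu' hmin hv hst hF hG hGg hrel h ht).elim

end P18
end DA

namespace DA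
section P19
open MvPolynomial IsLocalRing Finset
variable {R : Type*} [CommRing R] {d : ℕ}

/-- partial ideal -/
def QQ (x : Fin d → R) (T : Set (Fin d)) : Ideal R := Ideal.span (x '' T)

theorem QQ_le (x : Fin d → R) (T : Set (Fin d)) : QQ x T ≤ JJ x := 
  Ideal.span_mono (Set.image_subset_range _ _)

theorem QQ_mono (x : Fin d → R) {S T : Set (Fin d)} (h : S ⊆ T) : QQ x S ≤ QQ x T := 
  Ideal.span_mono (Set.image_mono h)

open Classical in
/-- killing the variables in `T` -/
noncomputable def pp (T : Set (Fin d)) : MvPolynomial (Fin d) R →ₐ[R] MvPolynomial (Fin d) R :=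
  aeval (fun i => if i ∈ T then 0 else X i)

open Classical in
theorem pp_mon (T : Set (Fin d)) (μ : Fin d →₀ ℕ) (r : R) : 
    pp T (monomial μ r) = if ∀ i ∈ T, μ i = 0 then monomial μ r else 0 := by
  rw [pp, aeval_monomial]
  split_ifs with h
  · rw [monomial_eq]
    congr 1
    refine Finsupp.prod_congr fun i hi => ?_
    rw [if_neg]
    intro hT
    exact Finsupp.mem_support_iff.1 hi (h i hT)
  · push Not at h
    obtain ⟨i, hi, hμ⟩ := h
    rw [Finsupp.prod, prod_eq_zero (Finsupp.mem_support_iff.2 hμ), mul_zero]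
    rw [if_pos hi, zero_pow hμ]

open Classical in
theorem pp_sum (T : Set (Fin d)) (F : MvPolynomial (Fin d) R) : 
    pp T F = ∑ μ ∈ F.support, if ∀ i ∈ T, μ i = 0 then monomial μ (coeff μ F) else 0 := by
  have h1 : pp T F = ∑ μ ∈ F.support, pp T (monomial μ (coeff μ F)) := by
    rw [← map_sum, ← F.as_sum]
  rw [h1]
  exact sum_congr rfl fun μ _ => pp_mon T μ _

theorem pp_hom (T : Set (Fin d)) {n : ℕ} {F : MvPolynomial (Fin d) R} (hF : F.IsHomogeneous n) : (pp T F).IsHomogeneous n := by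
  classical
  rw [pp_sum]
  refine IsHomogeneous.sum _ _ _ fun μ hμ => ?_
  split_ifs
  · exact isHomogeneous_monomial _ (hF.degree_eq_sum_deg_support hμ).symm
  · exact isHomogeneous_zero _ _ _

theorem mon_mem {a : Ideal R} {F : MvPolynomial (Fin d) R} (hF : F ∈ a.map (C : R →+* MvPolynomial (Fin d) R)) (μ : Fin d →₀ ℕ) : 
    monomial μ (coeff μ F) ∈ a.map (C : R →+* MvPolynomial (Fin d) R) := by
  rw [← mul_one (coeff μ F), ← C_mul_monomial]
  exact Ideal.mul_mem_right _ _ (Ideal.mem_map_of_mem _ (mem_map_C_iff.1 hF μ))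

theorem pp_mem (T : Set (Fin d)) {a : Ideal R} {F : MvPolynomial (Fin d) R} (hF : F ∈ a.map (C : R →+* MvPolynomial (Fin d) R)) : 
    pp T F ∈ a.map (C : R →+* MvPolynomial (Fin d) R) := by
  classical
  rw [pp_sum]
  refine sum_mem fun μ hμ => ?_
  split_ifs
  · exact mon_mem hF μ
  · exact zero_mem _

theorem pp_zero (T : Set (Fin d)) {F : MvPolynomial (Fin d) R} (hF : F.IsHomogeneous 0) : pp T F = F := by
  have hGc : F = C (coeff 0 F) := by
    rw [← homogeneousComponent_zero, homogeneousComponent_eq_self hF]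
  rw [hGc, pp, aeval_C]; rfl

theorem pp_split (x : Fin d → R) (T : Set (Fin d)) {a : Ideal R} {n : ℕ} {F : MvPolynomial (Fin d) R} (hF : F.IsHomogeneous (n + 1))
    (hFa : F ∈ a.map (C : R →+* MvPolynomial (Fin d) R)) : eval x F - eval x (pp T F) ∈ QQ x T * (a * JJ x ^ n) := by
  classical
  have h1 : F - pp T F = ∑ μ ∈ F.support, if ∀ i ∈ T, μ i = 0 then 0 else monomial μ (coeff μ F) := by
    rw [pp_sum]
    conv_lhs => enter [1]; rw [F.as_sum]
    rw [← sum_sub_distrib]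
    refine sum_congr rfl fun μ _ => ?_
    split_ifs
    · rw [sub_self]
    · rw [sub_zero]
  rw [← map_sub, h1, map_sum]
  refine sum_mem fun μ hμ => ?_
  split_ifs with h
  · rw [map_zero]; exact zero_mem _
  · push Not at h
    obtain ⟨i, hi, hμi⟩ := h
    have hle : Finsupp.single i 1 ≤ μ := by
      rw [Finsupp.single_le_iff]; omega
    have hdeg : μ.degree = n + 1 := (hF.degree_eq_sum_deg_support hμ).symm
    have hsplit : μ = Finsupp.single i 1 + (μ - Finsupp.single i 1) := (add_tsub_cancel_of_le hle).symm
    have hd' : (μ - Finsupp.single i 1).degree = n := by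
      rw [hsplit, map_add, Finsupp.degree_single] at hdeg
      omega
    have h2 : monomial μ (coeff μ F) = X i * (C (coeff μ F) * monomial (μ - Finsupp.single i 1) 1) := by
      conv_lhs => rw [hsplit]
      rw [C_mul_monomial, mul_one, X, monomial_mul, one_mul, ← hsplit]
    rw [h2, map_mul, map_mul, eval_X, eval_C]
    refine Ideal.mul_mem_mul (Ideal.subset_span ⟨i, hi, rfl⟩) (Ideal.mul_mem_mul (mem_map_C_iff.1 hFa μ) ?_)
    exact eval_mem_pow x (isHomogeneous_monomial _ hd')

/-- weak splitting -/
theorem pp_split' (x : Fin d → R) (T : Set (Fin d)) {n : ℕ} {F : MvPolynomial (Fin d) R} (hF : F.IsHomogeneous n) :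
    eval x F - eval x (pp T F) ∈ QQ x T := by
  rcases n with _ | n
  · rw [pp_zero T hF, sub_self]; exact zero_mem _
  · exact Ideal.mul_le_left (pp_split x T (a := ⊤) hF (by rw [Ideal.map_top]; trivial))

theorem QQ_rep (x : Fin d → R) (T : Set (Fin d)) {n : ℕ} {z : R} (hz : z ∈ QQ x T * JJ x ^ n) :
    ∃ G : MvPolynomial (Fin d) R, G.IsHomogeneous (n + 1) ∧ pp T G = 0 ∧ eval x G = z := by
  refine Submodule.mul_induction_on hz ?_ ?_
  · intro r hr
    refine Submodule.span_induction (p := fun r _ => ∀ y ∈ JJ x ^ n, ∃ G : MvPolynomial (Fin d) R, G.IsHomogeneous (n + 1) ∧ pp T G = 0 ∧ eval x G = r * y) ?_ ?_ ?_ ?_ hr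
    · rintro _ ⟨i, hi, rfl⟩ y hy
      obtain ⟨H, hH, rfl⟩ := (Ideal.mem_span_pow_iff_exists_isHomogeneous x y).mp hy
      refine ⟨X i * H, ?_, ?_, by simp⟩
      · rw [add_comm]; exact (isHomogeneous_X _ i).mul hH
      · rw [map_mul, pp, aeval_X, if_pos hi, zero_mul]
    · intro y _
      exact ⟨0, isHomogeneous_zero _ _ _, by simp, by simp⟩
    · rintro r s _ _ h1 h2 y hy
      obtain ⟨G, a1, a2, a3⟩ := h1 y hy
      obtain ⟨H, b1, b2, b3⟩ := h2 y hy
      exact ⟨G + H, a1.add b1, by rw [map_add, a2, b2, add_zero], by rw [map_add, a3, b3, add_mul]⟩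
    · rintro c r _ h1 y hy
      obtain ⟨G, a1, a2, a3⟩ := h1 y hy
      exact ⟨C c * G, a1.C_mul c, by rw [map_mul, a2, mul_zero], by rw [map_mul, a3, eval_C, smul_eq_mul, mul_assoc]⟩
  · rintro y z ⟨G, a1, a2, a3⟩ ⟨H, b1, b2, b3⟩
    exact ⟨G + H, a1.add b1, by rw [map_add, a2, b2, add_zero], by rw [map_add, a3, b3]⟩

theorem QQ_inter {x : Fin d → R} (hx : QR x) (T : Set (Fin d)) {n : ℕ} {z : R} (hz : z ∈ QQ x T) (hn : z ∈ JJ x ^ (n + 1)) :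
    z ∈ QQ x T * JJ x ^ n := by
  have key : ∀ j ≤ n, z ∈ QQ x T * JJ x ^ j := by
    intro j
    induction j with
    | zero => intro _; simpa using hz
    | succ j ih =>
      intro hj
      obtain ⟨G, h1, h2, rfl⟩ := QQ_rep x T (ih (by omega))
      have h3 := hx.coeff_mem_J h1 (Ideal.pow_le_pow_right (by omega) hn)
      have := pp_split x T h1 h3
      rwa [h2, map_zero, sub_zero, ← pow_succ'] at this
  exact key n le_rfl

theorem QQ_inter' {x : Fin d → R} (hx : QR x) (T : Set (Fin d)) {a : Ideal R} (ha : JJ x ≤ a) {n : ℕ} {z : R} (hz : z ∈ QQ x T) (hn : z ∈ a * JJ x ^ (n + 1)) :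
    z ∈ QQ x T * (a * JJ x ^ n) := by
  obtain ⟨G, h1, h2, rfl⟩ := QQ_rep x T (QQ_inter hx T hz (Ideal.mul_le_right hn))
  have h3 := hx.coeff_mem ha h1 hn
  have := pp_split x T h1 h3
  rwa [h2, map_zero, sub_zero] at this

theorem QQ_rep' {x : Fin d → R} (hx : QR x) (T : Set (Fin d)) {n : ℕ} {z : R} (hz : z ∈ QQ x T) (hn : z ∈ JJ x ^ n) :
    ∃ G : MvPolynomial (Fin d) R, G.IsHomogeneous n ∧ pp T G ∈ (JJ x).map (C : R →+* MvPolynomial (Fin d) R) ∧ eval x G = z := by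
  rcases n with _ | n
  · refine ⟨C z, isHomogeneous_C _ _, pp_mem T (Ideal.mem_map_of_mem _ (QQ_le x T hz)), eval_C _⟩
  · obtain ⟨G, h1, h2, h3⟩ := QQ_rep x T (QQ_inter hx T hz hn)
    exact ⟨G, h1, by rw [h2]; exact zero_mem _, h3⟩

theorem tf_step [IsLocalRing R] {x : Fin d → R} (hx : QR x) (T : Set (Fin d)) {a : Ideal R} (ha : JJ x ≤ a) {s n : ℕ} {F : MvPolynomial (Fin d) R}
    (hF : F.IsHomogeneous s) (hg : Good (pp T F)) {u : R} (hu : u ∈ QQ x T ⊔ JJ x ^ n) (h : eval x F * u ∈ QQ x T ⊔ a * JJ x ^ (n + s)) :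
    u ∈ QQ x T ⊔ a * JJ x ^ n := by
  obtain ⟨q, hq, y, hy, rfl⟩ := Submodule.mem_sup.1 hu
  obtain ⟨U, hU, rfl⟩ := (Ideal.mem_span_pow_iff_exists_isHomogeneous x y).mp hy
  obtain ⟨p, hp, e, he, hpe⟩ := Submodule.mem_sup.1 h
  have h1 : eval x (F * U) - e ∈ QQ x T := by
    have : eval x (F * U) - e = p - eval x F * q := by
      rw [map_mul]; linear_combination hpe.symm
    rw [this]
    exact sub_mem hp (Ideal.mul_mem_left _ _ hq)
  have hFU : (F * U).IsHomogeneous (n + s) := by rw [add_comm]; exact hF.mul hU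
  obtain ⟨G, hG, hGp, hGe⟩ := QQ_rep' hx T h1 (sub_mem (eval_mem_pow x hFU) (Ideal.mul_le_right he))
  have h2 : F * U - G ∈ a.map (C : R →+* MvPolynomial (Fin d) R) := by
    refine hx.coeff_mem ha (hFU.sub hG) ?_
    rw [map_sub, hGe, sub_sub_cancel]
    exact he
  have h3 := add_mem (pp_mem T h2) (Ideal.map_mono ha hGp)
  rw [map_sub, sub_add_cancel, map_mul] at h3
  have h4 := mccoy hg h3
  refine add_mem (Ideal.mem_sup_left hq) ?_
  rw [← sub_add_cancel (eval x U) (eval x (pp T U))]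
  refine add_mem (Ideal.mem_sup_left (pp_split' x T hU)) (Ideal.mem_sup_right ?_)
  rw [mem_mul_pow]
  exact ⟨_, pp_hom T hU, h4, rfl⟩

theorem tf_mod [IsLocalRing R] {x : Fin d → R} (hx : QR x) (T : Set (Fin d)) {a : Ideal R} (ha : JJ x ≤ a) {s n : ℕ} {F : MvPolynomial (Fin d) R}
    (hF : F.IsHomogeneous s) (hg : Good (pp T F)) {u : R} (h : eval x F * u ∈ QQ x T ⊔ a * JJ x ^ (n + s)) :
    u ∈ QQ x T ⊔ a * JJ x ^ n := by
  have key : ∀ j ≤ n, u ∈ QQ x T ⊔ JJ x ^ j := by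
    intro j
    induction j with
    | zero => intro _; simp
    | succ j ih =>
      intro hj
      rw [pow_succ']
      refine tf_step hx T le_rfl hF hg (ih (by omega)) ?_
      rw [← pow_succ']
      have hle : a * JJ x ^ (n + s) ≤ JJ x ^ (j + s + 1) := Ideal.mul_le_right.trans (Ideal.pow_le_pow_right (by omega))
      exact (sup_le_sup_left hle (QQ x T) : _ ≤ _) h
  exact tf_step hx T ha hF hg (key n le_rfl) h

theorem pp_X (T : Set (Fin d)) {i : Fin d} (hi : i ∉ T) : pp T (X i : MvPolynomial (Fin d) R) = X i := by
  rw [pp, aeval_X, if_neg hi]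

theorem reg_mod [IsLocalRing R] [IsNoetherianRing R] {x : Fin d → R} (hx : QR x) (hm : JJ x ≤ maximalIdeal R) (T : Set (Fin d)) {i : Fin d} (hi : i ∉ T) {w : R}
    (h : x i * w ∈ QQ x T) : w ∈ QQ x T := by
  have h1 : ∀ n, w ∈ QQ x T ⊔ JJ x ^ n := by
    intro n
    have := tf_mod (n := n) hx T le_rfl (isHomogeneous_X R i) (by rw [pp_X T hi]; exact good_X i) (u := w) (by
      rw [eval_X]; exact Ideal.mem_sup_left h)
    have hle : JJ x * JJ x ^ n ≤ JJ x ^ n := Ideal.mul_le_right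
    exact (sup_le_sup_left hle (QQ x T) : _ ≤ _) this
  have hbot := Ideal.iInf_pow_smul_eq_bot_of_isLocalRing (M := R ⧸ QQ x T) (JJ x) (fun ht => (maximalIdeal.isMaximal R).ne_top (top_le_iff.1 (ht ▸ hm)))
  rw [← Ideal.Quotient.eq_zero_iff_mem]
  have : Ideal.Quotient.mk (QQ x T) w ∈ (⨅ i : ℕ, JJ x ^ i • ⊤ : Submodule R (R ⧸ QQ x T)) := by
    rw [Submodule.mem_iInf]
    intro n
    obtain ⟨q, hq, y, hy, rfl⟩ := Submodule.mem_sup.1 (h1 n)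
    rw [map_add, Ideal.Quotient.eq_zero_iff_mem.2 hq, zero_add]
    have : Ideal.Quotient.mk (QQ x T) y = y • (1 : R ⧸ QQ x T) := by
      rw [Algebra.smul_def, mul_one]; rfl
    rw [this]
    exact Submodule.smul_mem_smul hy trivial
  rw [hbot] at this
  exact this

end P19
end DA

namespace DA
section P20
open MvPolynomial IsLocalRing Finset
variable {R : Type*} [CommRing R] {d : ℕ}

theorem eval_scale {n : ℕ} {U : MvPolynomial (Fin d) R} (hU : U.IsHomogeneous n) (l : Fin d → R) (c : R) :
    eval (fun i => l i * c) U = eval l U * c ^ n := by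
  have h : (Polynomial.eval₂RingHom (eval l) c).comp (hz : MvPolynomial (Fin d) R →ₐ[R] _).toRingHom = eval (fun i => l i * c) := by
    refine MvPolynomial.ringHom_ext ?_ ?_
    · intro r
      have : (hz : MvPolynomial (Fin d) R →ₐ[R] _) (C r) = Polynomial.C (C r) := by
        rw [hz, aeval_C]; rfl
      simp [this]
    · intro i
      have : (hz : MvPolynomial (Fin d) R →ₐ[R] _) (X i) = Polynomial.C (X i) * Polynomial.X := by
        rw [hz, aeval_X]
      simp [this]
  rw [← h]
  show Polynomial.eval₂RingHom (eval l) c (hz U) = _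
  rw [hz_hom hU]
  simp

theorem eval_congr_mod {Q : Ideal R} {x y : Fin d → R} (h : ∀ i, x i - y i ∈ Q) (U : MvPolynomial (Fin d) R) : eval x U - eval y U ∈ Q := by
  rw [← Ideal.Quotient.eq]
  have : (Ideal.Quotient.mk Q).comp (eval x) = (Ideal.Quotient.mk Q).comp (eval y) := by
    refine MvPolynomial.ringHom_ext ?_ ?_
    · intro r; simp
    · intro i
      simpa using Ideal.Quotient.eq.2 (h i)
  exact congrArg (fun f => f U) this

theorem gen_pos [IsLocalRing R] [IsNoetherianRing R] [Infinite (ResidueField R)] {b : Ideal R} {k : ℕ} (hk : maximalIdeal R ^ k ≤ b) 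
    (i0 : Fin d) {n : ℕ} {U : MvPolynomial (Fin d) R} (hU : U.IsHomogeneous n) (hUb : U ∉ b.map (C : R →+* MvPolynomial (Fin d) R)) :
    ∃ l : Fin d → R, l i0 = 1 ∧ eval l U ∉ b := by
  induction b using WellFoundedGT.induction with
  | ind b ih =>
    have hbt : b < ⊤ := by
      refine lt_top_iff_ne_top.2 ?_
      rintro rfl
      apply hUb
      rw [Ideal.map_top]; trivial
    obtain ⟨e, -, heb, hme⟩ := exists_socle hk hbt
    have hlt' : b < b ⊔ Ideal.span {e} := by
      refine lt_of_le_of_ne le_sup_left fun he => heb ?_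
      rw [he]
      exact Ideal.mem_sup_right (Ideal.mem_span_singleton_self e)
    by_cases hU' : U ∈ (b ⊔ Ideal.span {e}).map (C : R →+* MvPolynomial (Fin d) R)
    · obtain ⟨U1, hU1⟩ := mem_sup_span hU'
      have hg : Good U1 := by
        intro h
        apply hUb
        rw [← sub_add_cancel U (C e * U1)]
        refine add_mem hU1 ?_
        rw [mem_map_C_iff] at h ⊢
        intro m
        rw [coeff_C_mul, mul_comm]
        exact hme _ (h m)
      have hg2 := good_iff.1 (hg.mul (good_X i0))
      obtain ⟨l', hl'⟩ : ∃ l' : Fin d → ResidueField R, eval l' (MvPolynomial.map (residue R) (U1 * X i0)) ≠ 0 := by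
        by_contra hc
        push Not at hc
        exact hg2 (MvPolynomial.funext fun y => by rw [hc y, map_zero])
      choose l hl using fun i => residue_surjective (R := R) (l' i)
      have h1 : residue R (eval l U1 * l i0) ≠ 0 := by
        have hcomp : (residue R).comp (eval l) = (eval l').comp (MvPolynomial.map (residue R)) := by
          refine MvPolynomial.ringHom_ext ?_ ?_
          · intro r; simp
          · intro i; simp [hl]
        have h0 : residue R (eval l (U1 * X i0)) = eval l' (MvPolynomial.map (residue R) (U1 * X i0)) :=
          congrArg (fun f => f (U1 * X i0)) hcomp
        rw [← h0, map_mul (eval l), eval_X] at hl'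
        exact hl'
      rw [map_mul] at h1
      have hu1 : IsUnit (eval l U1) := (residue_ne_zero_iff_isUnit _).1 (left_ne_zero_of_mul h1)
      obtain ⟨c, hc⟩ := ((residue_ne_zero_iff_isUnit _).1 (right_ne_zero_of_mul h1)).exists_right_inv
      refine ⟨fun i => l i * c, hc, fun hmem => ?_⟩
      rw [eval_scale hU] at hmem
      have hcu : IsUnit (c ^ n) := (IsUnit.of_mul_eq_one (l i0) (by rw [mul_comm]; exact hc)).pow n
      have h2 : eval l U ∈ b := (Ideal.mul_unit_mem_iff_mem _ hcu).1 hmem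
      have h3 : eval l (U - C e * U1) ∈ b := by
        have := Ideal.mem_map_of_mem (eval l) hU1
        rw [Ideal.map_map] at this
        have hid : (eval l).comp (C : R →+* MvPolynomial (Fin d) R) = RingHom.id R := by ext; simp
        rwa [hid, Ideal.map_id] at this
      rw [map_sub, map_mul, eval_C] at h3
      have h4 := sub_mem h2 h3
      rw [sub_sub_cancel] at h4
      exact heb ((Ideal.mul_unit_mem_iff_mem _ hu1).1 h4)
    · obtain ⟨l, h1, h2⟩ := ih _ hlt' (hk.trans hlt'.le) hU'
      exact ⟨l, h1, fun h => h2 (hlt'.le h)⟩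

theorem ic_congr {x y : Fin d → R} (h : JJ x = JJ y) (n : ℕ) : ic x n = ic y n := by
  ext w
  rw [mem_ic, mem_ic, h]

theorem exists_coord [IsLocalRing R] [IsNoetherianRing R] [Infinite (ResidueField R)] {x : Fin d → R} 
    (hQ : ∀ y : Fin d → R, JJ y = JJ x → QR y)
    {b : Ideal R} (hb : JJ x ≤ b) {k : ℕ} (hk : maximalIdeal R ^ k ≤ b) 
    (i0 : Fin d) {n : ℕ} {u : R} (hu : u ∈ JJ x ^ n) (hub : u ∉ b * JJ x ^ n) :
    ∃ y : Fin d → R, JJ y = JJ x ∧ u ∉ QQ y {i | i ≠ i0} ⊔ b * JJ x ^ n := by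
  obtain ⟨U, hU, rfl⟩ := (Ideal.mem_span_pow_iff_exists_isHomogeneous x u).mp hu
  obtain ⟨l, hl, hlb⟩ := gen_pos hk i0 hU (fun h => hub ((mem_mul_pow x b n _).2 ⟨U, hU, h, rfl⟩))
  classical
  let y : Fin d → R := fun i => if i = i0 then x i0 else x i - l i * x i0
  have hy0 : y i0 = x i0 := if_pos rfl
  have hyi : ∀ i, i ≠ i0 → y i = x i - l i * x i0 := fun i hi => if_neg hi
  have hJ : JJ y = JJ x := by
    apply le_antisymm
    · rw [JJ, Ideal.span_le]
      rintro _ ⟨i, rfl⟩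
      by_cases hi : i = i0
      · rw [hi, hy0]; exact x_mem x i0
      · rw [hyi i hi]; exact sub_mem (x_mem x i) (Ideal.mul_mem_left _ _ (x_mem x i0))
    · rw [JJ, Ideal.span_le]
      rintro _ ⟨i, rfl⟩
      by_cases hi : i = i0
      · rw [hi, ← hy0]; exact x_mem y i0
      · have : x i = y i + l i * y i0 := by rw [hyi i hi, hy0]; ring
        rw [this]; exact add_mem (x_mem y i) (Ideal.mul_mem_left _ _ (x_mem y i0))
  have hy := hQ y hJ
  refine ⟨y, hJ, fun hmem => hlb ?_⟩
  have h1 : eval x U - eval l U * y i0 ^ n ∈ QQ y {i | i ≠ i0} := by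
    rw [← eval_scale hU]
    refine eval_congr_mod (fun i => ?_) U
    by_cases hi : i = i0
    · rw [hi, hl, hy0, one_mul, sub_self]; exact zero_mem _
    · rw [hy0, ← hyi i hi]
      exact Ideal.subset_span ⟨i, hi, rfl⟩
  have h2 := sub_mem hmem (Ideal.mem_sup_left h1)
  rw [sub_sub_cancel] at h2
  have h3 := tf_mod (n := 0) (s := n) (a := b) hy {i | i ≠ i0} (by rw [hJ]; exact hb) (isHomogeneous_X_pow (R := R) i0 n) (by 
    rw [map_pow, pp_X _ (by simp)]; exact (good_X i0).pow n) (u := eval l U) (by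
      rw [map_pow, eval_X, mul_comm (y i0 ^ n), zero_add, hJ]; exact h2)
  rw [pow_zero, mul_one] at h3
  exact (sup_le ((QQ_le y _).trans (by rw [hJ]; exact hb)) le_rfl : _ ≤ b) h3

end P20
end DA

namespace DA
section P21
open MvPolynomial IsLocalRing Finset
variable {R : Type*} [CommRing R] {d : ℕ}

/-- Valabrega–Valla property for all subsets of coordinates different from `i0`. -/
def VV (x : Fin d → R) (i0 : Fin d) : Prop :=
  ∀ T : Set (Fin d), T ⊆ {i | i ≠ i0} → ∀ (n : ℕ) (z : R), z ∈ QQ x T → z ∈ ic x (n + 1) → z ∈ QQ x T * ic x n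

theorem vv_BB {x : Fin d → R} (hx : QR x) (T : Set (Fin d)) {n : ℕ} {z : R} (hz : z ∈ QQ x T) (hn : z ∈ BB x n) :
    z ∈ QQ x T * ic x n := by
  rcases n with _ | n
  · rw [ic_zero, Ideal.mul_top]; exact hz
  · have h := QQ_inter' hx T (JJ_le_ic x) hz hn
    exact Ideal.mul_mono_right (BB_le x n) h

theorem BB_congr {x y : Fin d → R} (h : JJ x = JJ y) (n : ℕ) : BB x n = BB y n := by
  rw [BB, BB, ic_congr h, h]

theorem vv_str [IsLocalRing R] {x : Fin d → R} (hx : QR x) (i0 : Fin d) {a : ℕ} {u : R} 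
    (hu : u ∈ ic x (a + 1)) (hmu : ∀ y ∈ maximalIdeal R, y * u ∈ BB x a)
    (hlt : ∀ n < a, ic x (n + 1) ≤ BB x n)
    (hge : ∀ b ≥ a, ∀ v ∈ ic x (b + 1), ∃ p ∈ JJ x ^ (b - a), v - p * u ∈ BB x b)
    (hu0 : u ∉ QQ x {i | i ≠ i0} ⊔ BB x a) : VV x i0 := by
  intro T hT n z hz hn
  rcases lt_or_ge n a with h | h
  · exact vv_BB hx T hz (hlt n h hn)
  obtain ⟨s, rfl⟩ := Nat.exists_eq_add_of_le h
  obtain ⟨p, hp, hpz⟩ := hge _ h z hn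
  rw [Nat.add_sub_cancel_left] at hp
  obtain ⟨F, hF, rfl⟩ := (Ideal.mem_span_pow_iff_exists_isHomogeneous x p).mp hp
  by_cases hg : Good (pp T F)
  · exfalso
    have h1 := tf_mod (n := a) hx T (JJ_le_ic x) hF hg (u := u) (by
      have : eval x F * u = z - (z - eval x F * u) := by ring
      rw [this]
      exact sub_mem (Ideal.mem_sup_left hz) (Ideal.mem_sup_right hpz))
    have hle : QQ x T ≤ QQ x {i | i ≠ i0} := QQ_mono x hT
    exact hu0 ((sup_le_sup_right hle (BB x a) : _ ≤ _) h1)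
  have hg' : pp T F ∈ (maximalIdeal R).map (C : R →+* MvPolynomial (Fin d) R) := by
    by_contra hc; exact hg hc
  have h1 : eval x (pp T F) ∈ maximalIdeal R * JJ x ^ s := (mem_mul_pow x _ s _).2 ⟨_, pp_hom T hF, hg', rfl⟩
  have h2 : eval x (pp T F) * u ∈ BB x (a + s) := by
    refine Submodule.mul_induction_on (C := fun r => r * u ∈ BB x (a + s)) h1 ?_ ?_
    · intro y hy r hr
      have := BB_mul (hmu y hy) hr
      rwa [← mul_assoc, mul_comm r] at this
    · intro y z hy hz
      rw [add_mul]; exact add_mem hy hz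
  have h3 : (eval x F - eval x (pp T F)) * u ∈ QQ x T * ic x (a + s) := by
    rcases s with _ | s
    · rw [pp_zero T hF, sub_self, zero_mul]; exact zero_mem _
    · have h4 := pp_split x T (a := ⊤) hF (by rw [Ideal.map_top]; trivial)
      rw [Ideal.top_mul] at h4
      have h5 := Ideal.mul_mem_mul h4 hu
      rw [mul_assoc] at h5
      refine Ideal.mul_mono_right ?_ h5
      refine (Ideal.mul_mono_left (pow_le_ic x s)).trans ((ic_mul_le x _ _).trans ?_)
      exact ic_anti x (by omega)
  have h6 : z - (eval x F - eval x (pp T F)) * u ∈ BB x (a + s) := by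
    have : z - (eval x F - eval x (pp T F)) * u = (z - eval x F * u) + eval x (pp T F) * u := by ring
    rw [this]; exact add_mem hpz h2
  have h7 := vv_BB hx T (sub_mem hz (Ideal.mul_le_left h3)) h6
  have := add_mem h7 h3
  rwa [sub_add_cancel] at this

theorem exists_VV [IsLocalRing R] [IsNoetherianRing R] [Infinite (ResidueField R)] {x : Fin d → R} (hd : 0 < d)
    (hQ : ∀ y : Fin d → R, JJ y = JJ x → QR y) (hm : JJ x ≤ maximalIdeal R) 
    {k : ℕ} (hk : maximalIdeal R ^ k ≤ JJ x) (hN : NT x) (i0 : Fin d) :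
    ∃ y : Fin d → R, JJ y = JJ x ∧ VV y i0 := by
  have hx := hQ x rfl
  rcases structure_thm hx hd hm hk hN with h | ⟨a, u, ha, hu, hub, hmu, hlt, hge⟩
  · exact ⟨x, rfl, fun T hT n z hz hn => vv_BB hx T hz (h n hn)⟩
  obtain ⟨a, rfl⟩ := Nat.exists_eq_add_of_le' ha
  have hu1 : u ∈ BB x a := drop hx hd hm hN hu
  have fin : ∀ y : Fin d → R, JJ y = JJ x → u ∉ QQ y {i | i ≠ i0} ⊔ BB x (a + 1) → VV y i0 := by
    intro y hy hu0
    refine vv_str (hQ y hy) i0 (a := a + 1) (u := u) ?_ ?_ ?_ ?_ ?_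
    · rw [ic_congr hy]; exact hu
    · rw [BB_congr hy]; exact hmu
    · intro n hn; rw [BB_congr hy, ic_congr hy]; exact hlt n hn
    · intro b hb v hv
      rw [ic_congr hy] at hv
      obtain ⟨P, hP, hP'⟩ := hge b hb v hv
      rw [hy, BB_congr hy]
      exact ⟨_, eval_mem_pow x hP, hP'⟩
    · rw [BB_congr hy]; exact hu0
  by_cases hJ : u ∈ JJ x ^ (a + 1)
  · obtain ⟨y, hy, h⟩ := exists_coord hQ (JJ_le_ic x) (hk.trans (JJ_le_ic x)) i0 hJ hub
    exact ⟨y, hy, fin y hy h⟩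
  · obtain ⟨y, hy, h⟩ := exists_coord hQ le_rfl hk i0 (BB_le_pow x a hu1) (by rw [← pow_succ']; exact hJ)
    refine ⟨y, hy, fin y hy fun hc => h ?_⟩
    rw [← pow_succ']
    exact (sup_le_sup_left (BB_le_pow x (a + 1)) _ : _ ≤ _) hc

theorem QQ_insert (x : Fin d → R) (T : Set (Fin d)) (i : Fin d) : QQ x (insert i T) = Ideal.span {x i} ⊔ QQ x T := by
  rw [QQ, Set.image_insert_eq, Ideal.span_insert, QQ]

/-- the graded colon statement -/
theorem colon_lem [IsLocalRing R] [IsNoetherianRing R] {x : Fin d → R} (hx : QR x) (hm : JJ x ≤ maximalIdeal R) {i0 : Fin d}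
    (hV : VV x i0) {T : Set (Fin d)} (hT : T ⊆ {i | i ≠ i0}) {i : Fin d} (hi : i ∉ T) (hi0 : i ≠ i0) {n : ℕ} {w : R}
    (hw : w ∈ ic x n) (h : x i * w ∈ ic x (n + 2) ⊔ QQ x T * ic x n) : w ∈ ic x (n + 1) ⊔ QQ x T * ic x (n - 1) := by
  obtain ⟨p, hp, q, hq, hpq⟩ := Submodule.mem_sup.1 h
  have h1 : p ∈ QQ x (insert i T) := by
    have : p = x i * w - q := by rw [← hpq]; ring
    rw [this, QQ_insert]
    exact sub_mem (Ideal.mem_sup_left (Ideal.mul_mem_right _ _ (Ideal.mem_span_singleton_self _)))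
      (Ideal.mem_sup_right (Ideal.mul_le_left hq))
  have h2 := hV (insert i T) (Set.insert_subset hi0 hT) (n + 1) p h1 hp
  rw [QQ_insert, Ideal.sup_mul] at h2
  obtain ⟨r, hr, t, ht, hrt⟩ := Submodule.mem_sup.1 h2
  obtain ⟨z, hz, rfl⟩ := Ideal.mem_span_singleton_mul.1 hr
  have h3 : x i * (w - z) ∈ QQ x T := by
    have : x i * (w - z) = t + q := by rw [mul_sub, ← hpq, ← hrt]; ring
    rw [this]
    exact add_mem (Ideal.mul_le_left ht) (Ideal.mul_le_left hq)
  have h4 := reg_mod hx hm T hi h3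
  have hwz : w - z ∈ QQ x T * ic x (n - 1) := by
    rcases n with _ | n
    · rw [Nat.zero_sub, ic_zero, Ideal.mul_top]; exact h4
    · exact hV T hT n _ h4 (sub_mem hw (ic_anti x (by omega) hz))
  rw [← add_sub_cancel z w]
  exact add_mem (Ideal.mem_sup_left hz) (Ideal.mem_sup_right hwz)

end P21
end DA

namespace DA
section P22
open IsLocalRing Finset
variable {R : Type*} [CommRing R] {d : ℕ}

theorem ic_one_le [IsLocalRing R] {x : Fin d → R} (hm : JJ x ≤ maximalIdeal R) : ic x 1 ≤ maximalIdeal R := by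
  intro w hw
  obtain ⟨M, hM⟩ := mem_ic.1 hw
  have h := hM (M + 1)
  rw [one_mul, Nat.add_sub_cancel_left, pow_one] at h
  exact (maximalIdeal.isMaximal R).isPrime.mem_of_pow_mem _ (hm h)

theorem QQ_mul_le (x : Fin d → R) (T : Set (Fin d)) (n : ℕ) : QQ x T * ic x n ≤ ic x (n + 1) := by
  rw [add_comm n 1]
  exact (Ideal.mul_mono_left ((QQ_le x T).trans (JJ_le_ic x))).trans (ic_mul_le x 1 n)

/-- the `n`-th graded piece of the ideal generated by `x_j t`, `j ∈ T`, modulo degree shift. -/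
def GT (x : Fin d → R) (T : Set (Fin d)) (n : ℕ) : Ideal R := ic x (n + 1) ⊔ QQ x T * ic x (n - 1)

theorem GT_zero (x : Fin d → R) (T : Set (Fin d)) : GT x T 0 = ic x 1 := by
  rw [GT, zero_add, sup_eq_left, Nat.zero_sub]
  exact QQ_mul_le x T 0

theorem GT_succ (x : Fin d → R) (T : Set (Fin d)) (n : ℕ) : GT x T (n + 1) = ic x (n + 2) ⊔ QQ x T * ic x n := rfl

theorem ic_mul_GT {x : Fin d → R} (T : Set (Fin d)) {k l : ℕ} {w z : R} (hw : w ∈ ic x k) (hz : z ∈ GT x T l) : 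
    w * z ∈ GT x T (k + l) := by
  rcases l with _ | l
  · rw [GT_zero] at hz
    exact Ideal.mem_sup_left (ic_mul hw hz)
  · rw [GT_succ] at hz
    rw [← add_assoc, GT_succ]
    obtain ⟨p, hp, q, hq, rfl⟩ := Submodule.mem_sup.1 hz
    rw [mul_add]
    refine add_mem (Ideal.mem_sup_left ?_) (Ideal.mem_sup_right ?_)
    · have := ic_mul hw hp
      rwa [← add_assoc] at this
    · have h := Ideal.mul_mem_mul hw hq
      rw [mul_left_comm] at h
      exact Ideal.mul_mono_right (ic_mul_le x k l) h

variable {x : Fin d → R} {A : Subalgebra R (Polynomial R)} {K : Ideal A}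

/-- The ideal of elements with coefficients in `GT`. -/
def GI (hA : ∀ p : Polynomial R, p ∈ A ↔ ∀ n, p.coeff n ∈ ic x n) (T : Set (Fin d)) : Ideal A where
  carrier := {p | ∀ n, (p : Polynomial R).coeff n ∈ GT x T n}
  zero_mem' := fun n => by simp
  add_mem' := fun {p q} hp hq n => by
    rw [Subalgebra.coe_add, Polynomial.coeff_add]
    exact add_mem (hp n) (hq n)
  smul_mem' := fun c p hp n => by
    rw [smul_eq_mul, Subalgebra.coe_mul, Polynomial.coeff_mul]
    refine sum_mem fun kl hkl => ?_
    rw [← HasAntidiagonal.mem_antidiagonal.1 hkl]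
    exact ic_mul_GT T ((hA _).1 c.2 _) (hp _)

/-- `x_j t` -/
noncomputable def xt (hA : ∀ p : Polynomial R, p ∈ A ↔ ∀ n, p.coeff n ∈ ic x n) (j : Fin d) : A :=
  ⟨Polynomial.monomial 1 (x j), (hA _).2 fun n => by
    rw [Polynomial.coeff_monomial]
    split_ifs with h
    · rw [← h]; exact JJ_le_ic x (x_mem x j)
    · exact zero_mem _⟩

theorem mono_mem (hA : ∀ p : Polynomial R, p ∈ A ↔ ∀ n, p.coeff n ∈ ic x n) {n : ℕ} {r : R} (hr : r ∈ ic x n) : 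
    Polynomial.monomial n r ∈ A := (hA _).2 fun k => by
  rw [Polynomial.coeff_monomial]
  split_ifs with h
  · rw [← h]; exact hr
  · exact zero_mem _

theorem GI_eq (hA : ∀ p : Polynomial R, p ∈ A ↔ ∀ n, p.coeff n ∈ ic x n)
    (hK : ∀ p : A, p ∈ K ↔ ∀ n, (p : Polynomial R).coeff n ∈ ic x (n + 1)) (T : Set (Fin d)) :
    Ideal.span (xt hA '' T) ⊔ K = GI hA T := by
  apply le_antisymm
  · refine sup_le ?_ ?_
    · rw [Ideal.span_le]
      rintro _ ⟨j, hj, rfl⟩ n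
      rw [xt, Polynomial.coeff_monomial]
      split_ifs with h
      · rw [← h]
        refine Ideal.mem_sup_right ?_
        rw [Nat.sub_self, ic_zero, Ideal.mul_top]
        exact Ideal.subset_span ⟨j, hj, rfl⟩
      · exact zero_mem _
    · intro p hp n
      exact Ideal.mem_sup_left ((hK p).1 hp n)
  · have hq : ∀ n : ℕ, ∀ q ∈ QQ x T * ic x n, ∃ g : A, g ∈ Ideal.span (xt hA '' T) ∧ (g : Polynomial R) = Polynomial.monomial (n + 1) q := by
      intro n q hq
      refine Submodule.mul_induction_on hq ?_ ?_
      · intro r hr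
        refine Submodule.span_induction (p := fun r _ => ∀ y ∈ ic x n, ∃ g : A, g ∈ Ideal.span (xt hA '' T) ∧ 
          (g : Polynomial R) = Polynomial.monomial (n + 1) (r * y)) ?_ ?_ ?_ ?_ hr
        · rintro _ ⟨j, hj, rfl⟩ y hy
          refine ⟨⟨_, mono_mem hA hy⟩ * xt hA j, Ideal.mul_mem_left _ _ (Ideal.subset_span ⟨j, hj, rfl⟩), ?_⟩
          rw [Subalgebra.coe_mul, xt, Polynomial.monomial_mul_monomial, mul_comm y]
        · intro y _
          exact ⟨0, zero_mem _, by simp⟩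
        · intro r s _ _ h1 h2 y hy
          obtain ⟨g, hg, hg'⟩ := h1 y hy
          obtain ⟨f, hf, hf'⟩ := h2 y hy
          exact ⟨g + f, add_mem hg hf, by rw [Subalgebra.coe_add, hg', hf', add_mul, map_add]⟩
        · intro a r _ h1 y hy
          obtain ⟨g, hg, hg'⟩ := h1 (a * y) (Ideal.mul_mem_left _ _ hy)
          exact ⟨g, hg, by rw [hg', smul_eq_mul, mul_left_comm, mul_assoc]⟩
      · rintro r s ⟨g, hg, hg'⟩ ⟨f, hf, hf'⟩
        exact ⟨g + f, add_mem hg hf, by rw [Subalgebra.coe_add, hg', hf', map_add]⟩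
    have hmK : ∀ (n : ℕ) (r : R), r ∈ ic x (n + 1) → ∃ g : A, g ∈ K ∧ (g : Polynomial R) = Polynomial.monomial n r := by
      intro n r hr
      refine ⟨⟨_, mono_mem hA (ic_anti x (Nat.le_succ n) hr)⟩, (hK _).2 fun k => ?_, rfl⟩
      rw [Polynomial.coeff_monomial]
      split_ifs with h
      · rw [← h]; exact hr
      · exact zero_mem _
    have hm : ∀ (n : ℕ) (r : R), r ∈ GT x T n → ∃ g : A, g ∈ Ideal.span (xt hA '' T) ⊔ K ∧ (g : Polynomial R) = Polynomial.monomial n r := by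
      intro n r hr
      rcases n with _ | n
      · rw [GT_zero] at hr
        obtain ⟨g, hg, hg'⟩ := hmK 0 r hr
        exact ⟨g, Ideal.mem_sup_right hg, hg'⟩
      · rw [GT_succ] at hr
        obtain ⟨p, hp, q, hq', rfl⟩ := Submodule.mem_sup.1 hr
        obtain ⟨g, hg, hg'⟩ := hmK _ p hp
        obtain ⟨f, hf, hf'⟩ := hq n q hq'
        exact ⟨g + f, add_mem (Ideal.mem_sup_right hg) (Ideal.mem_sup_left hf), by rw [Subalgebra.coe_add, hg', hf', map_add]⟩
    intro p hp
    choose g hg hg' using fun n => hm n _ (hp n)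
    have : p = ∑ n ∈ (p : Polynomial R).support, g n := by
      apply Subtype.ext
      rw [AddSubmonoidClass.coe_finsetSum]
      conv_lhs => rw [(p : Polynomial R).as_sum_support]
      exact sum_congr rfl fun n _ => (hg' n).symm
    rw [this]
    exact sum_mem fun n _ => hg n

theorem reg_gen {S : Type*} [CommRing S] (rs : List S) 
    (h1 : ∀ (i : ℕ) (hi : i < rs.length) (f : S), rs[i] * f ∈ Ideal.ofList (rs.take i) → f ∈ Ideal.ofList (rs.take i))
    (h2 : (1 : S) ∉ Ideal.ofList rs) : RingTheory.Sequence.IsRegular S rs := by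
  have e : ∀ I : Ideal S, (I • ⊤ : Submodule S S) = I := fun I => by
    rw [smul_eq_mul]; exact Ideal.mul_top I
  refine ⟨⟨fun i hi => ?_⟩, ?_⟩
  · rw [isSMulRegular_quotient_iff_mem_of_smul_mem, e]
    exact h1 i hi
  · rw [e]
    intro h
    rw [← h] at h2
    exact h2 trivial

theorem depth_rs {S : Type*} [CommRing S] (M : Ideal S) (rs : List S) (hM : ∀ y ∈ rs, y ∈ M)
    (h1 : ∀ (i : ℕ) (hi : i < rs.length) (f : S), rs[i] * f ∈ Ideal.ofList (rs.take i) → f ∈ Ideal.ofList (rs.take i))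
    (h2 : (1 : S) ∉ Ideal.ofList rs) : (rs.length : ℕ∞) ≤ rdepth S M S :=
  le_sSup ⟨rs, rfl, hM, reg_gen rs h1 h2⟩

theorem depth_gen {B : Type*} [CommRing B] (K M : Ideal B) (l : List B) (hM : ∀ y ∈ l, y ∈ M)
    (h1 : ∀ (i : ℕ) (hi : i < l.length) (f : B), l[i] * f ∈ Ideal.ofList (l.take i) ⊔ K → f ∈ Ideal.ofList (l.take i) ⊔ K)
    (h2 : (1 : B) ∉ Ideal.ofList l ⊔ K) : (l.length : ℕ∞) ≤ rdepth (B ⧸ K) (M.map (Ideal.Quotient.mk K)) (B ⧸ K) := by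
  have h := depth_rs (M.map (Ideal.Quotient.mk K)) (l.map (Ideal.Quotient.mk K)) (by
    intro z hz
    obtain ⟨y, hy, rfl⟩ := List.mem_map.1 hz
    exact Ideal.mem_map_of_mem _ (hM y hy)) (by
    intro i hi f hf
    obtain ⟨f, rfl⟩ := Ideal.Quotient.mk_surjective f
    rw [List.length_map] at hi
    rw [List.getElem_map, ← map_mul] at hf
    rw [← List.map_take, ← Ideal.map_ofList, Ideal.mem_quotient_iff_mem_sup] at hf ⊢
    exact h1 i hi f hf) (by
    rw [← map_one (Ideal.Quotient.mk K), ← Ideal.map_ofList, Ideal.mem_quotient_iff_mem_sup]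
    exact h2)
  rw [List.length_map] at h
  exact h

theorem depth_ge [IsLocalRing R] [IsNoetherianRing R] (hx : QR x) (hm : JJ x ≤ maximalIdeal R) {i0 : Fin d} (hV : VV x i0) 
    (hA : ∀ p : Polynomial R, p ∈ A ↔ ∀ n, p.coeff n ∈ ic x n)
    (hK : ∀ p : A, p ∈ K ↔ ∀ n, (p : Polynomial R).coeff n ∈ ic x (n + 1)) (MG : Ideal A)
    (hMG : ∀ p : A, p ∈ MG ↔ (p : Polynomial R).coeff 0 ∈ maximalIdeal R) : 
    ((d - 1 : ℕ) : ℕ∞) ≤ rdepth (A ⧸ K) (MG.map (Ideal.Quotient.mk K)) (A ⧸ K) := by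
  classical
  obtain ⟨l, hl⟩ : ∃ l : List (Fin d), l = (Finset.univ.erase i0).toList := ⟨_, rfl⟩
  have hnd : l.Nodup := by rw [hl]; exact Finset.nodup_toList _
  have hl0 : i0 ∉ l := by simp [hl]
  have hlen : l.length = d - 1 := by
    rw [hl, Finset.length_toList, Finset.card_erase_of_mem (Finset.mem_univ _), Finset.card_univ, Fintype.card_fin]
  have hof : ∀ l' : List (Fin d), Ideal.ofList (l'.map (xt hA)) ⊔ K = GI hA {i | i ∈ l'} := by
    intro l'
    rw [← GI_eq hA hK]
    have : {r | r ∈ l'.map (xt hA)} = xt hA '' {i | i ∈ l'} := by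
      ext r; simp
    rw [Ideal.ofList, this]
  have h := depth_gen K MG (l.map (xt hA)) (by
    intro y hy
    obtain ⟨j, hj, rfl⟩ := List.mem_map.1 hy
    refine (hMG _).2 ?_
    rw [xt, Polynomial.coeff_monomial]
    simp) (by
    intro i hi f hf
    rw [List.length_map] at hi
    rw [List.getElem_map] at hf
    rw [← List.map_take, hof] at hf ⊢
    intro n
    have h1 := hf (n + 1)
    rw [Subalgebra.coe_mul, xt, Polynomial.coeff_monomial_mul, GT_succ] at h1
    refine colon_lem hx hm hV ?_ ?_ ?_ ((hA _).1 f.2 n) h1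
    · intro j hj hj0
      exact hl0 (hj0 ▸ List.mem_of_mem_take hj)
    · intro hmem
      obtain ⟨j, hj, hj'⟩ := List.mem_take_iff_getElem.1 hmem
      have := (hnd.getElem_inj_iff).1 hj'
      omega
    · intro h
      exact hl0 (h ▸ List.getElem_mem hi)) (by
    intro h1
    rw [hof] at h1
    have h2 := h1 0
    rw [GT_zero, Subalgebra.coe_one, Polynomial.coeff_one_zero] at h2
    exact (Ideal.ne_top_iff_one _).1 (maximalIdeal.isMaximal R).ne_top (ic_one_le hm h2))
  rw [List.length_map, hlen] at h
  exact h

end P22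
end DA

namespace DA
section P23
open IsLocalRing Finset

theorem qlen_fin {R : Type*} [CommRing R] [IsLocalRing R] [IsNoetherianRing R] {b : Ideal R} {k : ℕ} (hk : maximalIdeal R ^ k ≤ b) : 
    ∃ r0 : ℕ, qlen b = r0 := by
  have hk1 : maximalIdeal R ^ (k + 1) ≤ b := (Ideal.pow_le_pow_right (Nat.le_succ k)).trans hk
  have h1 : IsArtinianRing (R ⧸ maximalIdeal R ^ (k + 1)) :=
    IsLocalRing.quotient_artinian_of_mem_minimalPrimes_of_isLocalRing _ 
      ⟨⟨inferInstance, Ideal.pow_le_self (Nat.succ_ne_zero k)⟩, fun p hp _ => hp.1.le_of_pow_le hp.2⟩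
  have h2 : IsArtinian R (R ⧸ maximalIdeal R ^ (k + 1)) := 
    isArtinian_of_surjective_algebraMap (R := R ⧸ maximalIdeal R ^ (k + 1)) Ideal.Quotient.mk_surjective
  have h3 : qlen (maximalIdeal R ^ (k + 1)) ≠ ⊤ := Module.length_ne_top
  obtain ⟨r, hr⟩ := ENat.ne_top_iff_exists.1 (ne_top_of_le_ne_top h3 (qlen_mono hk1))
  exact ⟨r, hr.symm⟩

theorem main_thm
    {R : Type*} [CommRing R] [IsLocalRing R] [IsNoetherianRing R]
    {d : ℕ} (hd2 : 2 ≤ d) (hdim : ringKrullDim R = d)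
    (hCM : IsCMLocal R) (hAU : AnalyticallyUnramified R)
    (hres : Infinite (ResidueField R))
    {I J : Ideal R} (hI : IsMPrimary I) (hJ : IsMinimalReduction d J I)
    {L : ℕ → ℕ} {e : ℕ → ℤ} (hHilb : NormalHilbertData d I L e)
    (he1 : e 1 ≤ e 0 - L 0 + 1) : 
    ∃ (x : Fin d → R) (i0 : Fin d), QR x ∧ JJ x ≤ maximalIdeal R ∧ VV x i0 ∧ ∀ n, intCl (I ^ n) = ic x n := by
  have hd : 0 < d := by omega
  obtain ⟨hJI, ⟨x, rfl⟩, N, hN⟩ := hJ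
  obtain ⟨hL1, N', hL2⟩ := hHilb
  change JJ x ≤ I at hJI
  change ∀ n ≥ N, I ^ (n + 1) = JJ x * I ^ n at hN
  have hIm : I ≤ maximalIdeal R := by
    rw [← hI]; exact Ideal.le_radical
  have hm : JJ x ≤ maximalIdeal R := hJI.trans hIm
  obtain ⟨k0, hk0⟩ := I.exists_radical_pow_le_of_fg (IsNoetherian.noetherian _)
  rw [hI] at hk0
  obtain ⟨k, hk⟩ : ∃ k, maximalIdeal R ^ k ≤ JJ x := by
    refine ⟨k0 * (N + 1), ?_⟩
    rw [pow_mul]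
    refine (Ideal.pow_right_mono hk0 _).trans ?_
    rw [hN N le_rfl]
    exact Ideal.mul_le_left
  have hQ : ∀ y : Fin d → R, JJ y = JJ x → QR y := fun y hy =>
    QR_of_CM hdim hCM y (by rw [hy]; exact hm) k (by rw [hy]; exact hk)
  have hx := hQ x rfl
  obtain ⟨r0, hr0⟩ := qlen_fin hk
  have hic := intCl_eq_ic hx hd hm hJI hN
  have hL : ∀ n, qlen (ic x (n + 1)) = L n := by
    intro n
    have h1 := hL1 n
    rw [hic, mlen, ← Module.coe_length] at h1
    exact WithBot.coe_injective h1
  have hch : ∀ k, ∃ N, ic x N ≤ maximalIdeal R ^ k := 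
    chevalley hAU (ic x) (fun a b h => ic_anti x h) r0 fun n w hw => Ideal.pow_right_mono hm n (pow_r0 hd hx hm hr0 hw)
  obtain ⟨c, hc⟩ := linear_bound hd hx hk hr0 hch hm
  have h0 : e 0 = r0 := by
    refine e0_eq (c := c) hd hL2 (fun n => ?_) (fun n => ?_)
    · have h1 := qlen_mono (pow_le_ic x (n + 1))
      rw [hL, qlen_pow hd hx, hr0, show n + 1 + d - 1 = n + d by omega] at h1
      exact_mod_cast h1
    · have h1 := qlen_mono (hc (n + 1))
      rw [show n + 1 + c = n + c + 1 by omega, hL, qlen_pow hd hx, hr0, show n + 1 + d - 1 = n + d by omega] at h1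
      exact_mod_cast h1
  have hsym : ∀ n, (n + d - 1).choose n = (n + d - 1).choose (d - 1) := fun n => 
    Nat.choose_symm_of_eq_add (by omega)
  have hNT : NT x := by
    intro c hc
    refine no_two hd2 hL2 h0 he1 c fun n => ?_
    have h1 := hc n
    rw [BB, qlen_mul_pow hd hx (JJ_le_ic x), card_mon, hL, hr0, add_comm d n, hsym n, hsym (n + c), 
      show qlen (ic x 1) = L 0 from hL 0] at h1
    exact_mod_cast h1
  obtain ⟨y, hy, hV⟩ := exists_VV hd hQ hm hk hNT ⟨0, hd⟩
  exact ⟨y, ⟨0, hd⟩, hQ y hy, by rw [hy]; exact hm, hV, fun n => by rw [hic, ic_congr hy]⟩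

end P23
end DA

set_option synthInstance.maxHeartbeats 1000000
set_option maxHeartbeats 2000000

open IsLocalRing Polynomial Finset

variable {R : Type*}

theorem depth_agr_almost_maximal_e1
    (R : Type*) [CommRing R] [IsLocalRing R] [IsNoetherianRing R]
    (d : ℕ) (hd : 0 < d) (hdim : ringKrullDim R = d)
    (hCM : IsCMLocal R) (hAU : AnalyticallyUnramified R)
    (hres : Infinite (ResidueField R))
    (I J : Ideal R) (hI : IsMPrimary I) (hJ : IsMinimalReduction d J I)
    (L : ℕ → ℕ) (e : ℕ → ℤ) (hHilb : NormalHilbertData d I L e)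
    -- ē₁ ≤ e₀ − λ(R/Ī) + 1
    (he1 : e 1 ≤ e 0 - L 0 + 1)
    -- the Rees algebra of the normal filtration and its associated graded ring
    (A : Subalgebra R (Polynomial R))
    (hA : ∀ p : Polynomial R, p ∈ A ↔ ∀ n, p.coeff n ∈ intCl (I ^ n))
    (K : Ideal A)
    (hK : ∀ p : A, p ∈ K ↔ ∀ n, (p : Polynomial R).coeff n ∈ intCl (I ^ (n + 1)))
    (MG : Ideal A)
    (hMG : ∀ p : A, p ∈ MG ↔ (p : Polynomial R).coeff 0 ∈ maximalIdeal R) :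
    -- depth Ḡ ≥ d − 1
    ((d - 1 : ℕ) : ℕ∞) ≤ rdepth (A ⧸ K) (MG.map (Ideal.Quotient.mk K)) (A ⧸ K) := by
  rcases Nat.lt_or_ge d 2 with h | hd2
  · have h1 : d - 1 = 0 := by omega
    rw [h1]
    exact zero_le
  · obtain ⟨x, i0, hx, hm, hV, hic⟩ := DA.main_thm hd2 hdim hCM hAU hres hI hJ hHilb he1
    exact DA.depth_ge hx hm hV (fun p => by simp only [hA, hic]) (fun p => by simp only [hK, hic]) MG hMG
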